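/- Let 0 < α < 1/2 and α < β < 1. Let f : I × I → ℝ be Hölder continuous with ∫ f dν = 0. Then there exists σ² ≥ 0 such that the distributions of (1/√n) S_n f under ν converge weakly, as n → ∞, to the Gaussian law N(0,σ²) (the Dirac mass at 0 if σ² = 0). -/

import Mathlib

open MeasureTheory Filter Set Topology

noncomputable section

/-- The Liverani–Saussol–Vaienti map `T_a` on `[0,1]`. -/
def lsv (a x : ℝ) : ℝ := if x ≤ 1 / 2 then x * (1 + (2 : ℝ) ^ a * x ^ a) else 2 * x - 1

/-- Random parameter selection: `α` on `[0,p₁)`, `β` on `[p₁,1]`. -/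
def alphaOf (α β p₁ ω : ℝ) : ℝ := if ω < p₁ then α else β

/-- The noise dynamics `φ` on `[0,1]`. -/
def phiMap (p₁ ω : ℝ) : ℝ := if ω < p₁ then ω / p₁ else (ω - p₁) / (1 - p₁)

/-- The skew product `S(x,ω) = (T_{α(ω)} x, φ ω)`. -/
def skewLSV (α β p₁ : ℝ) (p : ℝ × ℝ) : ℝ × ℝ :=
  (lsv (alphaOf α β p₁ p.2) p.1, phiMap p₁ p.2)

/-- The base of inducing, `Δ₀ = (1/2,1] × [0,1]`. -/
def Δ0 : Set (ℝ × ℝ) := Ioc (1 / 2 : ℝ) 1 ×ˢ Icc (0 : ℝ) 1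

/-- Birkhoff sums `S_n f` of the skew product. -/
def birkhoff (α β p₁ : ℝ) (f : ℝ × ℝ → ℝ) (n : ℕ) (p : ℝ × ℝ) : ℝ :=
  ∑ k ∈ Finset.range n, f ((skewLSV α β p₁)^[k] p)

section AbstractCLT

variable {Ω : Type*} [MeasurableSpace Ω] {ν : Measure Ω} [IsProbabilityMeasure ν] {S : Ω → Ω}

omit [IsProbabilityMeasure ν] in
lemma MeasureTheory.MeasurePreserving.integral_comp_aesm {E : Type*} [NormedAddCommGroup E]
    [NormedSpace ℝ E] (hS : MeasurePreserving S ν ν) {G : Ω → E} (hG : AEStronglyMeasurable G ν) :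
    ∫ q, G (S q) ∂ν = ∫ q, G q ∂ν := by
  conv_rhs => rw [← hS.map_eq]
  rw [integral_map hS.aemeasurable (by rwa [hS.map_eq])]

omit [IsProbabilityMeasure ν] in
lemma MeasureTheory.MeasurePreserving.integrable_comp_self {E : Type*} [NormedAddCommGroup E]
    (hS : MeasurePreserving S ν ν) {G : Ω → E} (hG : Integrable G ν) :
    Integrable (fun q => G (S q)) ν :=
  hS.integrable_comp_of_integrable hG

lemma integral_abs_le_norm_Lp_two (u : Lp ℝ 2 ν) : ∫ q, |u q| ∂ν ≤ ‖u‖ := by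
  have h1 : ∫ q, |u q| ∂ν = (eLpNorm u 1 ν).toReal := by
    rw [eLpNorm_one_eq_lintegral_enorm,
      ← integral_norm_eq_lintegral_enorm (Lp.aestronglyMeasurable u)]
    rfl
  rw [h1, Lp.norm_def]
  apply ENNReal.toReal_mono (Lp.eLpNorm_ne_top u)
  exact eLpNorm_le_eLpNorm_of_exponent_le (by norm_num) (Lp.aestronglyMeasurable u)

/-- The mean ergodic theorem in `L¹`, for square integrable observables. -/
lemma tendsto_integral_abs_average_sub (hS : Ergodic S ν) {φ : Ω → ℝ} (hφ : MemLp φ 2 ν) :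
    Tendsto (fun n : ℕ => ∫ q, |(∑ k ∈ Finset.range n, φ (S^[k] q)) / n - ∫ q, φ q ∂ν| ∂ν) atTop
      (𝓝 0) := by
  have hmp := hS.toMeasurePreserving
  let U : Lp ℝ 2 ν →L[ℝ] Lp ℝ 2 ν :=
    (Lp.compMeasurePreservingₗᵢ ℝ S hmp).toContinuousLinearMap
  have hUn : ‖U‖ ≤ 1 := LinearIsometry.norm_toContinuousLinearMap_le _
  have hU : ∀ u : Lp ℝ 2 ν, U u = Lp.compMeasurePreserving S hmp u := fun u => rfl
  set x : Lp ℝ 2 ν := hφ.toLp φ with hx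
  have hlim := ContinuousLinearMap.tendsto_birkhoffAverage_orthogonalProjection U hUn x
  set y0 := (U.eqLocus (1 : Lp ℝ 2 ν →L[ℝ] Lp ℝ 2 ν)).orthogonalProjectionOnto x with hy0
  have hfix : U (y0 : Lp ℝ 2 ν) = y0 := y0.2
  obtain ⟨c, hc⟩ : ∃ c : ℝ, (y0 : Lp ℝ 2 ν) =ᵐ[ν] Function.const Ω c := by
    refine hS.ae_eq_const_of_ae_eq_comp_ae (Lp.aestronglyMeasurable _) ?_
    have := Lp.coeFn_compMeasurePreserving (y0 : Lp ℝ 2 ν) hmp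
    rw [← hU, hfix] at this
    exact this.symm
  have hiter : ∀ n, U^[n] x = (hφ.comp_measurePreserving (hmp.iterate n)).toLp _ := by
    intro n
    have h1 : U^[n] x = (Lp.compMeasurePreserving S hmp)^[n] x := rfl
    rw [h1, Lp.compMeasurePreserving_iterate hmp n]
    rfl
  have havg : ∀ n : ℕ, (birkhoffAverage ℝ U _root_.id n x : Lp ℝ 2 ν) =ᵐ[ν]
      fun q => (∑ k ∈ Finset.range n, φ (S^[k] q)) / n := by
    intro n
    have h1 : birkhoffAverage ℝ U _root_.id n x = (n : ℝ)⁻¹ • ∑ k ∈ Finset.range n, U^[k] x := rfl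
    rw [h1]
    have h2 := Lp.coeFn_smul (n : ℝ)⁻¹ (∑ k ∈ Finset.range n, U^[k] x)
    have h3 := Lp.coeFn_fun_finsetSum (f := fun k => U^[k] x) (Finset.range n)
    have h4 : ∀ᵐ q ∂ν, ∀ k : ℕ, (U^[k] x) q = φ (S^[k] q) := by
      rw [ae_all_iff]
      intro k
      rw [hiter k]
      exact (hφ.comp_measurePreserving (hmp.iterate k)).coeFn_toLp
    filter_upwards [h2, h3, h4] with q q2 q3 q4
    rw [q2, Pi.smul_apply, q3, smul_eq_mul, Finset.sum_congr rfl fun k _ => q4 k, div_eq_inv_mul]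
  have hconv : Tendsto (fun n : ℕ => ∫ q, |(∑ k ∈ Finset.range n, φ (S^[k] q)) / n - c| ∂ν)
      atTop (𝓝 0) := by
    have h0 : Tendsto (fun n : ℕ => ‖birkhoffAverage ℝ U _root_.id n x - y0‖) atTop (𝓝 0) := by
      rw [← tendsto_iff_norm_sub_tendsto_zero]
      exact hlim
    refine squeeze_zero (fun n => integral_nonneg fun q => abs_nonneg _) (fun n => ?_) h0
    refine le_trans (le_of_eq ?_) (integral_abs_le_norm_Lp_two _)
    apply integral_congr_ae
    filter_upwards [havg n, hc, Lp.coeFn_sub (birkhoffAverage ℝ U _root_.id n x) (y0 : Lp ℝ 2 ν)]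
      with q q1 q2 q3
    rw [q3, Pi.sub_apply, q1, q2]
    rfl
  have hφi : Integrable φ ν := hφ.integrable (by norm_num)
  have hsumint : ∀ n : ℕ, Integrable (fun q => ∑ k ∈ Finset.range n, φ (S^[k] q)) ν := fun n =>
    integrable_finsetSum _ fun k _ => (hmp.iterate k).integrable_comp_of_integrable hφi
  have hce : ∫ q, φ q ∂ν = c := by
    have h1 : ∀ n : ℕ, 1 ≤ n → |(∫ q, φ q ∂ν) - c| ≤
        ∫ q, |(∑ k ∈ Finset.range n, φ (S^[k] q)) / n - c| ∂ν := by
      intro n hn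
      have h2 : ∫ q, ((∑ k ∈ Finset.range n, φ (S^[k] q)) / n - c) ∂ν = (∫ q, φ q ∂ν) - c := by
        rw [integral_sub ((hsumint n).div_const _) (integrable_const _), integral_div,
          integral_finsetSum _ fun k _ => (hmp.iterate k).integrable_comp_self hφi]
        have h3 : ∀ k ∈ Finset.range n, ∫ q, φ (S^[k] q) ∂ν = ∫ q, φ q ∂ν := fun k _ =>
          (hmp.iterate k).integral_comp_aesm hφi.aestronglyMeasurable
        rw [Finset.sum_congr rfl h3]
        have : (n : ℝ) ≠ 0 := by positivity
        simp [this]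
      rw [← h2]
      exact abs_integral_le_integral_abs
    have h2 : |(∫ q, φ q ∂ν) - c| ≤ 0 :=
      ge_of_tendsto hconv (eventually_atTop.2 ⟨1, h1⟩)
    exact sub_eq_zero.1 (abs_eq_zero.1 (le_antisymm h2 (abs_nonneg _)))
  rw [hce]
  exact hconv

end AbstractCLT

section HittingSystem

variable {Ω : Type*} [MeasurableSpace Ω]

/-- `τ` is the hitting time of `Y` under the dynamics `S` on the forward invariant set `X`. -/
structure HittingSystem (S : Ω → Ω) (X Y : Set Ω) (τ : Ω → ℕ) : Prop where
  mapsTo : ∀ q ∈ X, S q ∈ X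
  subset : Y ⊆ X
  zero : ∀ q ∈ Y, τ q = 0
  succ : ∀ q ∈ X, q ∉ Y → τ q = τ (S q) + 1
  measY : MeasurableSet Y
  measS : Measurable S
  measτ : Measurable τ

/-- The point of the orbit of `q` at time `τ q`. -/
def hitMap (S : Ω → Ω) (τ : Ω → ℕ) (q : Ω) : Ω := S^[τ q] q

namespace HittingSystem

variable {S : Ω → Ω} {X Y : Set Ω} {τ : Ω → ℕ}

lemma hitMap_of_mem (h : HittingSystem S X Y τ) {q : Ω} (hq : q ∈ Y) : hitMap S τ q = q := by
  simp [hitMap, h.zero q hq]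

lemma hitMap_of_notMem (h : HittingSystem S X Y τ) {q : Ω} (hq : q ∈ X) (hq' : q ∉ Y) :
    hitMap S τ q = hitMap S τ (S q) := by
  simp [hitMap, h.succ q hq hq', Function.iterate_succ_apply]

lemma induction_on (h : HittingSystem S X Y τ) {P : Ω → Prop} (h0 : ∀ q ∈ Y, P q)
    (h1 : ∀ q ∈ X, q ∉ Y → P (S q) → P q) : ∀ q ∈ X, P q := by
  have : ∀ n, ∀ q ∈ X, τ q = n → P q := by
    intro n
    induction n with
    | zero =>
      intro q hq hn
      by_cases hY : q ∈ Y
      · exact h0 q hY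
      · have := h.succ q hq hY
        omega
    | succ n ih =>
      intro q hq hn
      by_cases hY : q ∈ Y
      · exact h0 q hY
      · have := h.succ q hq hY
        exact h1 q hq hY (ih _ (h.mapsTo q hq) (by omega))
  exact fun q hq => this _ q hq rfl

lemma hitMap_mem (h : HittingSystem S X Y τ) : ∀ q ∈ X, hitMap S τ q ∈ Y :=
  h.induction_on (fun q hq => by rwa [h.hitMap_of_mem hq]) fun q hq hq' ih => by
    rwa [h.hitMap_of_notMem hq hq']

lemma measurable_hitMap (h : HittingSystem S X Y τ) : Measurable (hitMap S τ) := by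
  have h1 : Measurable (fun p : ℕ × Ω => S^[p.1] p.2) :=
    measurable_from_prod_countable_right fun n => h.measS.iterate n
  exact h1.comp (h.measτ.prodMk measurable_id)

lemma shift_eq {E : Type*} (h : HittingSystem S X Y τ) {A : ℕ → Ω → E}
    (hA0 : ∀ q q', A 0 q = A 0 q') (hA : ∀ k, ∀ q ∈ X, q ∉ Y → A (k + 1) q = A k (S q)) :
    ∀ q ∈ X, ∀ k, A k q = A (k - τ q) (hitMap S τ q) := by
  refine h.induction_on (fun q hq k => ?_) fun q hq hq' ih k => ?_
  · rw [h.hitMap_of_mem hq, h.zero q hq, Nat.sub_zero]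
  · rw [h.hitMap_of_notMem hq hq', h.succ q hq hq']
    rcases k with _ | k
    · simpa using hA0 _ _
    · rw [hA k q hq hq', ih k, Nat.add_sub_add_right]

section
variable {ν : Measure Ω} [IsFiniteMeasure ν]

lemma integral_return (h : HittingSystem S X Y τ) (hS : MeasurePreserving S ν ν) (hX : ν Xᶜ = 0)
    {G : Ω → ℝ} (hG : Measurable G) (hGb : ∃ b, ∀ q, |G q| ≤ b) :
    ∫ p in Y, G (hitMap S τ (S p)) ∂ν = ∫ p in Y, G p ∂ν := by
  obtain ⟨b, hb⟩ := hGb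
  have hmeas : Measurable (fun q => G (hitMap S τ q)) := hG.comp h.measurable_hitMap
  have hInt : Integrable (fun q => G (hitMap S τ q)) ν :=
    Integrable.of_bound hmeas.aestronglyMeasurable b (Eventually.of_forall fun q => hb _)
  have hInt' : Integrable (fun q => G (hitMap S τ (S q))) ν := hS.integrable_comp_self hInt
  have h1 := hS.integral_comp_aesm hInt.aestronglyMeasurable
  rw [← integral_add_compl h.measY hInt', ← integral_add_compl h.measY hInt] at h1
  have h2 : ∫ p in Yᶜ, G (hitMap S τ (S p)) ∂ν = ∫ p in Yᶜ, G (hitMap S τ p) ∂ν := by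
    apply setIntegral_congr_ae h.measY.compl
    filter_upwards [compl_mem_ae_iff.2 hX] with q hq hq'
    rw [h.hitMap_of_notMem (by simpa using hq) hq']
  have h3 : ∫ p in Y, G (hitMap S τ p) ∂ν = ∫ p in Y, G p ∂ν :=
    setIntegral_congr_fun h.measY fun q hq => by simp only [h.hitMap_of_mem hq]
  linarith

end

end HittingSystem

lemma norm_sum_shift_sub_le {E : Type*} [NormedAddCommGroup E] (a : ℕ → E) (n : ℕ) {b : ℝ}
    (hb0 : 0 ≤ b)     (hb : ∀ k < n, ‖a k‖ ≤ b) (r : ℕ) :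
    ‖∑ k ∈ Finset.range n, a (k - r) - ∑ k ∈ Finset.range n, a k‖ ≤ 2 * r * b := by
  induction r with
  | zero => simp
  | succ r ih =>
    have h1 : ‖∑ k ∈ Finset.range n, a (k - (r + 1)) - ∑ k ∈ Finset.range n, a (k - r)‖
        ≤ 2 * b := by
      rcases n with _ | n
      · simpa using hb0
      · rw [Finset.sum_range_succ', Finset.sum_range_succ]
        have h2 : ∀ k ∈ Finset.range n, a (k + 1 - (r + 1)) = a (k - r) := fun k _ => by
          rw [Nat.add_sub_add_right]
        rw [Finset.sum_congr rfl h2, add_sub_add_left_eq_sub]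
        refine (norm_sub_le _ _).trans ?_
        have h3 := hb (0 - (r + 1)) (by omega)
        have h4 := hb (n - r) (by omega)
        linarith
    calc _ = ‖(∑ k ∈ Finset.range n, a (k - (r + 1)) - ∑ k ∈ Finset.range n, a (k - r)) +
          (∑ k ∈ Finset.range n, a (k - r) - ∑ k ∈ Finset.range n, a k)‖ := by congr 1; abel
      _ ≤ 2 * b + 2 * r * b := (norm_add_le _ _).trans (add_le_add h1 ih)
      _ = _ := by push_cast; ring

end HittingSystem

section ReturnMartingale

variable {Ω : Type*} [MeasurableSpace Ω] {ν : Measure Ω} [IsProbabilityMeasure ν]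
  {S : Ω → Ω} {X Y : Set Ω} {τ : Ω → ℕ}

/-- `N` is orthogonal, over `Y`, to all functions of the first return to `Y`. -/
def ReturnOrthogonal (ν : Measure Ω) (S : Ω → Ω) (Y : Set Ω) (τ : Ω → ℕ) (N : Ω → ℝ) : Prop :=
  ∀ G : Ω → ℝ, Measurable G → (∃ b, ∀ q, |G q| ≤ b) →
    ∫ p in Y, N p * G (hitMap S τ (S p)) ∂ν = 0

lemma ReturnOrthogonal.complex (h : HittingSystem S X Y τ) {N : Ω → ℝ} (hN : Measurable N)
    (hNb : ∃ d, ∀ q, |N q| ≤ d) (h0 : ReturnOrthogonal ν S Y τ N) {G : Ω → ℂ} (hG : Measurable G)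
    (hGb : ∃ b, ∀ q, ‖G q‖ ≤ b) :
    ∫ p in Y, (N p : ℂ) * G (hitMap S τ (S p)) ∂ν = 0 := by
  obtain ⟨b, hb⟩ := hGb
  obtain ⟨d, hd⟩ := hNb
  have hmeas : Measurable (fun p => (N p : ℂ) * G (hitMap S τ (S p))) :=
    (Complex.measurable_ofReal.comp hN).mul (hG.comp (h.measurable_hitMap.comp h.measS))
  have hInt : Integrable (fun p => (N p : ℂ) * G (hitMap S τ (S p))) (ν.restrict Y) := by
    refine Integrable.of_bound hmeas.aestronglyMeasurable (d * b) (Eventually.of_forall fun q => ?_)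
    rw [norm_mul, Complex.norm_real, Real.norm_eq_abs]
    exact mul_le_mul (hd _) (hb _) (norm_nonneg _) ((abs_nonneg _).trans (hd q))
  apply Complex.ext
  · have h1 := RCLike.re_eq_complex_re ▸ integral_re (𝕜 := ℂ) hInt
    rw [Complex.zero_re]
    refine Eq.trans (by simpa using h1.symm) ?_
    have := h0 (fun q => (G q).re) (Complex.measurable_re.comp hG)
      ⟨b, fun q => (Complex.abs_re_le_norm _).trans (hb q)⟩
    simpa using this
  · have h1 := RCLike.im_eq_complex_im ▸ integral_im (𝕜 := ℂ) hInt
    rw [Complex.zero_im]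
    refine Eq.trans (by simpa using h1.symm) ?_
    have := h0 (fun q => (G q).im) (Complex.measurable_im.comp hG)
      ⟨b, fun q => (Complex.abs_im_le_norm _).trans (hb q)⟩
    simpa using this

lemma HittingSystem.norm_sum_integral_le (h : HittingSystem S X Y τ) {N : Ω → ℝ}
    (hN : Measurable N) {d : ℝ} (hd : ∀ q, |N q| ≤ d) (h0 : ReturnOrthogonal ν S Y τ N)
    (hτ : IntegrableOn (fun p => (τ (S p) : ℝ)) Y ν) {A : ℕ → Ω → ℂ}
    (hAm : ∀ k, Measurable (A k)) (hAb : ∀ k, ∃ b, ∀ q, ‖A k q‖ ≤ b)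
    (hA0 : ∀ q q', A 0 q = A 0 q') (hA : ∀ k, ∀ q ∈ X, q ∉ Y → A (k + 1) q = A k (S q)) (n : ℕ)
    {G : Ω → ℝ} (hG : Measurable G) {b : ℝ} (hGb : ∀ q, |G q| ≤ b) (hG0 : ∀ q, 0 ≤ G q)
    (hAG : ∀ k < n, ∀ q ∈ Y, ‖A k q‖ ≤ G q) :
    ‖∑ k ∈ Finset.range n, ∫ p in Y, (N p : ℂ) * A k (S p) ∂ν‖ ≤
      ∫ p in Y, |N p| * (2 * τ (S p) * G (hitMap S τ (S p))) ∂ν := by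
  have hF : Measurable fun p => hitMap S τ (S p) := h.measurable_hitMap.comp h.measS
  have hNc : Measurable fun p => (N p : ℂ) := Complex.measurable_ofReal.comp hN
  have hInt : ∀ (k : ℕ) (R : Ω → Ω), Measurable R →
      Integrable (fun p => (N p : ℂ) * A k (R p)) (ν.restrict Y) := by
    intro k R hR
    obtain ⟨c, hc⟩ := hAb k
    refine Integrable.of_bound (hNc.mul ((hAm k).comp hR)).aestronglyMeasurable (d * c)
      (Eventually.of_forall fun q => ?_)
    rw [norm_mul, Complex.norm_real, Real.norm_eq_abs]
    exact mul_le_mul (hd _) (hc _) (norm_nonneg _) ((abs_nonneg _).trans (hd q))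
  have e1 : ∑ k ∈ Finset.range n, ∫ p in Y, (N p : ℂ) * A k (S p) ∂ν =
      ∫ p in Y, (N p : ℂ) * (∑ k ∈ Finset.range n, A k (S p)
        - ∑ k ∈ Finset.range n, A k (hitMap S τ (S p))) ∂ν := by
    simp only [mul_sub, Finset.mul_sum]
    rw [integral_sub (integrable_finsetSum _ fun k _ => hInt k S h.measS)
      (integrable_finsetSum _ fun k _ => hInt k _ hF),
      integral_finsetSum _ fun k _ => hInt k S h.measS,
      integral_finsetSum _ fun k _ => hInt k _ hF]
    rw [Finset.sum_eq_zero (s := Finset.range n)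
      (f := fun k => ∫ p in Y, (N p : ℂ) * A k (hitMap S τ (S p)) ∂ν), sub_zero]
    exact fun k _ => h0.complex h hN ⟨d, hd⟩ (hAm k) (hAb k)
  rw [e1]
  refine norm_integral_le_of_norm_le ?_ ?_
  · have : Integrable (fun p => (2 * d * b) * (τ (S p) : ℝ)) (ν.restrict Y) := hτ.const_mul _
    refine this.mono' ?_ (Eventually.of_forall fun p => ?_)
    · have : Measurable fun p => (τ (S p) : ℝ) :=
        measurable_from_top.comp (h.measτ.comp h.measS)
      exact (hN.abs.mul ((this.const_mul 2).mul (hG.comp hF))).aestronglyMeasurable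
    · simp only [norm_mul, Real.norm_eq_abs, abs_abs, Nat.abs_cast, abs_two]
      have := mul_le_mul (hd p) (hGb (hitMap S τ (S p))) (abs_nonneg _)
        ((abs_nonneg _).trans (hd p))
      calc |N p| * (2 * (τ (S p) : ℝ) * |G (hitMap S τ (S p))|)
          = 2 * (τ (S p) : ℝ) * (|N p| * |G (hitMap S τ (S p))|) := by ring
        _ ≤ 2 * (τ (S p) : ℝ) * (d * b) := by gcongr
        _ = _ := by ring
  · rw [ae_restrict_iff' h.measY]
    refine Eventually.of_forall fun p hp => ?_
    have hSp : S p ∈ X := h.mapsTo p (h.subset hp)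
    have hFp := h.hitMap_mem _ hSp
    rw [norm_mul, Complex.norm_real, Real.norm_eq_abs]
    gcongr
    rw [Finset.sum_congr rfl fun k _ => h.shift_eq hA0 hA _ hSp k]
    exact norm_sum_shift_sub_le (fun k => A k (hitMap S τ (S p))) n (hG0 _)
      (fun k hk => hAG k hk _ hFp) _

end ReturnMartingale

lemma norm_exp_mul_I_sub_le {x : ℝ} (hx : |x| ≤ 1) :
    ‖Complex.exp (x * Complex.I) - (1 + x * Complex.I) * Real.exp (-(x ^ 2) / 2)‖ ≤ 2 * |x| ^ 3 := by
  have hz : ‖(x : ℂ) * Complex.I‖ = |x| := by simp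
  have h1 := Complex.exp_bound (x := x * Complex.I) (by rwa [hz]) (n := 3) (by norm_num)
  rw [hz] at h1
  have h2 : ∑ m ∈ Finset.range 3, ((x : ℂ) * Complex.I) ^ m / (m.factorial : ℂ)
      = 1 + x * Complex.I - x ^ 2 / 2 := by
    simp only [Finset.sum_range_succ, Finset.sum_range_zero, mul_pow, Complex.I_sq]
    norm_num [Nat.factorial]
    ring
  rw [h2] at h1
  have hx2 : x ^ 2 ≤ 1 := by rw [← sq_abs]; exact pow_le_one₀ (abs_nonneg _) hx
  have h3 := Real.abs_exp_sub_one_sub_id_le (x := -(x ^ 2) / 2) (by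
    rw [abs_le]; constructor <;> nlinarith [sq_nonneg x])
  have h4 : ‖(1 : ℂ) + x * Complex.I‖ ≤ 2 := by
    refine (norm_add_le _ _).trans ?_
    rw [hz, norm_one]; linarith
  set e := Real.exp (-(x ^ 2) / 2) with he
  have h5 : Complex.exp (x * Complex.I) - (1 + x * Complex.I) * e =
      (Complex.exp (x * Complex.I) - (1 + x * Complex.I - x ^ 2 / 2))
      + (1 + x * Complex.I) * (-(e - 1 - (-(x ^ 2) / 2) : ℝ) : ℂ)
      + ((x * Complex.I) * (x ^ 2 / 2)) := by
    push_cast; ring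
  rw [h5]
  refine (norm_add₃_le).trans ?_
  have h6 : ‖(1 + (x : ℂ) * Complex.I) * (-(e - 1 - (-(x ^ 2) / 2) : ℝ) : ℂ)‖ ≤
      2 * (-(x ^ 2) / 2) ^ 2 := by
    rw [norm_mul, norm_neg, Complex.norm_real, Real.norm_eq_abs]
    exact mul_le_mul h4 h3 (abs_nonneg _) (by norm_num)
  have h7 : ‖((x : ℂ) * Complex.I) * (x ^ 2 / 2)‖ = |x| ^ 3 / 2 := by
    rw [norm_mul, hz]
    simp
    rw [show |x| ^ 3 = |x| * |x| ^ 2 by ring, sq_abs]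
    ring
  rw [h7]
  have h8 : x ^ 2 = |x| ^ 2 := (sq_abs x).symm
  have h9 : |x| ^ 4 ≤ |x| ^ 3 := pow_le_pow_of_le_one (abs_nonneg _) hx (by norm_num)
  have h10 : (-(x ^ 2) / 2) ^ 2 = |x| ^ 4 / 4 := by rw [h8]; ring
  rw [h10] at h6
  norm_num [Nat.factorial] at h1
  have h11 : 0 ≤ |x| ^ 3 := by positivity
  nlinarith

lemma norm_prod_range_sub_prod_range_le {a b : ℕ → ℂ} (n : ℕ) (ha : ∀ k < n, ‖a k‖ ≤ 1)
    (hb : ∀ k < n, ‖b k‖ ≤ 1) :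
    ‖∏ k ∈ Finset.range n, a k - ∏ k ∈ Finset.range n, b k‖ ≤
      ∑ k ∈ Finset.range n, ‖a k - b k‖ := by
  induction n with
  | zero => simp
  | succ n ih =>
    rw [Finset.prod_range_succ, Finset.prod_range_succ, Finset.sum_range_succ]
    have h1 : (∏ k ∈ Finset.range n, a k) * a n - (∏ k ∈ Finset.range n, b k) * b n =
        (∏ k ∈ Finset.range n, a k - ∏ k ∈ Finset.range n, b k) * a n +
        (∏ k ∈ Finset.range n, b k) * (a n - b n) := by ring
    rw [h1]
    refine (norm_add_le _ _).trans ?_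
    rw [norm_mul, norm_mul]
    have h2 : ‖∏ k ∈ Finset.range n, b k‖ ≤ 1 := by
      rw [norm_prod]
      exact Finset.prod_le_one (fun _ _ => norm_nonneg _)
        fun k hk => hb k ((Finset.mem_range.1 hk).trans (Nat.lt_succ_self n))
    have h3 := ih (fun k hk => ha k (hk.trans (Nat.lt_succ_self n)))
      (fun k hk => hb k (hk.trans (Nat.lt_succ_self n)))
    have h4 := ha n (Nat.lt_succ_self n)
    refine add_le_add ?_ ?_
    · exact (mul_le_of_le_one_right (norm_nonneg _) h4).trans h3
    · exact mul_le_of_le_one_left (norm_nonneg _) h2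

lemma norm_one_add_mul_I_le (x : ℝ) : ‖(1 : ℂ) + x * Complex.I‖ ≤ Real.exp (x ^ 2 / 2) := by
  have h1 : ‖(1 : ℂ) + x * Complex.I‖ ^ 2 = 1 + x ^ 2 := by
    rw [← Complex.normSq_eq_norm_sq, Complex.normSq_apply]; simp; ring
  have h2 : Real.exp (x ^ 2 / 2) ^ 2 = Real.exp (x ^ 2) := by
    rw [← Real.exp_nat_mul]; congr 1; push_cast; ring
  refine (sq_le_sq₀ (norm_nonneg _) (Real.exp_pos _).le).1 ?_
  rw [h1, h2, add_comm]
  exact Real.add_one_le_exp _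

lemma abs_exp_neg_sub_exp_neg_le {a b : ℝ} (ha : 0 ≤ a) (hb : 0 ≤ b) :
    |Real.exp (-a) - Real.exp (-b)| ≤ |a - b| := by
  have key : ∀ a b : ℝ, 0 ≤ a → a ≤ b → |Real.exp (-a) - Real.exp (-b)| ≤ |a - b| := by
    intro a b ha hab
    have h1 : Real.exp (-b) ≤ Real.exp (-a) := Real.exp_le_exp.2 (by linarith)
    rw [abs_of_nonneg (by linarith), abs_of_nonpos (by linarith)]
    have h2 := Real.add_one_le_exp (a - b)
    have h3 : Real.exp (-b) = Real.exp (-a) * Real.exp (a - b) := by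
      rw [← Real.exp_add]; congr 1; ring
    have h4 : Real.exp (-a) ≤ 1 := Real.exp_le_one_iff.2 (by linarith)
    rw [h3]
    nlinarith [Real.exp_pos (-a)]
  rcases le_total a b with h | h
  · exact key a b ha h
  · rw [abs_sub_comm, abs_sub_comm a b]; exact key b a hb h

section

variable {Ω : Type*} [MeasurableSpace Ω] {ν : Measure Ω} [IsProbabilityMeasure ν]
  {S : Ω → Ω} {X Y : Set Ω} {τ : Ω → ℕ}

/-- The partial products of `1 + c N ∘ S^k`. -/
def cocycleProd (S : Ω → Ω) (N : Ω → ℝ) (c : ℂ) (n : ℕ) (q : Ω) : ℂ :=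
  ∏ k ∈ Finset.range n, (1 + c * N (S^[k] q))

omit [MeasurableSpace Ω] in
lemma cocycleProd_succ (N : Ω → ℝ) (c : ℂ) (n : ℕ) (q : Ω) :
    cocycleProd S N c (n + 1) q = (1 + c * N q) * cocycleProd S N c n (S q) := by
  rw [cocycleProd, Finset.prod_range_succ', mul_comm]
  rfl

lemma measurable_cocycleProd (hS : Measurable S) {N : Ω → ℝ} (hN : Measurable N) (c : ℂ) (n : ℕ) :
    Measurable (cocycleProd S N c n) := by
  unfold cocycleProd
  refine Finset.measurable_fun_prod _ fun k _ => measurable_const.add (measurable_const.mul ?_)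
  exact Complex.measurable_ofReal.comp (hN.comp (hS.iterate k))

lemma HittingSystem.norm_integral_cocycleProd_sub_one_le (h : HittingSystem S X Y τ)
    (hS : MeasurePreserving S ν ν) {N : Ω → ℝ} (hN : Measurable N) {d : ℝ} (hd : ∀ q, |N q| ≤ d)
    (hNY : ∀ q ∉ Y, N q = 0) (h0 : ReturnOrthogonal ν S Y τ N)
    (hτ : IntegrableOn (fun p => (τ (S p) : ℝ)) Y ν) (c : ℂ) (n : ℕ) {B : ℝ} (hB : 0 ≤ B)
    (hWB : ∀ k ≤ n, ∀ q, ‖cocycleProd S N c k q‖ ≤ B) :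
    ‖(∫ q, cocycleProd S N c n q ∂ν) - 1‖ ≤ ‖c‖ * (2 * d * B * ∫ p in Y, (τ (S p) : ℝ) ∂ν) := by
  have hWm := measurable_cocycleProd h.measS hN c
  have hWb : ∀ k, ∃ b, ∀ q, ‖cocycleProd S N c k q‖ ≤ b := by
    intro k
    refine ⟨(1 + ‖c‖ * d) ^ k, fun q => ?_⟩
    rw [cocycleProd, norm_prod]
    refine (Finset.prod_le_prod (fun _ _ => norm_nonneg _) fun j _ =>
      (?_ : _ ≤ 1 + ‖c‖ * d)).trans (by simp)
    refine (norm_add_le _ _).trans ?_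
    rw [norm_one, norm_mul, Complex.norm_real, Real.norm_eq_abs]
    gcongr
    exact hd _
  have hWi : ∀ k, Integrable (cocycleProd S N c k) ν := fun k => by
    obtain ⟨b, hb⟩ := hWb k
    exact Integrable.of_bound (hWm k).aestronglyMeasurable b (Eventually.of_forall hb)
  have hNWi : ∀ k, Integrable (fun q => (N q : ℂ) * cocycleProd S N c k (S q)) ν := fun k => by
    obtain ⟨b, hb⟩ := hWb k
    refine Integrable.of_bound ((Complex.measurable_ofReal.comp hN).mul
      ((hWm k).comp h.measS)).aestronglyMeasurable (d * b) (Eventually.of_forall fun q => ?_)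
    rw [norm_mul, Complex.norm_real, Real.norm_eq_abs]
    exact mul_le_mul (hd _) (hb _) (norm_nonneg _) ((abs_nonneg _).trans (hd q))
  have e1 : ∀ m, ∫ q, cocycleProd S N c m q ∂ν =
      1 + c * ∑ k ∈ Finset.range m, ∫ p in Y, (N p : ℂ) * cocycleProd S N c k (S p) ∂ν := by
    intro m
    induction m with
    | zero => simp [cocycleProd]
    | succ m ih =>
      have h2 : ∫ p in Y, (N p : ℂ) * cocycleProd S N c m (S p) ∂ν =
          ∫ p, (N p : ℂ) * cocycleProd S N c m (S p) ∂ν := by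
        refine setIntegral_eq_integral_of_forall_compl_eq_zero fun q hq => ?_
        simp [hNY q hq]
      rw [Finset.sum_range_succ, mul_add, ← add_assoc, ← ih, h2, ← integral_const_mul,
        ← hS.integral_comp_aesm (hWi m).aestronglyMeasurable,
        ← integral_add (hS.integrable_comp_self (hWi m)) ((hNWi m).const_mul c)]
      refine integral_congr_ae (Eventually.of_forall fun q => ?_)
      simp only [cocycleProd_succ]
      ring
  rw [e1, add_sub_cancel_left, norm_mul]
  gcongr
  have h3 := h.norm_sum_integral_le hN hd h0 hτ hWm hWb (fun q q' => by simp [cocycleProd])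
    (fun k q _ hq' => by rw [cocycleProd_succ, hNY q hq']; simp) n (G := fun _ => B)
    measurable_const (b := B) (fun q => by rw [abs_of_nonneg hB]) (fun _ => hB)
    (fun k hk q _ => hWB k hk.le q)
  refine h3.trans ?_
  rw [← integral_const_mul]
  have hτ' : Integrable (fun p => (2 * d * B) * (τ (S p) : ℝ)) (ν.restrict Y) := hτ.const_mul _
  refine integral_mono_of_nonneg (Eventually.of_forall fun p => by positivity) hτ'
    (Eventually.of_forall fun p => ?_)
  have := hd p
  calc |N p| * (2 * (τ (S p) : ℝ) * B) ≤ d * (2 * (τ (S p) : ℝ) * B) := by gcongr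
    _ = _ := by ring

/-- The central limit theorem, in terms of characteristic functions, for a bounded
observable which is supported on `Y` and orthogonal to all functions of the first return map. -/
lemma HittingSystem.tendsto_charFun_of_bounded (h : HittingSystem S X Y τ)
    (hS : Ergodic S ν) {N : Ω → ℝ} (hN : Measurable N) {d : ℝ} (hd : ∀ q, |N q| ≤ d)
    (hNY : ∀ q ∉ Y, N q = 0) (h0 : ReturnOrthogonal ν S Y τ N)
    (hτ : IntegrableOn (fun p => (τ (S p) : ℝ)) Y ν) (t : ℝ) :
    Tendsto (fun n : ℕ => ∫ q, Complex.exp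
        ((t * ((∑ k ∈ Finset.range n, N (S^[k] q)) / Real.sqrt n) : ℝ) * Complex.I) ∂ν) atTop
      (𝓝 (Real.exp (-(t ^ 2 * (∫ q, N q ^ 2 ∂ν) / 2)) : ℝ)) := by
  have hd0 : 0 ≤ d := by
    obtain ⟨q⟩ : Nonempty Ω := nonempty_of_isProbabilityMeasure ν
    exact (abs_nonneg _).trans (hd q)
  set σ2 := ∫ q, N q ^ 2 ∂ν with hσ
  have hσ0 : 0 ≤ σ2 := integral_nonneg fun q => sq_nonneg _
  set B := Real.exp (t ^ 2 * d ^ 2 / 2) with hB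
  set I1 := ∫ p in Y, (τ (S p) : ℝ) ∂ν
  let avg : ℕ → Ω → ℝ := fun n q => (∑ k ∈ Finset.range n, N (S^[k] q) ^ 2) / n
  have hsq : MemLp (fun q => N q ^ 2) 2 ν := by
    refine MemLp.of_bound (hN.pow_const 2).aestronglyMeasurable (d ^ 2)
      (Eventually.of_forall fun q => ?_)
    rw [Real.norm_eq_abs, abs_pow]
    exact pow_le_pow_left₀ (abs_nonneg _) (hd q) 2
  have herg := tendsto_integral_abs_average_sub hS hsq
  have hsum : ∀ n : ℕ, Measurable (fun q => ∑ k ∈ Finset.range n, N (S^[k] q)) := fun n =>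
    Finset.measurable_fun_sum _ fun k _ => hN.comp (h.measS.iterate k)
  have havgm : ∀ n : ℕ, Measurable (avg n) := fun n =>
    (Finset.measurable_fun_sum _ fun k _ => (hN.comp (h.measS.iterate k)).pow_const 2).div_const _
  have havgb : ∀ n q, |avg n q| ≤ d ^ 2 := by
    intro n q
    rcases Nat.eq_zero_or_pos n with rfl | hn
    · simp only [avg, Finset.range_zero, Finset.sum_empty, zero_div, abs_zero]; positivity
    · have hn' : (0 : ℝ) < n := by exact_mod_cast hn
      rw [abs_of_nonneg (by positivity), div_le_iff₀ hn']
      refine (Finset.sum_le_card_nsmul _ _ (d ^ 2) fun k _ => ?_).trans (le_of_eq ?_)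
      · rw [← sq_abs]; exact pow_le_pow_left₀ (abs_nonneg _) (hd _) 2
      · simp [mul_comm]
  set E := Real.exp (-(t ^ 2 * σ2 / 2)) with hE
  have hE1 : E ≤ 1 := Real.exp_le_one_iff.2 (by
    have : 0 ≤ t ^ 2 * σ2 / 2 := by positivity
    linarith)
  have hbound : ∀ n : ℕ, 1 ≤ n → |t| * d / Real.sqrt n ≤ 1 →
      ‖(∫ q, Complex.exp
        ((t * ((∑ k ∈ Finset.range n, N (S^[k] q)) / Real.sqrt n) : ℝ) * Complex.I) ∂ν) - E‖ ≤
      2 * (|t| * d) ^ 3 / Real.sqrt n + B * (t ^ 2 / 2) * (∫ q, |avg n q - σ2| ∂ν) +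
        |t| / Real.sqrt n * (2 * d * B * I1) := by
    intro n hn hsmall
    have hn' : (0 : ℝ) < n := by exact_mod_cast hn
    have hs : 0 < Real.sqrt n := Real.sqrt_pos.2 hn'
    have hss : Real.sqrt n ^ 2 = n := Real.sq_sqrt hn'.le
    set c : ℂ := (t / Real.sqrt n : ℝ) * Complex.I with hc
    let x : Ω → ℕ → ℝ := fun q k => t / Real.sqrt n * N (S^[k] q)
    have hxb : ∀ q k, |x q k| ≤ |t| * d / Real.sqrt n := by
      intro q k
      simp only [x]
      rw [abs_mul, abs_div, abs_of_pos hs, div_mul_eq_mul_div]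
      gcongr
      exact hd _
    have hxsq : ∀ q k, x q k ^ 2 ≤ t ^ 2 * d ^ 2 / n := by
      intro q k
      rw [← sq_abs]
      refine (pow_le_pow_left₀ (abs_nonneg _) (hxb q k) 2).trans (le_of_eq ?_)
      rw [div_pow, hss, mul_pow, sq_abs]
    have hWeq : ∀ m q, cocycleProd S N c m q =
        ∏ k ∈ Finset.range m, (1 + (x q k : ℂ) * Complex.I) := by
      intro m q
      refine Finset.prod_congr rfl fun k _ => ?_
      simp only [x, hc]
      push_cast
      ring
    have hWB : ∀ m ≤ n, ∀ q, ‖cocycleProd S N c m q‖ ≤ B := by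
      intro m hm q
      rw [hWeq, norm_prod]
      refine (Finset.prod_le_prod (fun _ _ => norm_nonneg _) fun k _ =>
        ((norm_one_add_mul_I_le _).trans (Real.exp_le_exp.2 (div_le_div_of_nonneg_right
          (hxsq q k) two_pos.le)))).trans ?_
      rw [Finset.prod_const, Finset.card_range, ← Real.exp_nat_mul]
      refine Real.exp_le_exp.2 ?_
      have hm' : (m : ℝ) ≤ n := by exact_mod_cast hm
      calc (m : ℝ) * (t ^ 2 * d ^ 2 / n / 2) ≤ n * (t ^ 2 * d ^ 2 / n / 2) := by gcongr
        _ = _ := by field_simp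
    have hQ : ∀ q, ∏ k ∈ Finset.range n, Real.exp (-(x q k ^ 2) / 2) =
        Real.exp (-(t ^ 2 * avg n q / 2)) := by
      intro q
      rw [← Real.exp_sum]
      congr 1
      simp only [avg, x, mul_pow, div_pow, hss]
      rw [← Finset.sum_div, Finset.sum_neg_distrib, ← Finset.mul_sum]
      ring
    have hWm := measurable_cocycleProd h.measS hN c n
    have hWi : Integrable (cocycleProd S N c n) ν :=
      Integrable.of_bound hWm.aestronglyMeasurable B (Eventually.of_forall (hWB n le_rfl))
    have hp1 : ∀ q, ‖Complex.exp
        ((t * ((∑ k ∈ Finset.range n, N (S^[k] q)) / Real.sqrt n) : ℝ) * Complex.I) -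
        cocycleProd S N c n q * (Real.exp (-(t ^ 2 * avg n q / 2)) : ℝ)‖ ≤
        2 * (|t| * d) ^ 3 / Real.sqrt n := by
      intro q
      have e1 : Complex.exp
        ((t * ((∑ k ∈ Finset.range n, N (S^[k] q)) / Real.sqrt n) : ℝ) * Complex.I) =
          ∏ k ∈ Finset.range n, Complex.exp (x q k * Complex.I) := by
        rw [← Complex.exp_sum, ← Finset.sum_mul]
        congr 2
        simp only [x]
        rw [← Complex.ofReal_sum, ← Finset.mul_sum]
        congr 1
        ring
      rw [e1, hWeq, ← hQ, Complex.ofReal_prod, ← Finset.prod_mul_distrib]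
      refine (norm_prod_range_sub_prod_range_le n (fun k _ => ?_) (fun k _ => ?_)).trans ?_
      · rw [Complex.norm_exp_ofReal_mul_I]
      · rw [norm_mul, Complex.norm_real, Real.norm_eq_abs, abs_of_pos (Real.exp_pos _)]
        refine (mul_le_mul_of_nonneg_right (norm_one_add_mul_I_le _) (Real.exp_pos _).le).trans ?_
        rw [← Real.exp_add]
        refine le_of_eq (Real.exp_eq_one_iff _ |>.2 (by ring))
      · refine (Finset.sum_le_sum fun k _ => (norm_exp_mul_I_sub_le ((hxb q k).trans hsmall)).trans
          (mul_le_mul_of_nonneg_left (pow_le_pow_left₀ (abs_nonneg _) (hxb q k) 3)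
            two_pos.le)).trans (le_of_eq ?_)
        rw [Finset.sum_const, Finset.card_range, nsmul_eq_mul, div_pow]
        rw [show Real.sqrt n ^ 3 = Real.sqrt n * n by rw [pow_succ', hss]]
        field_simp
    have hp2 : ∀ q, ‖cocycleProd S N c n q * (Real.exp (-(t ^ 2 * avg n q / 2)) : ℝ) -
        cocycleProd S N c n q * (E : ℂ)‖ ≤ B * (t ^ 2 / 2) * |avg n q - σ2| := by
      intro q
      rw [← mul_sub, norm_mul, ← Complex.ofReal_sub, Complex.norm_real, Real.norm_eq_abs, mul_assoc]
      refine mul_le_mul (hWB n le_rfl q) ?_ (abs_nonneg _) (Real.exp_pos _).le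
      have ha0 : 0 ≤ avg n q := by positivity
      refine (abs_exp_neg_sub_exp_neg_le (by positivity) (by positivity)).trans (le_of_eq ?_)
      rw [← abs_of_nonneg (show 0 ≤ t ^ 2 / 2 by positivity), ← abs_mul]
      congr 1
      ring
    have hi1 : Integrable (fun q => Complex.exp
        ((t * ((∑ k ∈ Finset.range n, N (S^[k] q)) / Real.sqrt n) : ℝ) * Complex.I)) ν := by
      refine Integrable.of_bound ?_ 1 (Eventually.of_forall fun q => ?_)
      · refine (Complex.measurable_exp.comp ((Complex.measurable_ofReal.comp
          ((hsum n).div_const _ |>.const_mul t)).mul_const _)).aestronglyMeasurable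
      · rw [Complex.norm_exp_ofReal_mul_I]
    have hi2 : Integrable (fun q => cocycleProd S N c n q *
        (Real.exp (-(t ^ 2 * avg n q / 2)) : ℝ)) ν := by
      refine Integrable.of_bound ?_ B (Eventually.of_forall fun q => ?_)
      · exact (hWm.mul (Complex.measurable_ofReal.comp (Real.measurable_exp.comp
          (((havgm n).const_mul _).div_const _).neg))).aestronglyMeasurable
      · rw [norm_mul, Complex.norm_real, Real.norm_eq_abs, abs_of_pos (Real.exp_pos _)]
        have ha0 : 0 ≤ avg n q := by positivity
        refine mul_le_of_le_one_right (norm_nonneg _) (Real.exp_le_one_iff.2 ?_) |>.trans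
          (hWB n le_rfl q)
        have : 0 ≤ t ^ 2 * avg n q / 2 := by positivity
        linarith
    have hi3 : Integrable (fun q => cocycleProd S N c n q * (E : ℂ)) ν := hWi.mul_const _
    have hT1 : ‖(∫ q, Complex.exp
        ((t * ((∑ k ∈ Finset.range n, N (S^[k] q)) / Real.sqrt n) : ℝ) * Complex.I) ∂ν) -
        ∫ q, cocycleProd S N c n q * (Real.exp (-(t ^ 2 * avg n q / 2)) : ℝ) ∂ν‖ ≤
        2 * (|t| * d) ^ 3 / Real.sqrt n := by
      rw [← integral_sub hi1 hi2]
      refine (norm_integral_le_of_norm_le_const (Eventually.of_forall hp1)).trans (by simp)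
    have hT2 : ‖(∫ q, cocycleProd S N c n q * (Real.exp (-(t ^ 2 * avg n q / 2)) : ℝ) ∂ν) -
        ∫ q, cocycleProd S N c n q * (E : ℂ) ∂ν‖ ≤
        B * (t ^ 2 / 2) * (∫ q, |avg n q - σ2| ∂ν) := by
      rw [← integral_sub hi2 hi3, ← integral_const_mul]
      refine norm_integral_le_of_norm_le (Integrable.const_mul ?_ _) (Eventually.of_forall hp2)
      refine (Integrable.sub ?_ (integrable_const _)).abs
      exact Integrable.of_bound (havgm n).aestronglyMeasurable (d ^ 2)
        (Eventually.of_forall (havgb n))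
    have hT3 : ‖(∫ q, cocycleProd S N c n q * (E : ℂ) ∂ν) - E‖ ≤
        |t| / Real.sqrt n * (2 * d * B * I1) := by
      rw [integral_mul_const]
      have h1 := h.norm_integral_cocycleProd_sub_one_le hS.toMeasurePreserving hN hd hNY h0 hτ c n
        (Real.exp_pos _).le hWB
      have h2 : ‖c‖ = |t| / Real.sqrt n := by
        rw [hc, norm_mul, Complex.norm_I, mul_one, Complex.norm_real, Real.norm_eq_abs, abs_div,
          abs_of_pos hs]
      rw [h2] at h1
      have h3 : (∫ q, cocycleProd S N c n q ∂ν) * (E : ℂ) - E =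
          ((∫ q, cocycleProd S N c n q ∂ν) - 1) * E := by ring
      rw [h3, norm_mul, Complex.norm_real, Real.norm_eq_abs, abs_of_pos (Real.exp_pos _)]
      exact (mul_le_of_le_one_right (norm_nonneg _) hE1).trans h1
    have h3 := norm_sub_le_norm_sub_add_norm_sub (∫ q, Complex.exp
        ((t * ((∑ k ∈ Finset.range n, N (S^[k] q)) / Real.sqrt n) : ℝ) * Complex.I) ∂ν)
        (∫ q, cocycleProd S N c n q * (Real.exp (-(t ^ 2 * avg n q / 2)) : ℝ) ∂ν) E
    have h4 := norm_sub_le_norm_sub_add_norm_sub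
        (∫ q, cocycleProd S N c n q * (Real.exp (-(t ^ 2 * avg n q / 2)) : ℝ) ∂ν)
        (∫ q, cocycleProd S N c n q * (E : ℂ) ∂ν) E
    linarith
  have hsqrt : Tendsto (fun n : ℕ => Real.sqrt n) atTop atTop :=
    Real.tendsto_sqrt_atTop.comp tendsto_natCast_atTop_atTop
  have hlim : Tendsto (fun n : ℕ => 2 * (|t| * d) ^ 3 / Real.sqrt n +
      B * (t ^ 2 / 2) * (∫ q, |avg n q - σ2| ∂ν) + |t| / Real.sqrt n * (2 * d * B * I1)) atTop
      (𝓝 0) := by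
    have h1 := ((hsqrt.const_div_atTop (2 * (|t| * d) ^ 3)).add
      (herg.const_mul (B * (t ^ 2 / 2)))).add
      ((hsqrt.const_div_atTop |t|).mul_const (2 * d * B * I1))
    simpa using h1
  rw [tendsto_iff_norm_sub_tendsto_zero]
  refine squeeze_zero' (Eventually.of_forall fun n => norm_nonneg _) ?_ hlim
  filter_upwards [eventually_ge_atTop 1,
    (hsqrt.const_div_atTop (|t| * d)).eventually (ge_mem_nhds zero_lt_one)] with n hn hn2
  exact hbound n hn hn2

end

section UnboundedCLT

variable {Ω : Type*} [MeasurableSpace Ω] {ν : Measure Ω} [IsProbabilityMeasure ν]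
  {S : Ω → Ω} {X Y : Set Ω} {τ : Ω → ℕ}

/-- The Birkhoff sums of `N` for the transformation `S`. -/
def bsum (S : Ω → Ω) (N : Ω → ℝ) (n : ℕ) (q : Ω) : ℝ := ∑ k ∈ Finset.range n, N (S^[k] q)

omit [MeasurableSpace Ω] in
lemma bsum_succ (N : Ω → ℝ) (n : ℕ) (q : Ω) : bsum S N (n + 1) q = N q + bsum S N n (S q) := by
  rw [bsum, Finset.sum_range_succ', add_comm]
  rfl

lemma measurable_bsum (hS : Measurable S) {N : Ω → ℝ} (hN : Measurable N) (n : ℕ) :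
    Measurable (bsum S N n) :=
  Finset.measurable_fun_sum _ fun k _ => hN.comp (hS.iterate k)

omit [MeasurableSpace Ω] in
lemma abs_bsum_le {N : Ω → ℝ} {d : ℝ} (hd : ∀ q, |N q| ≤ d) (n : ℕ) (q : Ω) :
    |bsum S N n q| ≤ n * d := by
  refine (Finset.abs_sum_le_sum_abs _ _).trans ?_
  refine (Finset.sum_le_card_nsmul _ _ d fun k _ => hd _).trans (le_of_eq (by simp))

omit [IsProbabilityMeasure ν] in
lemma MeasureTheory.MeasurePreserving.integral_abs_bsum_le (hS : MeasurePreserving S ν ν)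
    {N : Ω → ℝ} (hN : Integrable N ν) (n : ℕ) :
    Integrable (bsum S N n) ν ∧ ∫ q, |bsum S N n q| ∂ν ≤ n * ∫ q, |N q| ∂ν := by
  induction n with
  | zero =>
    have h0 : bsum S N 0 = fun _ => 0 := funext fun q => by simp [bsum]
    simp [h0]
  | succ n ih =>
    have h1 : Integrable (fun q => bsum S N n (S q)) ν := hS.integrable_comp_self ih.1
    have h2 : bsum S N (n + 1) = fun q => N q + bsum S N n (S q) := funext fun q => bsum_succ N n q
    rw [h2]
    refine ⟨hN.add h1, ?_⟩
    have h3 : ∫ q, |bsum S N n (S q)| ∂ν = ∫ q, |bsum S N n q| ∂ν :=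
      hS.integral_comp_aesm (G := fun q => |bsum S N n q|) ih.1.abs.aestronglyMeasurable
    calc ∫ q, |N q + bsum S N n (S q)| ∂ν ≤ ∫ q, (|N q| + |bsum S N n (S q)|) ∂ν :=
          integral_mono (hN.add h1).abs (hN.abs.add h1.abs) fun q => abs_add_le _ _
      _ = ∫ q, |N q| ∂ν + ∫ q, |bsum S N n q| ∂ν := by rw [integral_add hN.abs h1.abs, h3]
      _ ≤ _ := by push_cast; linarith [ih.2]

lemma HittingSystem.integral_bsum_sq_le (h : HittingSystem S X Y τ)
    (hS : MeasurePreserving S ν ν) {N : Ω → ℝ} (hN : Measurable N) {d : ℝ} (hd : ∀ q, |N q| ≤ d)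
    (hNY : ∀ q ∉ Y, N q = 0) (h0 : ReturnOrthogonal ν S Y τ N)
    (hτ : IntegrableOn (fun p => ((τ (S p) : ℝ) + 1) ^ 2) Y ν) {C c : ℝ} (hC : 0 ≤ C) (hc : 0 ≤ c)
    (hR : ∀ G : Ω → ℝ, Measurable G → (∃ b, ∀ q, |G q| ≤ b) → (∀ q, 0 ≤ G q) →
      ∫ p in Y, ((τ (S p) : ℝ) + 1) ^ 2 * G (hitMap S τ (S p)) ∂ν ≤ C * ∫ p in Y, G p ∂ν)
    (hNR : ∀ p ∈ Y, |N p| ≤ c * ((τ (S p) : ℝ) + 1)) (n : ℕ) :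
    ∫ q, bsum S N n q ^ 2 ∂ν ≤ n * (∫ q, N q ^ 2 ∂ν + 4 * c * C * ∫ q, |N q| ∂ν) := by
  have hd0 : 0 ≤ d := by
    obtain ⟨q⟩ : Nonempty Ω := nonempty_of_isProbabilityMeasure ν
    exact (abs_nonneg _).trans (hd q)
  have hRm : Measurable fun p => ((τ (S p) : ℝ) + 1) :=
    (measurable_from_top.comp (h.measτ.comp h.measS)).add_const 1
  have hτ1 : IntegrableOn (fun p => (τ (S p) : ℝ)) Y ν := by
    refine Integrable.mono' hτ (measurable_from_top.comp
      (h.measτ.comp h.measS)).aestronglyMeasurable (Eventually.of_forall fun p => ?_)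
    rw [Real.norm_eq_abs, Nat.abs_cast]
    have : (0 : ℝ) ≤ τ (S p) := Nat.cast_nonneg _
    nlinarith
  have hAm := measurable_bsum h.measS hN
  have hbd : ∀ {u : Ω → ℝ} (_ : Measurable u) (b : ℝ) (_ : ∀ q, |u q| ≤ b), Integrable u ν :=
    fun hu b hb => Integrable.of_bound hu.aestronglyMeasurable b (Eventually.of_forall hb)
  have hN2 : Integrable (fun q => N q ^ 2) ν := hbd (hN.pow_const 2) (d ^ 2) fun q => by
    rw [abs_pow]; exact pow_le_pow_left₀ (abs_nonneg _) (hd q) 2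
  have hA2 : ∀ k, Integrable (fun q => bsum S N k q ^ 2) ν := fun k =>
    hbd ((hAm k).pow_const 2) ((k * d) ^ 2) fun q => by
      rw [abs_pow]; exact pow_le_pow_left₀ (abs_nonneg _) (abs_bsum_le hd k q) 2
  have hNA : ∀ k, Integrable (fun q => N q * bsum S N k (S q)) ν := fun k =>
    hbd (hN.mul ((hAm k).comp h.measS)) (d * (k * d)) fun q => by
      rw [abs_mul]; exact mul_le_mul (hd q) (abs_bsum_le hd k _) (abs_nonneg _) hd0
  have e1 : ∀ m : ℕ, ∫ q, bsum S N m q ^ 2 ∂ν =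
      m * ∫ q, N q ^ 2 ∂ν + 2 * ∑ k ∈ Finset.range m, ∫ q in Y, N q * bsum S N k (S q) ∂ν := by
    intro m
    induction m with
    | zero => simp [bsum]
    | succ m ih =>
      have h2 : ∫ p in Y, N p * bsum S N m (S p) ∂ν = ∫ p, N p * bsum S N m (S p) ∂ν :=
        setIntegral_eq_integral_of_forall_compl_eq_zero fun q hq => by simp [hNY q hq]
      have h3 : ∫ q, bsum S N m (S q) ^ 2 ∂ν = ∫ q, bsum S N m q ^ 2 ∂ν :=
        hS.integral_comp_aesm (G := fun q => bsum S N m q ^ 2) (hA2 m).aestronglyMeasurable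
      have h4 : ∀ q, bsum S N (m + 1) q ^ 2 =
          N q ^ 2 + 2 * (N q * bsum S N m (S q)) + bsum S N m (S q) ^ 2 := fun q => by
        rw [bsum_succ]; ring
      have h5 : Integrable (fun q => bsum S N m (S q) ^ 2) ν :=
        hS.integrable_comp_self (G := fun q => bsum S N m q ^ 2) (hA2 m)
      have h6 : Integrable (fun q => N q ^ 2 + 2 * (N q * bsum S N m (S q))) ν :=
        hN2.add ((hNA m).const_mul 2)
      simp only [h4]
      rw [integral_add h6 h5,
        integral_add hN2 ((hNA m).const_mul 2), integral_const_mul, h3, ih, Finset.sum_range_succ,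
        h2]
      push_cast
      ring
  set G : Ω → ℝ := bsum S (fun q => |N q|) n with hG
  have hGm : Measurable G := measurable_bsum h.measS hN.abs n
  have hG0 : ∀ q, 0 ≤ G q := fun q => Finset.sum_nonneg fun k _ => abs_nonneg _
  have hGb : ∀ q, |G q| ≤ n * d := abs_bsum_le (fun q => by rw [abs_abs]; exact hd q) n
  have h3 := h.norm_sum_integral_le hN hd h0 hτ1 (A := fun k q => (bsum S N k q : ℂ))
    (fun k => Complex.measurable_ofReal.comp (hAm k))
    (fun k => ⟨k * d, fun q => by
      rw [Complex.norm_real]; exact abs_bsum_le hd k q⟩)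
    (fun q q' => by simp [bsum])
    (fun k q _ hq' => by rw [bsum_succ, hNY q hq', zero_add]) n hGm hGb hG0
    (fun k hk q _ => by
      rw [Complex.norm_real, Real.norm_eq_abs]
      refine (Finset.abs_sum_le_sum_abs _ _).trans ?_
      exact Finset.sum_le_sum_of_subset_of_nonneg (Finset.range_mono hk.le)
        fun _ _ _ => abs_nonneg _)
  have h4 : ∑ k ∈ Finset.range n, ∫ q in Y, N q * bsum S N k (S q) ∂ν ≤
      ∫ p in Y, |N p| * (2 * τ (S p) * G (hitMap S τ (S p))) ∂ν := by
    refine le_trans (le_trans (le_abs_self _) (le_of_eq ?_)) h3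
    rw [← Real.norm_eq_abs, ← Complex.norm_real, Complex.ofReal_sum]
    congr 1
    refine Finset.sum_congr rfl fun k _ => ?_
    rw [← integral_complex_ofReal]
    simp
  have hRG : IntegrableOn (fun p => ((τ (S p) : ℝ) + 1) ^ 2 * G (hitMap S τ (S p))) Y ν := by
    refine Integrable.mono' (hτ.mul_const (n * d)) ((hRm.pow_const 2).mul
      (hGm.comp (h.measurable_hitMap.comp h.measS))).aestronglyMeasurable
      (Eventually.of_forall fun p => ?_)
    rw [norm_mul, Real.norm_eq_abs, Real.norm_eq_abs, abs_of_nonneg (sq_nonneg _)]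
    exact mul_le_mul_of_nonneg_left (hGb _) (sq_nonneg _)
  have h5 : ∫ p in Y, |N p| * (2 * τ (S p) * G (hitMap S τ (S p))) ∂ν ≤
      2 * c * (∫ p in Y, ((τ (S p) : ℝ) + 1) ^ 2 * G (hitMap S τ (S p)) ∂ν) := by
    rw [← integral_const_mul]
    refine integral_mono_of_nonneg (Eventually.of_forall fun p => by
      have := hG0 (hitMap S τ (S p)); positivity) (hRG.const_mul _) ?_
    rw [EventuallyLE, ae_restrict_iff' h.measY]
    refine Eventually.of_forall fun p hp => ?_
    have h6 := hNR p hp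
    have h7 := hG0 (hitMap S τ (S p))
    have h8 : (0 : ℝ) ≤ τ (S p) := Nat.cast_nonneg _
    calc |N p| * (2 * τ (S p) * G (hitMap S τ (S p)))
        ≤ (c * ((τ (S p) : ℝ) + 1)) * (2 * ((τ (S p) : ℝ) + 1) * G (hitMap S τ (S p))) := by
          gcongr
          linarith
      _ = _ := by ring
  have h6 := hR G hGm ⟨_, hGb⟩ hG0
  have hGi : Integrable G ν := hbd hGm _ hGb
  have h7 : ∫ p in Y, G p ∂ν ≤ n * ∫ q, |N q| ∂ν := by
    refine (setIntegral_le_integral hGi (Eventually.of_forall hG0)).trans ?_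
    have h8 := (hS.integral_abs_bsum_le (hbd hN d hd).abs n).2
    simp only [abs_abs] at h8
    refine le_trans (le_of_eq ?_) h8
    exact integral_congr_ae (Eventually.of_forall fun q => (abs_of_nonneg (hG0 q)).symm)
  rw [e1]
  have h9 := mul_le_mul_of_nonneg_left (h6.trans (mul_le_mul_of_nonneg_left h7 hC))
    (show 0 ≤ 2 * c by positivity)
  have h10 := h4.trans (h5.trans h9)
  calc _ ≤ (n : ℝ) * ∫ q, N q ^ 2 ∂ν + 2 * (2 * c * (C * (n * ∫ q, |N q| ∂ν))) := by linarith
    _ = _ := by ring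

end UnboundedCLT

lemma norm_exp_mul_I_sub_exp_mul_I_le (a b : ℝ) :
    ‖Complex.exp (a * Complex.I) - Complex.exp (b * Complex.I)‖ ≤ |a - b| := by
  have h1 : Complex.exp (a * Complex.I) - Complex.exp (b * Complex.I) =
      Complex.exp (b * Complex.I) * (Complex.exp (Complex.I * ((a - b : ℝ) : ℂ)) - 1) := by
    rw [mul_sub, mul_one, ← Complex.exp_add]
    congr 2
    push_cast
    ring
  rw [h1, norm_mul, Complex.norm_exp_ofReal_mul_I, one_mul]
  simpa using Real.norm_exp_I_mul_ofReal_sub_one_le (x := a - b)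

section UnboundedCLT

variable {Ω : Type*} [MeasurableSpace Ω] {ν : Measure Ω} [IsProbabilityMeasure ν]
  {S : Ω → Ω} {X Y : Set Ω} {τ : Ω → ℕ}

lemma sq_integral_abs_le {u : Ω → ℝ} (hu : Integrable u ν) (hu2 : Integrable (fun q => u q ^ 2) ν) :
    (∫ q, |u q| ∂ν) ^ 2 ≤ ∫ q, u q ^ 2 ∂ν := by
  set m := ∫ q, |u q| ∂ν
  have h1 : 0 ≤ ∫ q, (|u q| - m) ^ 2 ∂ν := integral_nonneg fun q => sq_nonneg _
  have h2 : ∀ q, (|u q| - m) ^ 2 = u q ^ 2 - 2 * m * |u q| + m ^ 2 := fun q => by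
    rw [sub_sq, sq_abs]; ring
  have h3 : Integrable (fun q => u q ^ 2 - 2 * m * |u q|) ν := hu2.sub (hu.abs.const_mul _)
  simp only [h2] at h1
  rw [integral_add h3 (integrable_const _), integral_sub hu2 (hu.abs.const_mul _),
    integral_const_mul, integral_const] at h1
  simp at h1
  nlinarith

/-- The hypotheses under which an observable `M` on `Y` is approximated, after truncation of the
return time, by bounded observables orthogonal to the functions of the return map. -/
structure ReturnMartingale (ν : Measure Ω) (S : Ω → Ω) (Y : Set Ω) (τ : Ω → ℕ) (M : Ω → ℝ)
    (w : ℕ → Ω → ℝ) (ε : ℕ → ℝ) (c C : ℝ) : Prop where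
  meas : Measurable M
  eq_zero : ∀ q ∉ Y, M q = 0
  nonneg : 0 ≤ c
  nonneg' : 0 ≤ C
  bound : ∀ p ∈ Y, |M p| ≤ c * ((τ (S p) : ℝ) + 1)
  integrable : IntegrableOn (fun p => ((τ (S p) : ℝ) + 1) ^ 2) Y ν
  le : ∀ G : Ω → ℝ, Measurable G → (∃ b, ∀ q, |G q| ≤ b) → (∀ q, 0 ≤ G q) →
      ∫ p in Y, ((τ (S p) : ℝ) + 1) ^ 2 * G (hitMap S τ (S p)) ∂ν ≤ C * ∫ p in Y, G p ∂ν
  meas_w : ∀ K, Measurable (w K)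
  tendsto : Tendsto ε atTop (𝓝 0)
  bound_w : ∀ K q, |w K q| ≤ ε K
  orthogonal : ∀ (K : ℕ) (G : Ω → ℝ), Measurable G → (∃ b, ∀ q, |G q| ≤ b) →
      ∫ p in Y, (if τ (S p) < K then M p else 0) * G (hitMap S τ (S p)) ∂ν =
        ∫ p in Y, w K p * G p ∂ν

/-- The truncated and recentred observable. -/
def truncObs (S : Ω → Ω) (Y : Set Ω) (τ : Ω → ℕ) (M : Ω → ℝ) (w : ℕ → Ω → ℝ) (K : ℕ) : Ω → ℝ :=
  Y.indicator fun p => (if τ (S p) < K then M p else 0) - w K (hitMap S τ (S p))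

namespace ReturnMartingale

variable {M : Ω → ℝ} {w : ℕ → Ω → ℝ} {ε : ℕ → ℝ} {c C : ℝ}

omit [IsProbabilityMeasure ν] in
lemma measurable_truncated (hM : ReturnMartingale ν S Y τ M w ε c C) (h : HittingSystem S X Y τ)
    (K : ℕ) : Measurable fun p => if τ (S p) < K then M p else 0 :=
  Measurable.ite (measurableSet_lt (h.measτ.comp h.measS) measurable_const) hM.meas
    measurable_const

omit [IsProbabilityMeasure ν] in
lemma measurable_truncObs (hM : ReturnMartingale ν S Y τ M w ε c C) (h : HittingSystem S X Y τ)
    (K : ℕ) : Measurable (truncObs S Y τ M w K) :=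
  ((hM.measurable_truncated h K).sub
    ((hM.meas_w K).comp (h.measurable_hitMap.comp h.measS))).indicator h.measY

omit [IsProbabilityMeasure ν] in
lemma abs_truncated_le (hM : ReturnMartingale ν S Y τ M w ε c C) (K : ℕ) (p : Ω) :
    |if τ (S p) < K then M p else 0| ≤ c * K := by
  have := hM.nonneg
  by_cases hp : p ∈ Y
  · split_ifs with hK
    · refine (hM.bound p hp).trans ?_
      gcongr
      exact_mod_cast hK
    · rw [abs_zero]; positivity
  · rw [hM.eq_zero p hp]; simp; positivity

omit [IsProbabilityMeasure ν] in
lemma nonneg_eps [Nonempty Ω] (hM : ReturnMartingale ν S Y τ M w ε c C) (K : ℕ) : 0 ≤ ε K :=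
  (abs_nonneg _).trans (hM.bound_w K (Classical.arbitrary Ω))

omit [IsProbabilityMeasure ν] in
lemma abs_truncObs_le [Nonempty Ω] (hM : ReturnMartingale ν S Y τ M w ε c C) (K : ℕ) (p : Ω) :
    |truncObs S Y τ M w K p| ≤ c * K + ε K := by
  have := hM.nonneg_eps K
  have := hM.nonneg
  unfold truncObs
  by_cases hp : p ∈ Y
  · rw [indicator_of_mem hp]
    exact (abs_sub _ _).trans (add_le_add (hM.abs_truncated_le K p) (hM.bound_w _ _))
  · rw [indicator_of_notMem hp]; simp; positivity

lemma returnOrthogonal_truncObs (hM : ReturnMartingale ν S Y τ M w ε c C)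
    (h : HittingSystem S X Y τ) (hS : MeasurePreserving S ν ν) (hX : ν Xᶜ = 0) (K : ℕ) :
    ReturnOrthogonal ν S Y τ (truncObs S Y τ M w K) := by
  intro G hG hGb
  obtain ⟨b, hb⟩ := id hGb
  have hF : Measurable fun p => hitMap S τ (S p) := h.measurable_hitMap.comp h.measS
  have e1 : ∫ p in Y, truncObs S Y τ M w K p * G (hitMap S τ (S p)) ∂ν =
      ∫ p in Y, ((if τ (S p) < K then M p else 0) * G (hitMap S τ (S p)) -
        w K (hitMap S τ (S p)) * G (hitMap S τ (S p))) ∂ν := by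
    refine setIntegral_congr_fun h.measY fun p hp => ?_
    simp only [truncObs, indicator_of_mem hp, sub_mul]
  have i1 : Integrable (fun p => (if τ (S p) < K then M p else 0) * G (hitMap S τ (S p)))
      (ν.restrict Y) :=
    Integrable.of_bound ((hM.measurable_truncated h K).mul (hG.comp hF)).aestronglyMeasurable
      (c * K * b) (Eventually.of_forall fun p => by
        rw [norm_mul]
        exact mul_le_mul (hM.abs_truncated_le K p) (hb _) (abs_nonneg _)
          (mul_nonneg hM.nonneg (Nat.cast_nonneg _)))
  have hwG : ∀ q, |w K q * G q| ≤ ε K * b := fun q => by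
    rw [abs_mul]
    exact mul_le_mul (hM.bound_w K q) (hb _) (abs_nonneg _) ((abs_nonneg _).trans (hM.bound_w K q))
  have i2 : Integrable (fun p => w K (hitMap S τ (S p)) * G (hitMap S τ (S p)))
      (ν.restrict Y) :=
    Integrable.of_bound (((hM.meas_w K).mul hG).comp hF).aestronglyMeasurable
      (ε K * b) (Eventually.of_forall fun p => hwG _)
  rw [e1, integral_sub i1 i2, hM.orthogonal K G hG hGb,
    h.integral_return hS hX (G := fun q => w K q * G q) ((hM.meas_w K).mul hG) ⟨_, hwG⟩, sub_self]

end ReturnMartingale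

lemma ReturnOrthogonal.sub {N N' : Ω → ℝ} (h : HittingSystem S X Y τ) (hN : Measurable N)
    (hN' : Measurable N') {d d' : ℝ} (hd : ∀ q, |N q| ≤ d) (hd' : ∀ q, |N' q| ≤ d')
    (h0 : ReturnOrthogonal ν S Y τ N) (h0' : ReturnOrthogonal ν S Y τ N') :
    ReturnOrthogonal ν S Y τ (fun q => N q - N' q) := by
  intro G hG hGb
  obtain ⟨b, hb⟩ := id hGb
  have hF : Measurable fun p => hitMap S τ (S p) := h.measurable_hitMap.comp h.measS
  have key : ∀ (u : Ω → ℝ) (e : ℝ), Measurable u → (∀ q, |u q| ≤ e) →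
      Integrable (fun p => u p * G (hitMap S τ (S p))) (ν.restrict Y) := fun u e hu he =>
    Integrable.of_bound (hu.mul (hG.comp hF)).aestronglyMeasurable (e * b)
      (Eventually.of_forall fun p => by
        rw [norm_mul]
        exact mul_le_mul (he p) (hb _) (abs_nonneg _) ((abs_nonneg _).trans (he p)))
  simp only [sub_mul]
  rw [integral_sub (key N d hN hd) (key N' d' hN' hd'), h0 G hG hGb, h0' G hG hGb, sub_self]

lemma ReturnMartingale.tendsto_charFun {M : Ω → ℝ} {w : ℕ → Ω → ℝ} {ε : ℕ → ℝ} {c C : ℝ}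
    (hM : ReturnMartingale ν S Y τ M w ε c C) (h : HittingSystem S X Y τ)
    (hS : Ergodic S ν) (hX : ν Xᶜ = 0) (t : ℝ) :
    Tendsto (fun n : ℕ => ∫ q, Complex.exp
        ((t * (bsum S M n q / Real.sqrt n) : ℝ) * Complex.I) ∂ν) atTop
      (𝓝 (Real.exp (-(t ^ 2 * (∫ q, M q ^ 2 ∂ν) / 2)) : ℝ)) := by
  have : Nonempty Ω := nonempty_of_isProbabilityMeasure ν
  have hmp := hS.toMeasurePreserving
  obtain ⟨E, hE⟩ := hM.tendsto.bddAbove_range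
  have hE : ∀ K, ε K ≤ E := fun K => hE ⟨K, rfl⟩
  have hE0 : 0 ≤ E := (hM.nonneg_eps 0).trans (hE 0)
  have hc0 := hM.nonneg
  set N := truncObs S Y τ M w with hN
  have hNm : ∀ K, Measurable (N K) := hM.measurable_truncObs h
  have hNb := hM.abs_truncObs_le
  have hN0 : ∀ K, ∀ q ∉ Y, N K q = 0 := fun K q hq => by simp [hN, truncObs, hq]
  have hNorth := hM.returnOrthogonal_truncObs h hmp hX
  set c' := c + E with hc'
  set Φ : Ω → ℝ := Y.indicator fun p => (τ (S p) : ℝ) + 1 with hΦ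
  have hΦ0 : ∀ q, 0 ≤ Φ q := fun q => indicator_nonneg (fun _ _ => by positivity) q
  have hRm : Measurable fun p => ((τ (S p) : ℝ) + 1) :=
    (measurable_from_top.comp (h.measτ.comp h.measS)).add_const 1
  have hΦm : Measurable Φ := hRm.indicator h.measY
  have hΦ2 : Integrable (fun q => Φ q ^ 2) ν := by
    have h1 := (integrable_indicator_iff h.measY).2 hM.integrable
    refine h1.congr (Eventually.of_forall fun q => ?_)
    by_cases hq : q ∈ Y <;> simp [hΦ, hq]
  have hΦ1 : Integrable Φ ν := by
    refine hΦ2.mono' hΦm.aestronglyMeasurable (Eventually.of_forall fun q => ?_)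
    rw [Real.norm_eq_abs, abs_of_nonneg (hΦ0 q)]
    by_cases hq : q ∈ Y
    · simp only [hΦ, indicator_of_mem hq]
      have : (0 : ℝ) ≤ τ (S q) := Nat.cast_nonneg _
      nlinarith
    · simp [hΦ, hq]
  have hMΦ : ∀ q, |M q| ≤ c' * Φ q := fun q => by
    by_cases hq : q ∈ Y
    · simp only [hΦ, indicator_of_mem hq]
      refine (hM.bound q hq).trans ?_
      gcongr; linarith
    · simp [hΦ, hq, hM.eq_zero q hq]
  have hNΦ : ∀ K q, |N K q| ≤ c' * Φ q := fun K q => by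
    by_cases hq : q ∈ Y
    · simp only [hN, truncObs, hΦ, indicator_of_mem hq]
      refine (abs_sub _ _).trans ?_
      rw [hc', add_mul]
      have h8 : (0 : ℝ) ≤ τ (S q) := Nat.cast_nonneg _
      refine add_le_add ?_ (((hM.bound_w _ _).trans (hE K)).trans (by nlinarith))
      split_ifs
      · exact hM.bound q hq
      · rw [abs_zero]; positivity
    · simp [hΦ, hq, hN0 K q hq]
  have hlim : ∀ q, Tendsto (fun K => N K q) atTop (𝓝 (M q)) := fun q => by
    by_cases hq : q ∈ Y
    · have h1 : Tendsto (fun K => w K (hitMap S τ (S q))) atTop (𝓝 0) :=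
        squeeze_zero_norm (fun K => hM.bound_w K _) hM.tendsto
      have h2 := (tendsto_const_nhds (x := M q)).sub h1
      rw [sub_zero] at h2
      refine h2.congr' ?_
      filter_upwards [eventually_gt_atTop (τ (S q))] with K hK
      simp [hN, truncObs, hq, hK]
    · simp only [hN0 _ q hq, hM.eq_zero q hq]; exact tendsto_const_nhds
  have hMi : Integrable M ν := (hΦ1.const_mul c').mono' hM.meas.aestronglyMeasurable
    (Eventually.of_forall hMΦ)
  have hNi : ∀ K, Integrable (N K) ν := fun K => (hΦ1.const_mul c').mono'
    (hNm K).aestronglyMeasurable (Eventually.of_forall (hNΦ K))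
  have hdiff : ∀ K q, |M q - N K q| ≤ 2 * c' * Φ q := fun K q => by
    have := abs_sub (M q) (N K q)
    have := hMΦ q
    have := hNΦ K q
    linarith
  have hsq : ∀ {u : Ω → ℝ} {e : ℝ}, (∀ q, |u q| ≤ e * Φ q) →
      ∀ q, ‖u q ^ 2‖ ≤ e ^ 2 * Φ q ^ 2 := fun {u e} hu q => by
    rw [norm_pow, Real.norm_eq_abs, ← mul_pow]
    exact pow_le_pow_left₀ (abs_nonneg _) (hu q) 2
  have hM2 : Integrable (fun q => M q ^ 2) ν := (hΦ2.const_mul (c' ^ 2)).mono'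
    (hM.meas.pow_const 2).aestronglyMeasurable (Eventually.of_forall (hsq hMΦ))
  have hD2 : ∀ K, Integrable (fun q => (M q - N K q) ^ 2) ν := fun K =>
    (hΦ2.const_mul ((2 * c') ^ 2)).mono' ((hM.meas.sub (hNm K)).pow_const 2).aestronglyMeasurable
      (Eventually.of_forall (hsq (hdiff K)))
  have hl1 : Tendsto (fun K => ∫ q, |M q - N K q| ∂ν) atTop (𝓝 0) := by
    have := tendsto_integral_of_dominated_convergence (μ := ν) (F := fun K q => |M q - N K q|)
      (f := fun _ => 0) (fun q => 2 * c' * Φ q)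
      (fun K => (hM.meas.sub (hNm K)).abs.aestronglyMeasurable) (hΦ1.const_mul _)
      (fun K => Eventually.of_forall fun q => by
        rw [Real.norm_eq_abs, abs_abs]; exact hdiff K q)
      (Eventually.of_forall fun q => by
        have := ((hlim q).const_sub (M q)).abs
        simpa using this)
    simpa using this
  have hl2 : Tendsto (fun K => ∫ q, (M q - N K q) ^ 2 ∂ν) atTop (𝓝 0) := by
    have := tendsto_integral_of_dominated_convergence (μ := ν) (F := fun K q => (M q - N K q) ^ 2)
      (f := fun _ => 0) (fun q => (2 * c') ^ 2 * Φ q ^ 2)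
      (fun K => ((hM.meas.sub (hNm K)).pow_const 2).aestronglyMeasurable) (hΦ2.const_mul _)
      (fun K => Eventually.of_forall (hsq (hdiff K)))
      (Eventually.of_forall fun q => by
        have := ((hlim q).const_sub (M q)).pow 2
        simpa using this)
    simpa using this
  have hl3 : Tendsto (fun K => ∫ q, N K q ^ 2 ∂ν) atTop (𝓝 (∫ q, M q ^ 2 ∂ν)) :=
    tendsto_integral_of_dominated_convergence (μ := ν) (fun q => c' ^ 2 * Φ q ^ 2)
      (fun K => ((hNm K).pow_const 2).aestronglyMeasurable) (hΦ2.const_mul _)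
      (fun K => Eventually.of_forall (hsq (hNΦ K)))
      (Eventually.of_forall fun q => (hlim q).pow 2)
  set l : ℕ → ℝ := fun K => ∫ q, |M q - N K q| ∂ν with hl
  set e : ℕ → ℝ := fun K => ∫ q, (M q - N K q) ^ 2 ∂ν with he
  have hC0 := hM.nonneg'
  have hτ1 : IntegrableOn (fun p => (τ (S p) : ℝ)) Y ν := by
    refine Integrable.mono' hM.integrable (measurable_from_top.comp
      (h.measτ.comp h.measS)).aestronglyMeasurable (Eventually.of_forall fun p => ?_)
    rw [Real.norm_eq_abs, Nat.abs_cast]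
    have : (0 : ℝ) ≤ τ (S p) := Nat.cast_nonneg _
    nlinarith
  have hvar : ∀ K K' n, ∫ q, bsum S (fun q => N K' q - N K q) n q ^ 2 ∂ν ≤
      n * (2 * e K + 2 * e K' + 8 * c' * C * (l K + l K')) := by
    intro K K' n
    have hd : ∀ q, |N K' q - N K q| ≤ (c * K' + ε K') + (c * K + ε K) := fun q =>
      (abs_sub _ _).trans (add_le_add (hNb K' q) (hNb K q))
    have h1 := h.integral_bsum_sq_le (N := fun q => N K' q - N K q) hmp ((hNm K').sub (hNm K)) hd
      (fun q hq => by rw [hN0 K q hq, hN0 K' q hq, sub_zero])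
      ((hNorth K').sub h (hNm K') (hNm K) (hNb K') (hNb K) (hNorth K)) hM.integrable hC0
      (c := 2 * c') (by positivity) hM.le (fun p hp => by
        have h1 := hNΦ K p
        have h2 := hNΦ K' p
        simp only [hΦ, indicator_of_mem hp] at h1 h2
        have := abs_sub (N K' p) (N K p)
        linarith) n
    refine h1.trans ?_
    have h2 : ∫ q, (N K' q - N K q) ^ 2 ∂ν ≤ 2 * e K + 2 * e K' := by
      simp only [he]
      rw [← integral_const_mul, ← integral_const_mul, ← integral_add ((hD2 K).const_mul 2)
        ((hD2 K').const_mul 2)]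
      refine integral_mono_of_nonneg (Eventually.of_forall fun q => sq_nonneg _)
        (((hD2 K).const_mul 2).add ((hD2 K').const_mul 2)) (Eventually.of_forall fun q => ?_)
      show (N K' q - N K q) ^ 2 ≤ 2 * (M q - N K q) ^ 2 + 2 * (M q - N K' q) ^ 2
      nlinarith [sq_nonneg ((M q - N K q) + (M q - N K' q))]
    have h3 : ∫ q, |N K' q - N K q| ∂ν ≤ l K + l K' := by
      simp only [hl]
      have i1 := (hMi.sub (hNi K)).abs
      have i2 := (hMi.sub (hNi K')).abs
      refine le_trans (integral_mono_of_nonneg (Eventually.of_forall fun q => abs_nonneg _)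
        (i1.add i2) (Eventually.of_forall fun q => ?_)) (le_of_eq (integral_add i1 i2))
      show |N K' q - N K q| ≤ |M q - N K q| + |M q - N K' q|
      have h5 := abs_sub (M q - N K q) (M q - N K' q)
      have h6 : (M q - N K q) - (M q - N K' q) = N K' q - N K q := by ring
      rwa [h6] at h5
    have h4 : 4 * (2 * c') * C * ∫ q, |N K' q - N K q| ∂ν ≤ 8 * c' * C * (l K + l K') := by
      have h5 : 0 ≤ 8 * c' * C := by positivity
      nlinarith [mul_le_mul_of_nonneg_left h3 h5]
    refine mul_le_mul_of_nonneg_left (add_le_add h2 h4) (Nat.cast_nonneg n)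
  set η : ℕ → ℝ := fun K => Real.sqrt (2 * e K + 8 * c' * C * l K) with hη
  have hηlim : Tendsto η atTop (𝓝 0) := by
    have h1 := ((hl2.const_mul 2).add (hl1.const_mul (8 * c' * C))).sqrt
    simpa using h1
  have hL1 : ∀ K (n : ℕ), 0 < n → ∫ q, |bsum S M n q - bsum S (N K) n q| ∂ν ≤
      Real.sqrt n * η K := by
    intro K n hn
    have hlimK : Tendsto (fun K' => n * l K' +
        Real.sqrt (n * (2 * e K + 2 * e K' + 8 * c' * C * (l K + l K')))) atTop
        (𝓝 (n * 0 + Real.sqrt (n * (2 * e K + 2 * 0 + 8 * c' * C * (l K + 0))))) :=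
      (hl1.const_mul _).add ((((hl2.const_mul 2).const_add _).add
        ((hl1.const_add _).const_mul _)).const_mul _).sqrt
    refine (ge_of_tendsto' hlimK fun K' => ?_).trans (le_of_eq ?_)
    · have hsub : ∀ (u v : Ω → ℝ) q, bsum S (fun q => u q - v q) n q =
          bsum S u n q - bsum S v n q := fun u v q => Finset.sum_sub_distrib _ _
      have h1 := hmp.integral_abs_bsum_le (hMi.sub (hNi K')) n
      have h2 := hmp.integral_abs_bsum_le ((hNi K').sub (hNi K)) n
      have hd : ∀ q, |N K' q - N K q| ≤ (c * K' + ε K') + (c * K + ε K) := fun q =>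
        (abs_sub _ _).trans (add_le_add (hNb K' q) (hNb K q))
      have h3 : Integrable (fun q => bsum S (fun q => N K' q - N K q) n q ^ 2) ν :=
        Integrable.of_bound ((measurable_bsum h.measS ((hNm K').sub
          (hNm K)) n).pow_const 2).aestronglyMeasurable _
          (Eventually.of_forall fun q => by
            rw [norm_pow]; exact pow_le_pow_left₀ (norm_nonneg _) (abs_bsum_le hd n q) 2)
      have h4 := (sq_integral_abs_le h2.1 h3).trans (hvar K K' n)
      have h5 := Real.le_sqrt_of_sq_le h4
      refine le_trans ?_ (add_le_add h1.2 h5)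
      rw [← integral_add h1.1.abs h2.1.abs]
      refine integral_mono_of_nonneg (Eventually.of_forall fun q => abs_nonneg _)
        (h1.1.abs.add h2.1.abs) (Eventually.of_forall fun q => ?_)
      show |bsum S M n q - bsum S (N K) n q| ≤ |bsum S (fun q => M q - N K' q) n q| +
        |bsum S (fun q => N K' q - N K q) n q|
      rw [hsub, hsub]
      exact abs_sub_le _ _ _
    · rw [mul_zero, zero_add, mul_zero, add_zero, add_zero, Real.sqrt_mul (Nat.cast_nonneg n)]
  have hcf : ∀ K (n : ℕ), 0 < n → ‖(∫ q, Complex.exp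
      ((t * (bsum S M n q / Real.sqrt n) : ℝ) * Complex.I) ∂ν) - ∫ q, Complex.exp
      ((t * (bsum S (N K) n q / Real.sqrt n) : ℝ) * Complex.I) ∂ν‖ ≤ |t| * η K := by
    intro K n hn
    have hs : 0 < Real.sqrt n := Real.sqrt_pos.2 (by exact_mod_cast hn)
    have hi : ∀ {u : Ω → ℝ}, Measurable u → Integrable (fun q => Complex.exp
        ((t * (bsum S u n q / Real.sqrt n) : ℝ) * Complex.I)) ν := fun {u} hu => by
      refine Integrable.of_bound ?_ 1 (Eventually.of_forall fun q => ?_)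
      · exact (Complex.measurable_exp.comp ((Complex.measurable_ofReal.comp
          (((measurable_bsum h.measS hu n).div_const _).const_mul t)).mul_const
            _)).aestronglyMeasurable
      · rw [Complex.norm_exp_ofReal_mul_I]
    rw [← integral_sub (hi hM.meas) (hi (hNm K))]
    have i1 : Integrable (fun q => |bsum S M n q - bsum S (N K) n q|) ν :=
      ((hmp.integral_abs_bsum_le hMi n).1.sub (hmp.integral_abs_bsum_le (hNi K) n).1).abs
    refine (norm_integral_le_of_norm_le (i1.const_mul (|t| / Real.sqrt n))
      (Eventually.of_forall fun q => ?_)).trans ?_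
    · refine (norm_exp_mul_I_sub_exp_mul_I_le _ _).trans (le_of_eq ?_)
      rw [← mul_sub, ← sub_div, abs_mul, abs_div, abs_of_pos hs]
      ring
    · rw [integral_const_mul]
      refine (mul_le_mul_of_nonneg_left (hL1 K n hn) (by positivity)).trans (le_of_eq ?_)
      field_simp
  have hNcf := fun K => h.tendsto_charFun_of_bounded hS (hNm K) (hNb K) (hN0 K) (hNorth K) hτ1 t
  have hLim : Tendsto (fun K => (Real.exp (-(t ^ 2 * (∫ q, N K q ^ 2 ∂ν) / 2)) : ℝ)) atTop
      (𝓝 (Real.exp (-(t ^ 2 * (∫ q, M q ^ 2 ∂ν) / 2)) : ℝ)) :=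
    (Real.continuous_exp.tendsto _).comp (((hl3.const_mul _).div_const _).neg)
  rw [Metric.tendsto_atTop]
  intro δ hδ
  obtain ⟨K, hK1, hK2⟩ := (((hηlim.const_mul |t|).eventually (gt_mem_nhds
    (show |t| * 0 < δ / 3 by rw [mul_zero]; positivity))).and
    (Metric.tendsto_nhds.1 hLim (δ / 3) (by positivity))).exists
  obtain ⟨n₀, hn₀⟩ := Metric.tendsto_atTop.1 (hNcf K) (δ / 3) (by positivity)
  refine ⟨max n₀ 1, fun n hn => ?_⟩
  have h1 := hn₀ n ((le_max_left _ _).trans hn)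
  have h2 := hcf K n ((le_max_right _ _).trans hn)
  rw [← dist_eq_norm] at h2
  have h3 : dist ((Real.exp (-(t ^ 2 * (∫ q, N K q ^ 2 ∂ν) / 2)) : ℝ) : ℂ)
    ((Real.exp (-(t ^ 2 * (∫ q, M q ^ 2 ∂ν) / 2)) : ℝ) : ℂ) < δ / 3 := by
    rw [Complex.dist_eq, ← Complex.ofReal_sub, Complex.norm_real]; exact hK2
  have h4 := dist_triangle4 (∫ q, Complex.exp
      ((t * (bsum S M n q / Real.sqrt n) : ℝ) * Complex.I) ∂ν) (∫ q, Complex.exp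
      ((t * (bsum S (N K) n q / Real.sqrt n) : ℝ) * Complex.I) ∂ν)
      ((Real.exp (-(t ^ 2 * (∫ q, N K q ^ 2 ∂ν) / 2)) : ℝ) : ℂ)
      ((Real.exp (-(t ^ 2 * (∫ q, M q ^ 2 ∂ν) / 2)) : ℝ) : ℂ)
  have h1' : dist (∫ q, Complex.exp
      ((t * (bsum S (N K) n q / Real.sqrt n) : ℝ) * Complex.I) ∂ν)
      ((Real.exp (-(t ^ 2 * (∫ q, N K q ^ 2 ∂ν) / 2)) : ℝ) : ℂ) < δ / 3 := h1
  linarith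

end UnboundedCLT

section Coboundary

variable {Ω : Type*} [MeasurableSpace Ω] {ν : Measure Ω} [IsProbabilityMeasure ν]
  {S : Ω → Ω} {X Y : Set Ω} {τ : Ω → ℕ}

omit [IsProbabilityMeasure ν] in
lemma MeasureTheory.MeasurePreserving.bsum_coboundary (hS : MeasurePreserving S ν ν)
    {f M χ : Ω → ℝ} (hf : ∀ᵐ q ∂ν, f q = M q + χ q - χ (S q)) (n : ℕ) :
    ∀ᵐ q ∂ν, bsum S f n q = bsum S M n q + χ q - χ (S^[n] q) := by
  have h1 : ∀ k, ∀ᵐ q ∂ν, f (S^[k] q) = M (S^[k] q) + χ (S^[k] q) - χ (S (S^[k] q)) :=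
    fun k => (hS.iterate k).quasiMeasurePreserving.ae hf
  filter_upwards [ae_all_iff.2 h1] with q hq
  induction n with
  | zero => simp [bsum]
  | succ n ih =>
    rw [bsum, Finset.sum_range_succ, ← bsum, ih, hq n, bsum, bsum, Finset.sum_range_succ,
      Function.iterate_succ_apply' S n q]
    ring

lemma tendsto_integral_norm_exp_sub_one {χ : Ω → ℝ} (hχ : Measurable χ) (t : ℝ) :
    Tendsto (fun n : ℕ => ∫ q, ‖Complex.exp ((t * (χ q / Real.sqrt n) : ℝ) * Complex.I) - 1‖ ∂ν)
      atTop (𝓝 0) := by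
  have hsqrt : Tendsto (fun n : ℕ => Real.sqrt n) atTop atTop :=
    Real.tendsto_sqrt_atTop.comp tendsto_natCast_atTop_atTop
  have := tendsto_integral_of_dominated_convergence (μ := ν)
    (F := fun (n : ℕ) q => ‖Complex.exp ((t * (χ q / Real.sqrt n) : ℝ) * Complex.I) - 1‖)
    (f := fun _ => 0) (fun _ => 2) (fun n => ?_) (integrable_const _) (fun n => ?_) ?_
  · simpa using this
  · exact ((Complex.measurable_exp.comp ((Complex.measurable_ofReal.comp
      ((hχ.div_const _).const_mul t)).mul_const _)).sub_const 1).norm.aestronglyMeasurable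
  · refine Eventually.of_forall fun q => ?_
    rw [norm_norm]
    refine (norm_sub_le _ _).trans ?_
    rw [Complex.norm_exp_ofReal_mul_I, norm_one]
    norm_num
  · refine Eventually.of_forall fun q => ?_
    refine squeeze_zero (g := fun n : ℕ => |t * (χ q / Real.sqrt n)|) (fun n => norm_nonneg _)
      (fun n => ?_) ?_
    · have := norm_exp_mul_I_sub_exp_mul_I_le (t * (χ q / Real.sqrt n)) 0
      simpa using this
    · have := ((hsqrt.const_div_atTop (χ q)).const_mul t).abs
      simpa using this

lemma ReturnMartingale.exists_tendsto {M : Ω → ℝ} {w : ℕ → Ω → ℝ} {ε : ℕ → ℝ} {c C : ℝ}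
    (hM : ReturnMartingale ν S Y τ M w ε c C) (h : HittingSystem S X Y τ)
    (hS : Ergodic S ν) (hX : ν Xᶜ = 0) {f χ : Ω → ℝ} (hfm : Measurable f) (hχ : Measurable χ)
    (hf : ∀ᵐ q ∂ν, f q = M q + χ q - χ (S q)) :
    ∃ σ2 : NNReal, ∀ g : BoundedContinuousFunction ℝ ℝ,
      Tendsto (fun n : ℕ => ∫ p, g (bsum S f n p / Real.sqrt n) ∂ν) atTop
        (𝓝 (∫ x, g x ∂(ProbabilityTheory.gaussianReal 0 σ2))) := by
  have hmp := hS.toMeasurePreserving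
  set σ2 : NNReal := (∫ q, M q ^ 2 ∂ν).toNNReal with hσ
  have hσ' : (σ2 : ℝ) = ∫ q, M q ^ 2 ∂ν :=
    Real.coe_toNNReal _ (integral_nonneg fun q => sq_nonneg _)
  have hm : ∀ n : ℕ, Measurable fun p => bsum S f n p / Real.sqrt n := fun n =>
    (measurable_bsum h.measS hfm n).div_const _
  have hmM : ∀ n : ℕ, Measurable fun p => bsum S M n p / Real.sqrt n := fun n =>
    (measurable_bsum h.measS hM.meas n).div_const _
  have hInt : ∀ {u : Ω → ℝ} (t : ℝ), Measurable u →
      Integrable (fun q => Complex.exp ((t * u q : ℝ) * Complex.I)) ν := fun {u} t hu => by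
    refine Integrable.of_bound ?_ 1 (Eventually.of_forall fun q => ?_)
    · exact (Complex.measurable_exp.comp ((Complex.measurable_ofReal.comp
        (hu.const_mul t)).mul_const _)).aestronglyMeasurable
    · rw [Complex.norm_exp_ofReal_mul_I]
  have hbound : ∀ (t : ℝ) (n : ℕ), ‖(∫ q, Complex.exp
      ((t * (bsum S f n q / Real.sqrt n) : ℝ) * Complex.I) ∂ν) - ∫ q, Complex.exp
      ((t * (bsum S M n q / Real.sqrt n) : ℝ) * Complex.I) ∂ν‖ ≤
      (∫ q, ‖Complex.exp ((t * (χ q / Real.sqrt n) : ℝ) * Complex.I) - 1‖ ∂ν) +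
      ∫ q, ‖Complex.exp (((-t) * (χ q / Real.sqrt n) : ℝ) * Complex.I) - 1‖ ∂ν := by
    intro t n
    have i1 : ∀ s : ℝ, Integrable
        (fun q => ‖Complex.exp ((s * (χ q / Real.sqrt n) : ℝ) * Complex.I) - 1‖) ν := fun s =>
      ((hInt s (hχ.div_const _)).sub (integrable_const _)).norm
    have e2 := (hmp.iterate n).integral_comp_aesm (i1 (-t)).aestronglyMeasurable
    have i2 : Integrable (fun q => ‖Complex.exp (((-t) * (χ (S^[n] q) / Real.sqrt n) : ℝ) *
        Complex.I) - 1‖) ν := (hmp.iterate n).integrable_comp_self (i1 (-t))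
    rw [← e2, ← integral_add (i1 t) i2, ← integral_sub (hInt t (hm n)) (hInt t (hmM n))]
    refine norm_integral_le_of_norm_le ((i1 t).add i2) ?_
    filter_upwards [hmp.bsum_coboundary hf n] with q hq
    set a := Complex.exp ((t * (bsum S M n q / Real.sqrt n) : ℝ) * Complex.I) with ha
    set b := Complex.exp ((t * (χ q / Real.sqrt n) : ℝ) * Complex.I) with hb
    set d := Complex.exp (((-t) * (χ (S^[n] q) / Real.sqrt n) : ℝ) * Complex.I) with hd
    have h1 : Complex.exp ((t * (bsum S f n q / Real.sqrt n) : ℝ) * Complex.I) = a * b * d := by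
      rw [ha, hb, hd, ← Complex.exp_add, ← Complex.exp_add, hq]
      congr 1
      push_cast
      ring
    have na : ‖a‖ = 1 := Complex.norm_exp_ofReal_mul_I _
    have nb : ‖b‖ = 1 := Complex.norm_exp_ofReal_mul_I _
    have h2 : a * b * d - a = a * ((b - 1) + b * (d - 1)) := by ring
    rw [h1, h2, norm_mul, na, one_mul]
    refine (norm_add_le _ _).trans ?_
    rw [norm_mul, nb, one_mul]
  have hcf : ∀ t : ℝ, Tendsto (fun n : ℕ => ∫ q, Complex.exp
      ((t * (bsum S f n q / Real.sqrt n) : ℝ) * Complex.I) ∂ν) atTop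
      (𝓝 (Real.exp (-(t ^ 2 * (∫ q, M q ^ 2 ∂ν) / 2)) : ℝ)) := by
    intro t
    have h1 := hM.tendsto_charFun h hS hX t
    have h2 := (tendsto_integral_norm_exp_sub_one (ν := ν) hχ t).add
      (tendsto_integral_norm_exp_sub_one (ν := ν) hχ (-t))
    rw [add_zero] at h2
    have h3 := (squeeze_zero_norm (hbound t) h2).add h1
    simpa using h3
  let μ : ℕ → ProbabilityMeasure ℝ := fun n =>
    ⟨ν.map (fun p => bsum S f n p / Real.sqrt n), Measure.isProbabilityMeasure_map (hm n).aemeasurable⟩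
  let μ₀ : ProbabilityMeasure ℝ := ⟨ProbabilityTheory.gaussianReal 0 σ2, inferInstance⟩
  have key : Tendsto μ atTop (𝓝 μ₀) := by
    refine ProbabilityMeasure.tendsto_of_tendsto_charFun fun t => ?_
    have e1 : charFun (μ₀ : Measure ℝ) t =
        (Real.exp (-(t ^ 2 * (∫ q, M q ^ 2 ∂ν) / 2)) : ℝ) := by
      show charFun (ProbabilityTheory.gaussianReal 0 σ2) t = _
      rw [ProbabilityTheory.charFun_gaussianReal, ← hσ', Complex.ofReal_exp]
      congr 1
      push_cast
      ring
    rw [e1]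
    refine (hcf t).congr fun n => ?_
    show _ = charFun (ν.map (fun p => bsum S f n p / Real.sqrt n)) t
    rw [charFun_apply_real, integral_map (hm n).aemeasurable]
    · simp only [Complex.ofReal_mul]
    · fun_prop
  refine ⟨σ2, fun g => ?_⟩
  have h1 := ProbabilityMeasure.tendsto_iff_forall_integral_tendsto.1 key g
  refine h1.congr fun n => ?_
  show ∫ x, g x ∂(ν.map (fun p => bsum S f n p / Real.sqrt n)) = _
  rw [integral_map (hm n).aemeasurable g.continuous.aestronglyMeasurable]

end Coboundary

section Branch

/-- A homeomorphism of the line which extends the left branch of the map `lsv a`. -/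
def stretch (a y : ℝ) : ℝ := y + (2 : ℝ) ^ a * (max y 0 * max y 0 ^ a)

/-- The inverse of `stretch a`, which extends the inverse of the left branch of `lsv a`. -/
def linv (a : ℝ) : ℝ → ℝ := Function.invFun (stretch a)

/-- The derivative of `linv a` on the positive half-line. -/
def jac (a x : ℝ) : ℝ := (1 + (1 + a) * (2 * linv a x) ^ a)⁻¹

variable {a : ℝ}

lemma monotone_stretch_aux (ha : 0 < a) : Monotone fun y : ℝ => max y 0 * max y 0 ^ a := by
  intro y z hyz
  have h : max y 0 ≤ max z 0 := max_le_max_right 0 hyz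
  have h0 : 0 ≤ max y 0 := le_max_right _ _
  exact mul_le_mul h (Real.rpow_le_rpow h0 h ha.le) (Real.rpow_nonneg h0 _) (h0.trans h)

lemma sub_le_stretch_sub (ha : 0 < a) {y z : ℝ} (h : y ≤ z) :
    z - y ≤ stretch a z - stretch a y := by
  have h1 := monotone_stretch_aux ha h
  have h2 := mul_le_mul_of_nonneg_left h1 (Real.rpow_pos_of_pos (two_pos) a).le
  simp only [stretch]
  linarith

lemma strictMono_stretch (ha : 0 < a) : StrictMono (stretch a) := fun y z h => by
  have := sub_le_stretch_sub ha h.le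
  linarith

lemma stretch_of_nonpos {y : ℝ} (hy : y ≤ 0) : stretch a y = y := by
  simp [stretch, max_eq_right hy]

lemma stretch_of_nonneg {y : ℝ} (hy : 0 ≤ y) : stretch a y = y * (1 + (2 * y) ^ a) := by
  rw [stretch, max_eq_left hy, Real.mul_rpow two_pos.le hy]
  ring

lemma continuous_stretch (ha : 0 < a) : Continuous (stretch a) := by
  unfold stretch
  have h1 : Continuous fun y : ℝ => max y 0 := by fun_prop
  exact continuous_id.add (continuous_const.mul (h1.mul (h1.rpow_const fun _ => Or.inr ha.le)))

lemma surjective_stretch (ha : 0 < a) : Function.Surjective (stretch a) := by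
  refine (continuous_stretch ha).surjective ?_ ?_
  · refine tendsto_atTop_mono' _ ?_ tendsto_id
    filter_upwards [eventually_ge_atTop 0] with y hy
    rw [stretch_of_nonneg hy]
    have := Real.rpow_nonneg (show 0 ≤ 2 * y by positivity) a
    simp only [id]
    nlinarith
  · refine tendsto_id.congr' ?_
    filter_upwards [eventually_le_atBot 0] with y hy
    rw [stretch_of_nonpos hy, id]

lemma stretch_linv (ha : 0 < a) (x : ℝ) : stretch a (linv a x) = x :=
  Function.rightInverse_invFun (surjective_stretch ha) x

lemma linv_stretch (ha : 0 < a) (y : ℝ) : linv a (stretch a y) = y :=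
  Function.leftInverse_invFun (strictMono_stretch ha).injective y

lemma strictMono_linv (ha : 0 < a) : StrictMono (linv a) := fun x z h => by
  rw [← (strictMono_stretch ha).lt_iff_lt, stretch_linv ha, stretch_linv ha]
  exact h

lemma continuous_linv (ha : 0 < a) : Continuous (linv a) :=
  (strictMono_linv ha).monotone.continuous_of_surjective fun y => ⟨_, linv_stretch ha y⟩

lemma linv_zero (ha : 0 < a) : linv a 0 = 0 := by
  simpa [stretch_of_nonpos le_rfl] using linv_stretch ha 0

lemma stretch_half : stretch a (1 / 2) = 1 := by
  rw [stretch_of_nonneg (by norm_num)]; norm_num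

lemma linv_one (ha : 0 < a) : linv a 1 = 1 / 2 := by
  rw [← linv_stretch ha (1 / 2), stretch_half]

lemma linv_mem (ha : 0 < a) {x : ℝ} (hx : x ∈ Ioc (0 : ℝ) 1) : linv a x ∈ Ioc (0 : ℝ) (1 / 2) := by
  constructor
  · rw [← linv_zero ha]; exact strictMono_linv ha hx.1
  · rw [← linv_one ha]; exact (strictMono_linv ha).monotone hx.2

lemma lsv_of_mem {y : ℝ} (hy : y ∈ Ioc (0 : ℝ) (1 / 2)) : lsv a y = stretch a y := by
  rw [lsv, if_pos hy.2, stretch_of_nonneg hy.1.le, Real.mul_rpow two_pos.le hy.1.le]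

lemma lsv_linv (ha : 0 < a) {x : ℝ} (hx : x ∈ Ioc (0 : ℝ) 1) : lsv a (linv a x) = x := by
  rw [lsv_of_mem (linv_mem ha hx), stretch_linv ha]

lemma linv_image (ha : 0 < a) : linv a '' Ioc 0 1 = Ioc 0 (1 / 2) := by
  ext y
  constructor
  · rintro ⟨x, hx, rfl⟩
    exact linv_mem ha hx
  · intro hy
    refine ⟨stretch a y, ⟨?_, ?_⟩, linv_stretch ha y⟩
    · have := strictMono_stretch ha hy.1
      rwa [stretch_of_nonpos le_rfl] at this
    · rw [← stretch_half (a := a)]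
      exact (strictMono_stretch ha).monotone hy.2

lemma abs_linv_sub_le (ha : 0 < a) (x z : ℝ) : |linv a x - linv a z| ≤ |x - z| := by
  have key : ∀ x z : ℝ, x ≤ z → |linv a x - linv a z| ≤ |x - z| := fun x z h => by
    have h1 := (strictMono_linv ha).monotone h
    have h2 := sub_le_stretch_sub ha h1
    rw [stretch_linv ha, stretch_linv ha] at h2
    rw [abs_of_nonpos (by linarith), abs_of_nonpos (by linarith)]
    linarith
  rcases le_total x z with h | h
  · exact key x z h
  · rw [abs_sub_comm, abs_sub_comm x]; exact key z x h

lemma hasDerivAt_stretch {y : ℝ} (hy : 0 < y) :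
    HasDerivAt (stretch a) (1 + (1 + a) * (2 * y) ^ a) y := by
  have h1 : HasDerivAt (fun y : ℝ => y * (1 + (2 * y) ^ a))
      (1 * (1 + (2 * y) ^ a) + y * (2 * 1 * a * (2 * y) ^ (a - 1))) y :=
    (hasDerivAt_id y).mul ((((hasDerivAt_id y).const_mul 2).rpow_const
      (Or.inl (by simp; positivity))).const_add 1)
  have h2 : 1 * (1 + (2 * y) ^ a) + y * (2 * 1 * a * (2 * y) ^ (a - 1)) =
      1 + (1 + a) * (2 * y) ^ a := by
    rw [Real.rpow_sub_one (by positivity)]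
    field_simp
    ring
  rw [h2] at h1
  refine h1.congr_of_eventuallyEq ?_
  filter_upwards [lt_mem_nhds hy] with z hz
  exact stretch_of_nonneg hz.le

lemma jac_aux_pos (ha : 0 < a) {x : ℝ} (hx : 0 ≤ x) : 1 ≤ 1 + (1 + a) * (2 * linv a x) ^ a := by
  have h1 : 0 ≤ linv a x := by
    rw [← linv_zero ha]; exact (strictMono_linv ha).monotone hx
  have : 0 ≤ (1 + a) * (2 * linv a x) ^ a := by positivity
  linarith

lemma jac_pos (ha : 0 < a) {x : ℝ} (hx : 0 ≤ x) : 0 < jac a x :=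
  inv_pos.2 (zero_lt_one.trans_le (jac_aux_pos ha hx))

lemma jac_le_one (ha : 0 < a) {x : ℝ} (hx : 0 ≤ x) : jac a x ≤ 1 :=
  inv_le_one_of_one_le₀ (jac_aux_pos ha hx)

lemma hasDerivAt_linv (ha : 0 < a) {x : ℝ} (hx : 0 < x) : HasDerivAt (linv a) (jac a x) x := by
  have h1 : 0 < linv a x := by
    rw [← linv_zero ha]; exact strictMono_linv ha hx
  exact HasDerivAt.of_local_left_inverse (continuous_linv ha).continuousAt (hasDerivAt_stretch h1)
    (zero_lt_one.trans_le (jac_aux_pos ha hx.le)).ne' (Eventually.of_forall (stretch_linv ha))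

lemma measurable_jac (ha : 0 < a) : Measurable (jac a) :=
  (((((continuous_linv ha).measurable.const_mul 2).pow_const a).const_mul (1 + a)).const_add 1).inv

lemma jac_le_mul_exp (ha : 0 < a) (ha1 : a ≤ 1) {x z : ℝ} (hx : 0 < x) (hz : 0 < z) :
    jac a x ≤ jac a z * Real.exp (2 * |Real.log x - Real.log z| -
      2 * |Real.log (linv a x) - Real.log (linv a z)|) := by
  have hpos : ∀ {x : ℝ}, 0 < x → 0 < linv a x := fun {x} hx => by
    rw [← linv_zero ha]; exact strictMono_linv ha hx
  have hlog : ∀ {x : ℝ}, 0 < x →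
      Real.log x = Real.log (linv a x) + Real.log (1 + (2 * linv a x) ^ a) := fun {x} hx => by
    have h1 := hpos hx
    have h2 : 0 < (2 * linv a x) ^ a := by positivity
    conv_lhs => rw [← stretch_linv ha x, stretch_of_nonneg h1.le]
    rw [Real.log_mul h1.ne' (by positivity)]
  have hx1 := hpos hx
  have hz1 := hpos hz
  have hjx := jac_pos ha hx.le
  have hjz := jac_pos ha hz.le
  set y := linv a x with hy
  set v := linv a z with hv
  have hs : 0 < (2 * y) ^ a := by positivity
  have hs' : 0 < (2 * v) ^ a := by positivity
  rcases le_total z x with h | h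
  · have h1 : v ≤ y := (strictMono_linv ha).monotone h
    have h2 : (2 * v) ^ a ≤ (2 * y) ^ a := by gcongr
    have h3 : jac a x ≤ jac a z := by
      unfold jac
      rw [← hy, ← hv]
      gcongr
    have h4 : Real.log z ≤ Real.log x := Real.log_le_log hz h
    have h5 : Real.log v ≤ Real.log y := Real.log_le_log hz1 h1
    have h6 : Real.log (1 + (2 * v) ^ a) ≤ Real.log (1 + (2 * y) ^ a) :=
      Real.log_le_log (by positivity) (by linarith)
    have h7 := hlog hx
    have h8 := hlog hz
    refine h3.trans (le_mul_of_one_le_right hjz.le (Real.one_le_exp ?_))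
    rw [abs_of_nonneg (by linarith), abs_of_nonneg (by linarith)]
    linarith
  · have h1 : y ≤ v := (strictMono_linv ha).monotone h
    have h2 : (2 * y) ^ a ≤ (2 * v) ^ a := by gcongr
    have h4 : Real.log x ≤ Real.log z := Real.log_le_log hx h
    have h5 : Real.log y ≤ Real.log v := Real.log_le_log hx1 h1
    have h7 := hlog hx
    have h8 := hlog hz
    have h9 : 2 * |Real.log x - Real.log z| - 2 * |Real.log y - Real.log v| =
        2 * (Real.log (1 + (2 * v) ^ a)) - 2 * (Real.log (1 + (2 * y) ^ a)) := by
      rw [abs_of_nonpos (by linarith), abs_of_nonpos (by linarith)]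
      rw [← hy] at h7
      rw [← hv] at h8
      linarith
    have hexp : ∀ {s : ℝ}, 0 < s → Real.exp (2 * Real.log s) = s ^ 2 := fun hs => by
      rw [mul_comm, Real.exp_mul, Real.exp_log hs, Real.rpow_two]
    rw [h9, Real.exp_sub, hexp (by positivity), hexp (by positivity)]
    unfold jac
    rw [← hy, ← hv]
    set s := (2 * y) ^ a
    set s' := (2 * v) ^ a
    rw [inv_mul_eq_div, div_div, inv_eq_one_div, div_le_div_iff₀ (by positivity) (by positivity)]
    have : 0 ≤ (s' - s) * (2 + s + s' - (1 + a) + (1 + a) * s * s') :=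
      mul_nonneg (by linarith) (by nlinarith [mul_pos hs hs'])
    nlinarith

end Branch

/-- Parameters of the random system, together with a Hölder exponent `t`. -/
structure LSVParams where
  (α β p t : ℝ)
  α_pos : 0 < α
  α_lt : α < 1 / 2
  α_lt_β : α < β
  β_lt : β < 1
  p_pos : 0 < p
  p_lt : p < 1
  t_pos : 0 < t
  t_le : t ≤ 1

namespace LSVParams

variable (P : LSVParams)

/-- The exponent of the `i`-th map. -/
def e (i : Bool) : ℝ := bif i then P.α else P.β

/-- The probability of the `i`-th map. -/
def w (i : Bool) : ℝ := bif i then P.p else 1 - P.p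

/-- The left endpoint of the interval of noise parameters which select the `i`-th map. -/
def s (i : Bool) : ℝ := bif i then 0 else P.p

/-- The inverse branches of the noise dynamics. -/
def ψ (i : Bool) (ω : ℝ) : ℝ := P.w i * ω + P.s i

lemma e_pos (i : Bool) : 0 < P.e i := by
  have h1 := P.α_pos
  have h2 := P.α_lt_β
  cases i
  · exact h1.trans h2
  · exact h1

lemma e_le_one (i : Bool) : P.e i ≤ 1 := by
  have h1 := P.α_lt
  have h2 := P.β_lt
  cases i
  · exact h2.le
  · simp only [e, cond_true]; linarith

lemma w_pos (i : Bool) : 0 < P.w i := by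
  cases i
  · exact sub_pos.2 P.p_lt
  · exact P.p_pos

lemma w_lt_one (i : Bool) : P.w i < 1 := by
  cases i
  · exact sub_lt_self _ P.p_pos
  · exact P.p_lt

lemma sum_w : ∑ i, P.w i = 1 := by simp [w]

/-- The density at time `n` of points which have not returned, when started uniformly on the base. -/
def tail : ℕ → ℝ → ℝ
  | 0, _ => 1 / 2
  | n + 1, x => ∑ i, P.w i * jac (P.e i) x * tail n (linv (P.e i) x)

lemma measurable_tail (n : ℕ) : Measurable (P.tail n) := by
  induction n with
  | zero => exact measurable_const
  | succ n ih =>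
    refine Finset.measurable_sum _ fun i _ => ?_
    exact ((measurable_jac (P.e_pos i)).const_mul _).mul
      (ih.comp (continuous_linv (P.e_pos i)).measurable)

lemma linv_mem' (i : Bool) {x : ℝ} (hx : x ∈ Ioc (0 : ℝ) 1) :
    linv (P.e i) x ∈ Ioc (0 : ℝ) 1 :=
  Ioc_subset_Ioc_right (by norm_num) (linv_mem (P.e_pos i) hx)

lemma tail_nonneg (n : ℕ) : ∀ x ∈ Ioc (0 : ℝ) 1, 0 ≤ P.tail n x := by
  induction n with
  | zero => intro x _; simp [tail]
  | succ n ih =>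
    intro x hx
    exact Finset.sum_nonneg fun i _ => mul_nonneg
      (mul_nonneg (P.w_pos i).le (jac_pos (P.e_pos i) hx.1.le).le) (ih _ (P.linv_mem' i hx))

lemma tail_le_mul_exp (n : ℕ) : ∀ x ∈ Ioc (0 : ℝ) 1, ∀ z ∈ Ioc (0 : ℝ) 1,
    P.tail n x ≤ P.tail n z * Real.exp (2 * |Real.log x - Real.log z|) := by
  induction n with
  | zero =>
    intro x _ z _
    have : 1 ≤ Real.exp (2 * |Real.log x - Real.log z|) := Real.one_le_exp (by positivity)
    simp only [tail]
    linarith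
  | succ n ih =>
    intro x hx z hz
    simp only [tail]
    rw [Finset.sum_mul]
    refine Finset.sum_le_sum fun i _ => ?_
    have h1 := ih _ (P.linv_mem' i hx) _ (P.linv_mem' i hz)
    have h2 := jac_le_mul_exp (P.e_pos i) (P.e_le_one i) hx.1 hz.1
    have h3 := P.tail_nonneg n _ (P.linv_mem' i hx)
    have hw := (P.w_pos i).le
    have hj := (jac_pos (P.e_pos i) hz.1.le).le
    calc P.w i * jac (P.e i) x * P.tail n (linv (P.e i) x)
        ≤ P.w i * (jac (P.e i) z * Real.exp (2 * |Real.log x - Real.log z| -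
          2 * |Real.log (linv (P.e i) x) - Real.log (linv (P.e i) z)|)) *
          (P.tail n (linv (P.e i) z) *
            Real.exp (2 * |Real.log (linv (P.e i) x) - Real.log (linv (P.e i) z)|)) := by
          gcongr
      _ = _ := by
          rw [Real.exp_sub]
          field_simp

lemma rpow_neg_stretch_le {a : ℝ} (ha : 0 < a) {b : ℝ} (hb : 0 < b) {y : ℝ} (hy : 0 < y) :
    stretch b y ^ (-a) ≤ y ^ (-a) := by
  have h1 := sub_le_stretch_sub hb hy.le
  rw [stretch_of_nonpos le_rfl] at h1
  exact Real.rpow_le_rpow_of_nonpos hy (by linarith) (by linarith)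

lemma rpow_neg_stretch_self_le {a : ℝ} (ha : 0 < a) (ha1 : a ≤ 1) {y : ℝ}
    (hy : y ∈ Ioc (0 : ℝ) (1 / 2)) :
    stretch a y ^ (-a) ≤ y ^ (-a) - a / 2 := by
  have hy0 := hy.1
  set s := (2 * y) ^ a with hs
  have hspos : 0 < s := by positivity
  have hs1 : s ≤ 1 := Real.rpow_le_one (by positivity) (by linarith [hy.2]) ha.le
  rw [stretch_of_nonneg hy0.le, ← hs, Real.mul_rpow hy0.le (by positivity)]
  have h1 : (1 + s) ^ (-a) ≤ 1 - a * (s / (1 + s)) := by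
    rw [Real.rpow_neg (by positivity), ← Real.inv_rpow (by positivity)]
    have h2 : (1 + s)⁻¹ = 1 + -(s / (1 + s)) := by field_simp; ring
    rw [h2]
    have h3 : s / (1 + s) ≤ 1 := by rw [div_le_one (by positivity)]; linarith
    have := rpow_one_add_le_one_add_mul_self (s := -(s / (1 + s))) (by linarith) ha.le ha1
    linarith
  have h4 : s / 2 ≤ s / (1 + s) := by gcongr; linarith
  have h5 : y ^ (-a) * s = 2 ^ a := by
    rw [hs, Real.mul_rpow two_pos.le hy0.le, Real.rpow_neg hy0.le]
    have : 0 < y ^ a := by positivity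
    field_simp
  have h6 : (1 : ℝ) ≤ 2 ^ a := Real.one_le_rpow (by norm_num) ha.le
  have h7 : 0 < y ^ (-a) := by positivity
  calc y ^ (-a) * (1 + s) ^ (-a) ≤ y ^ (-a) * (1 - a * (s / 2)) := by
        gcongr
        refine h1.trans ?_
        gcongr
    _ = y ^ (-a) - a / 2 * (y ^ (-a) * s) := by ring
    _ ≤ y ^ (-a) - a / 2 := by
        rw [h5]
        nlinarith

/-- A time-dependent Lyapunov function for the return time. -/
def lyap (n : ℕ) (x : ℝ) : ℝ := (4 / (P.α * P.p) * x ^ (-P.α) + (n + 1)) ^ 2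

lemma measurable_lyap (n : ℕ) : Measurable (P.lyap n) := by
  unfold lyap
  fun_prop

lemma sq_le_lyap (n : ℕ) {x : ℝ} (hx : 0 < x) : ((n : ℝ) + 1) ^ 2 ≤ P.lyap n x := by
  have h1 := P.α_pos
  have h2 := P.p_pos
  have : 0 ≤ 4 / (P.α * P.p) * x ^ (-P.α) := by positivity
  exact pow_le_pow_left₀ (by positivity) (by linarith) 2

lemma sum_lyap_stretch_le (n : ℕ) {y : ℝ} (hy : y ∈ Ioc (0 : ℝ) (1 / 2)) :
    ∑ i, P.w i * P.lyap (n + 1) (stretch (P.e i) y) ≤ P.lyap n y := by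
  have h1 := P.α_pos
  have h2 := P.p_pos
  have h2' := P.p_lt
  have ha : stretch P.α y ^ (-P.α) ≤ y ^ (-P.α) - P.α / 2 :=
    rpow_neg_stretch_self_le h1 (by linarith [P.α_lt]) hy
  have hb : stretch P.β y ^ (-P.α) ≤ y ^ (-P.α) :=
    rpow_neg_stretch_le h1 (h1.trans P.α_lt_β) hy.1
  have pos : ∀ b : ℝ, 0 < b → 0 ≤ stretch b y ^ (-P.α) := fun b hb => by
    have := strictMono_stretch hb hy.1
    rw [stretch_of_nonpos le_rfl] at this
    positivity
  have ha0 := pos P.α h1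
  have hb0 := pos P.β (h1.trans P.α_lt_β)
  set K := 4 / (P.α * P.p) with hK
  have hK0 : 0 < K := by positivity
  have hKc : K * (P.α / 2) * P.p = 2 := by rw [hK]; field_simp; norm_num
  have hd : 2 ≤ K * (P.α / 2) := by nlinarith [mul_pos hK0 h1]
  set d := K * (P.α / 2) with hdd
  set v := K * y ^ (-P.α) with hv
  have e1 : K * stretch P.α y ^ (-P.α) ≤ v - d := by
    rw [hv, hdd, ← mul_sub]; gcongr
  have e2 : K * stretch P.β y ^ (-P.α) ≤ v := by rw [hv]; gcongr
  have e10 : 0 ≤ K * stretch P.α y ^ (-P.α) := by positivity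
  have e20 : 0 ≤ K * stretch P.β y ^ (-P.α) := by positivity
  simp only [Fintype.sum_bool, w, e, cond_true, cond_false, lyap, ← hK, ← hv]
  push_cast
  have hn : (0 : ℝ) ≤ n := n.cast_nonneg
  set z := v + ((n : ℝ) + 1) with hz
  have s1 : (K * stretch P.α y ^ (-P.α) + ((n : ℝ) + 1 + 1)) ^ 2 ≤ (z + 1 - d) ^ 2 := by
    apply pow_le_pow_left₀ (by positivity); linarith
  have s2 : (K * stretch P.β y ^ (-P.α) + ((n : ℝ) + 1 + 1)) ^ 2 ≤ (z + 1) ^ 2 := by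
    apply pow_le_pow_left₀ (by positivity); linarith
  have hz1 : d + 1 ≤ z := by linarith
  calc _ ≤ P.p * (z + 1 - d) ^ 2 + (1 - P.p) * (z + 1) ^ 2 := by
        gcongr
    _ = z ^ 2 + 2 * z + 1 - 2 * (d * P.p) * (z + 1) + (d * P.p) * d := by ring
    _ ≤ z ^ 2 := by rw [hKc]; nlinarith

lemma lintegral_linv (i : Bool) (u : ℝ → ENNReal) :
    ∫⁻ x in Ioc (0 : ℝ) 1, ENNReal.ofReal (jac (P.e i) x) * u (linv (P.e i) x) =
      ∫⁻ y in Ioc (0 : ℝ) (1 / 2), u y := by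
  rw [← linv_image (P.e_pos i), lintegral_image_eq_lintegral_abs_deriv_mul measurableSet_Ioc
    (fun x hx => (hasDerivAt_linv (P.e_pos i) hx.1).hasDerivWithinAt)
    ((strictMono_linv (P.e_pos i)).injective.injOn)]
  refine setLIntegral_congr_fun measurableSet_Ioc fun x hx => ?_
  simp only [abs_of_pos (jac_pos (P.e_pos i) hx.1.le)]

/-- The Lyapunov functional evaluated along the tail densities. -/
def lyapMass (n : ℕ) : ENNReal :=
  ∫⁻ x in Ioc (0 : ℝ) 1, ENNReal.ofReal (P.tail n x * P.lyap n x)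

lemma lyap_nonneg (n : ℕ) (x : ℝ) : 0 ≤ P.lyap n x := sq_nonneg _

lemma lyapMass_succ_add_le (n : ℕ) :
    P.lyapMass (n + 1) + ∫⁻ x in Ioc (1 / 2 : ℝ) 1, ENNReal.ofReal (P.tail n x * P.lyap n x) ≤
      P.lyapMass n := by
  have hm : ∀ i, Measurable fun y : ℝ =>
      ENNReal.ofReal (P.w i * (P.tail n y * P.lyap (n + 1) (stretch (P.e i) y))) := fun i =>
    (((P.measurable_tail n).mul ((P.measurable_lyap (n + 1)).comp
      (continuous_stretch (P.e_pos i)).measurable)).const_mul _).ennreal_ofReal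
  have key : P.lyapMass (n + 1) = ∫⁻ y in Ioc (0 : ℝ) (1 / 2), ∑ i,
      ENNReal.ofReal (P.w i * (P.tail n y * P.lyap (n + 1) (stretch (P.e i) y))) := by
    rw [lintegral_finsetSum _ fun i _ => hm i]
    have h1 : ∀ i, ∫⁻ y in Ioc (0 : ℝ) (1 / 2),
        ENNReal.ofReal (P.w i * (P.tail n y * P.lyap (n + 1) (stretch (P.e i) y))) =
        ∫⁻ x in Ioc (0 : ℝ) 1, ENNReal.ofReal (jac (P.e i) x) *
          ENNReal.ofReal (P.w i * (P.tail n (linv (P.e i) x) * P.lyap (n + 1) x)) := fun i => by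
      rw [← P.lintegral_linv i]
      refine setLIntegral_congr_fun measurableSet_Ioc fun x hx => ?_
      simp only [stretch_linv (P.e_pos i)]
    simp_rw [h1]
    rw [← lintegral_finsetSum]
    · refine setLIntegral_congr_fun measurableSet_Ioc fun x hx => ?_
      simp only [tail]
      rw [Finset.sum_mul, ENNReal.ofReal_sum_of_nonneg]
      · refine Finset.sum_congr rfl fun i _ => ?_
        rw [← ENNReal.ofReal_mul (jac_pos (P.e_pos i) hx.1.le).le]
        congr 1
        ring
      · intro i _
        have a1 := (P.w_pos i).le
        have a2 := (jac_pos (P.e_pos i) hx.1.le).le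
        have a3 := P.tail_nonneg n _ (P.linv_mem' i hx)
        have a4 := P.lyap_nonneg (n + 1) x
        positivity
    · intro i _
      exact (measurable_jac (P.e_pos i)).ennreal_ofReal.mul
        ((((P.measurable_tail n).comp (continuous_linv (P.e_pos i)).measurable).mul
          (P.measurable_lyap (n + 1))).const_mul _).ennreal_ofReal
  have hle : P.lyapMass (n + 1) ≤
      ∫⁻ y in Ioc (0 : ℝ) (1 / 2), ENNReal.ofReal (P.tail n y * P.lyap n y) := by
    rw [key]
    refine setLIntegral_mono' measurableSet_Ioc fun y hy => ?_
    have a3 := P.tail_nonneg n _ (Ioc_subset_Ioc_right (by norm_num) hy)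
    rw [← ENNReal.ofReal_sum_of_nonneg fun i _ => by
      have a1 := (P.w_pos i).le
      have a4 := P.lyap_nonneg (n + 1) (stretch (P.e i) y)
      positivity]
    refine ENNReal.ofReal_le_ofReal ?_
    calc ∑ i, P.w i * (P.tail n y * P.lyap (n + 1) (stretch (P.e i) y))
        = P.tail n y * ∑ i, P.w i * P.lyap (n + 1) (stretch (P.e i) y) := by
          rw [Finset.mul_sum]
          exact Finset.sum_congr rfl fun i _ => by ring
      _ ≤ _ := mul_le_mul_of_nonneg_left (P.sum_lyap_stretch_le n hy) a3
  calc _ ≤ (∫⁻ y in Ioc (0 : ℝ) (1 / 2), ENNReal.ofReal (P.tail n y * P.lyap n y)) +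
        ∫⁻ x in Ioc (1 / 2 : ℝ) 1, ENNReal.ofReal (P.tail n x * P.lyap n x) := by gcongr
    _ = P.lyapMass n := by
        rw [← lintegral_union measurableSet_Ioc, Ioc_union_Ioc_eq_Ioc (by norm_num) (by norm_num)]
        · rfl
        · exact Set.disjoint_left.2 fun x h1 h2 => absurd h1.2 (not_le.2 h2.1)

lemma lyapMass_zero_lt_top : P.lyapMass 0 < ⊤ := by
  have h1 := P.α_pos
  have h2 := P.α_lt
  have hInt : IntegrableOn (fun x : ℝ => P.tail 0 x * P.lyap 0 x) (Ioc 0 1) := by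
    set K := 4 / (P.α * P.p) with hK
    have i1 : IntegrableOn (fun x : ℝ => x ^ (-(2 * P.α))) (Ioc 0 1) :=
      (intervalIntegrable_iff_integrableOn_Ioc_of_le zero_le_one).1
        (intervalIntegral.intervalIntegrable_rpow' (by linarith))
    have i2 : IntegrableOn (fun x : ℝ => x ^ (-P.α)) (Ioc 0 1) :=
      (intervalIntegrable_iff_integrableOn_Ioc_of_le zero_le_one).1
        (intervalIntegral.intervalIntegrable_rpow' (by linarith))
    have i3 : IntegrableOn (fun _ : ℝ => (1 : ℝ)) (Ioc 0 1) :=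
      integrableOn_const (by simp)
    refine IntegrableOn.congr_fun (((i1.const_mul (K ^ 2 / 2)).add (i2.const_mul K)).add
      (i3.const_mul (1 / 2))) (fun x hx => ?_) measurableSet_Ioc
    have : x ^ (-(2 * P.α)) = (x ^ (-P.α)) ^ 2 := by
      rw [← Real.rpow_natCast, ← Real.rpow_mul hx.1.le]
      congr 1
      push_cast
      ring
    simp only [Pi.add_apply, tail, lyap, ← hK, this]
    push_cast
    ring
  have := hInt.lintegral_lt_top
  exact this

lemma sum_lintegral_tail_le (N : ℕ) :
    P.lyapMass N + ∑ n ∈ Finset.range N,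
      ∫⁻ x in Ioc (1 / 2 : ℝ) 1, ENNReal.ofReal (P.tail n x * P.lyap n x) ≤ P.lyapMass 0 := by
  induction N with
  | zero => simp
  | succ N ih =>
    rw [Finset.sum_range_succ, add_comm (Finset.sum _ _), ← add_assoc]
    exact (add_le_add_left (P.lyapMass_succ_add_le N) _).trans ih

lemma tail_le_four_mul (n : ℕ) {x z : ℝ} (hx : x ∈ Ioc (1 / 2 : ℝ) 1)
    (hz : z ∈ Ioc (1 / 2 : ℝ) 1) : P.tail n x ≤ 4 * P.tail n z := by
  have hx' : x ∈ Ioc (0 : ℝ) 1 := Ioc_subset_Ioc_left (by norm_num) hx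
  have hz' : z ∈ Ioc (0 : ℝ) 1 := Ioc_subset_Ioc_left (by norm_num) hz
  have hl : ∀ {x : ℝ}, x ∈ Ioc (1 / 2 : ℝ) 1 → -Real.log 2 ≤ Real.log x ∧ Real.log x ≤ 0 :=
    fun {x} hx => by
      constructor
      · rw [← Real.log_inv]
        exact Real.log_le_log (by norm_num) (by linarith [hx.1])
      · exact Real.log_nonpos (by linarith [hx.1]) hx.2
  have h1 : |Real.log x - Real.log z| ≤ Real.log 2 := by
    rw [abs_le]
    constructor <;> linarith [hl hx, hl hz, (hl hx).1, (hl hx).2, (hl hz).1, (hl hz).2]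
  have h2 : Real.exp (2 * |Real.log x - Real.log z|) ≤ 4 := by
    calc Real.exp (2 * |Real.log x - Real.log z|) ≤ Real.exp (Real.log 2 * 2) := by
          apply Real.exp_le_exp.2; linarith
      _ = 4 := by rw [Real.exp_mul, Real.exp_log two_pos]; norm_num
  have h3 := P.tail_le_mul_exp n x hx' z hz'
  have h4 := P.tail_nonneg n z hz'
  nlinarith

/-- A uniform bound for the tail densities on the base. -/
def tb (n : ℕ) : ℝ := 4 * P.tail n 1

lemma tb_nonneg (n : ℕ) : 0 ≤ P.tb n :=
  mul_nonneg (by norm_num) (P.tail_nonneg n 1 (by simp))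

lemma tail_le_tb (n : ℕ) {x : ℝ} (hx : x ∈ Ioc (1 / 2 : ℝ) 1) : P.tail n x ≤ P.tb n :=
  P.tail_le_four_mul n hx (by norm_num)

lemma summable_sq_mul_tb : Summable fun n : ℕ => ((n : ℝ) + 1) ^ 2 * P.tb n := by
  have hlow : ∀ n : ℕ, ENNReal.ofReal (((n : ℝ) + 1) ^ 2 * P.tb n / 32) ≤
      ∫⁻ x in Ioc (1 / 2 : ℝ) 1, ENNReal.ofReal (P.tail n x * P.lyap n x) := fun n => by
    calc ENNReal.ofReal (((n : ℝ) + 1) ^ 2 * P.tb n / 32)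
        = ∫⁻ _ in Ioc (1 / 2 : ℝ) 1, ENNReal.ofReal (((n : ℝ) + 1) ^ 2 * P.tb n / 16) := by
          rw [setLIntegral_const, Real.volume_Ioc, ← ENNReal.ofReal_mul
            (div_nonneg (mul_nonneg (sq_nonneg _) (P.tb_nonneg n)) (by norm_num))]
          congr 1
          ring
      _ ≤ _ := by
          refine setLIntegral_mono' measurableSet_Ioc fun x hx => ENNReal.ofReal_le_ofReal ?_
          have h1 := P.tail_le_four_mul n (x := 1) (by norm_num) hx
          have h2 := P.sq_le_lyap n (x := x) (by linarith [hx.1])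
          have h3 := P.tail_nonneg n x (Ioc_subset_Ioc_left (by norm_num) hx)
          have h4 : P.tb n / 16 ≤ P.tail n x := by rw [tb]; linarith
          calc ((n : ℝ) + 1) ^ 2 * P.tb n / 16 = P.tb n / 16 * ((n : ℝ) + 1) ^ 2 := by ring
            _ ≤ P.tail n x * P.lyap n x := by gcongr
  have hnn : ∀ n : ℕ, 0 ≤ ((n : ℝ) + 1) ^ 2 * P.tb n / 32 := fun n =>
    div_nonneg (mul_nonneg (sq_nonneg _) (P.tb_nonneg n)) (by norm_num)
  have hs : Summable fun n : ℕ => ((n : ℝ) + 1) ^ 2 * P.tb n / 32 := by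
    refine summable_of_sum_range_le (c := (P.lyapMass 0).toReal) hnn fun N => ?_
    rw [← ENNReal.ofReal_le_iff_le_toReal P.lyapMass_zero_lt_top.ne,
      ENNReal.ofReal_sum_of_nonneg fun i _ => hnn i]
    exact (Finset.sum_le_sum fun i _ => hlow i).trans
      (le_add_self.trans (P.sum_lintegral_tail_le N))
  simpa using (hs.mul_right 32)

end LSVParams

namespace LSVParams

variable (P : LSVParams)

/-- The skew product. -/
def S : ℝ × ℝ → ℝ × ℝ := skewLSV P.α P.β P.p

/-- The phase space up to a null set. -/
def X : Set (ℝ × ℝ) := Ioc (0 : ℝ) 1 ×ˢ Ico (0 : ℝ) 1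

/-- The base of the first return map up to a null set. -/
def Y : Set (ℝ × ℝ) := Ioc (1 / 2 : ℝ) 1 ×ˢ Ico (0 : ℝ) 1

lemma measurableSet_X : MeasurableSet X := measurableSet_Ioc.prod measurableSet_Ico

lemma measurableSet_Y : MeasurableSet Y := measurableSet_Ioc.prod measurableSet_Ico

lemma Y_subset_X : Y ⊆ X := prod_mono (Ioc_subset_Ioc_left (by norm_num)) subset_rfl

lemma S_apply (q : ℝ × ℝ) : P.S q = (lsv (P.e (decide (q.2 < P.p))) q.1,
    (q.2 - P.s (decide (q.2 < P.p))) / P.w (decide (q.2 < P.p))) := by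
  by_cases h : q.2 < P.p <;> simp [S, skewLSV, alphaOf, phiMap, h, e, s, w]

lemma measurable_S : Measurable P.S := by
  have h2 : MeasurableSet {q : ℝ × ℝ | q.2 < P.p} := measurableSet_lt measurable_snd measurable_const
  have h3 : MeasurableSet {q : ℝ × ℝ | q.1 ≤ 1 / 2} :=
    measurableSet_le measurable_fst measurable_const
  have ha : Measurable fun q : ℝ × ℝ => alphaOf P.α P.β P.p q.2 :=
    Measurable.ite h2 measurable_const measurable_const
  refine Measurable.prodMk (Measurable.ite h3 ?_ ?_) (Measurable.ite h2 ?_ ?_)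
  · exact measurable_fst.mul ((ha.const_pow 2 |>.mul (measurable_fst.pow ha)).const_add 1)
  · exact (measurable_fst.const_mul 2).sub_const 1
  · exact measurable_snd.div_const _
  · exact (measurable_snd.sub_const _).div_const _

lemma noise_mem {ω : ℝ} (h : ω ∈ Ico (0 : ℝ) 1) :
    (ω - P.s (decide (ω < P.p))) / P.w (decide (ω < P.p)) ∈ Ico (0 : ℝ) 1 := by
  have h1 := P.p_pos
  have h2 := P.p_lt
  by_cases hω : ω < P.p
  · simp only [hω, decide_true, s, w, cond_true, sub_zero]
    exact ⟨div_nonneg h.1 h1.le, (div_lt_one h1).2 hω⟩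
  · simp only [hω, decide_false, s, w, cond_false]
    exact ⟨div_nonneg (by linarith) (by linarith),
      (div_lt_one (by linarith)).2 (by linarith [h.2])⟩

lemma mapsTo_S {q : ℝ × ℝ} (hq : q ∈ X) : P.S q ∈ X := by
  rw [S_apply]
  refine ⟨?_, P.noise_mem hq.2⟩
  have he := P.e_pos (decide (q.2 < P.p))
  by_cases hx : q.1 ≤ 1 / 2
  · have hm : q.1 ∈ Ioc (0 : ℝ) (1 / 2) := ⟨hq.1.1, hx⟩
    simp only [lsv_of_mem hm]
    rw [← linv_image he] at hm
    obtain ⟨z, hz, hz'⟩ := hm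
    rw [← hz', stretch_linv he]
    exact hz
  · simp only [lsv, if_neg hx]
    constructor <;> linarith [hq.1.2]

lemma le_fst_S {q : ℝ × ℝ} (hq : q ∈ X) (hY : q ∉ Y) :
    q.1 + 2 * q.1 ^ 2 ≤ (P.S q).1 := by
  have hx : q.1 ≤ 1 / 2 := by
    by_contra hx
    exact hY ⟨⟨not_le.1 hx, hq.1.2⟩, hq.2⟩
  have h0 := hq.1.1
  rw [S_apply]
  simp only [lsv_of_mem (show q.1 ∈ Ioc (0 : ℝ) (1 / 2) from ⟨h0, hx⟩), stretch_of_nonneg h0.le]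
  have := Real.rpow_le_rpow_of_exponent_ge (x := 2 * q.1) (by positivity) (by linarith)
    (P.e_le_one (decide (q.2 < P.p)))
  rw [Real.rpow_one] at this
  nlinarith

lemma exists_hit {q : ℝ × ℝ} (hq : q ∈ X) : ∃ n, P.S^[n] q ∈ Y := by
  by_contra! hn
  have hX : ∀ n, P.S^[n] q ∈ X := fun n => by
    induction n with
    | zero => exact hq
    | succ n ih => rw [Function.iterate_succ_apply']; exact P.mapsTo_S ih
  have hgrow : ∀ n : ℕ, q.1 + n * (2 * q.1 ^ 2) ≤ (P.S^[n] q).1 := fun n => by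
    induction n with
    | zero => simp
    | succ n ih =>
      have h1 := P.le_fst_S (hX n) (hn n)
      rw [Function.iterate_succ_apply']
      have h0 := hq.1.1
      have h2 : q.1 ≤ (P.S^[n] q).1 := by
        have : 0 ≤ (n : ℝ) * (2 * q.1 ^ 2) := by positivity
        linarith
      have h3 : q.1 ^ 2 ≤ (P.S^[n] q).1 ^ 2 := by gcongr
      push_cast
      linarith
  have h0 := hq.1.1
  obtain ⟨n, hn⟩ := exists_nat_gt (1 / (2 * q.1 ^ 2))
  rw [div_lt_iff₀ (by positivity)] at hn
  linarith [hgrow n, (hX n).1.2]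

lemma exists_hit_or (q : ℝ × ℝ) : ∃ n, P.S^[n] q ∈ Y ∨ q ∉ X := by
  by_cases hq : q ∈ X
  · exact (P.exists_hit hq).imp fun n h => Or.inl h
  · exact ⟨0, Or.inr hq⟩

open Classical in
/-- The hitting time of the base. -/
def τ (q : ℝ × ℝ) : ℕ := Nat.find (P.exists_hit_or q)

lemma measurable_τ : Measurable P.τ := by
  classical
  refine measurable_find _ fun n => ?_
  exact (measurableSet_Y.preimage (P.measurable_S.iterate n)).union measurableSet_X.compl

lemma hitting : HittingSystem P.S X Y P.τ where
  mapsTo _ hq := P.mapsTo_S hq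
  subset := Y_subset_X
  zero q hq := by
    classical
    exact (Nat.find_eq_zero _).2 (Or.inl hq)
  succ q hq hY := by
    classical
    have hS := P.mapsTo_S hq
    unfold τ
    rw [Nat.find_eq_iff]
    have spec := Nat.find_spec (P.exists_hit_or (P.S q))
    refine ⟨Or.inl ?_, ?_⟩
    · rw [Function.iterate_succ_apply]
      exact spec.resolve_right (not_not.2 hS)
    · rintro (_ | n) hn
      · simpa using ⟨hY, hq⟩
      · rw [Function.iterate_succ_apply]
        have := Nat.find_min (P.exists_hit_or (P.S q)) (Nat.lt_of_succ_lt_succ hn)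
        simp only [not_or, not_not] at this ⊢
        exact ⟨this.1, hq⟩
  measY := measurableSet_Y
  measS := P.measurable_S
  measτ := P.measurable_τ

end LSVParams

namespace LSVParams

/-- Measurable functions which are bounded on the phase space. -/
structure BM (u : ℝ × ℝ → ℝ) : Prop where
  meas : Measurable u
  bdd : ∃ b, 0 ≤ b ∧ ∀ q ∈ X, |u q| ≤ b

lemma BM.of_bdd {u : ℝ × ℝ → ℝ} (hu : Measurable u) {b : ℝ} (h : ∀ q ∈ X, |u q| ≤ b) : BM u :=
  ⟨hu, |b|, abs_nonneg b, fun q hq => (h q hq).trans (le_abs_self b)⟩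

lemma BM.add {u v : ℝ × ℝ → ℝ} (hu : BM u) (hv : BM v) : BM fun q => u q + v q := by
  obtain ⟨b, -, hb⟩ := hu.bdd
  obtain ⟨c, -, hc⟩ := hv.bdd
  exact BM.of_bdd (hu.meas.add hv.meas) fun q hq =>
    (abs_add_le _ _).trans (add_le_add (hb q hq) (hc q hq))

lemma BM.mul {u v : ℝ × ℝ → ℝ} (hu : BM u) (hv : BM v) : BM fun q => u q * v q := by
  obtain ⟨b, hb0, hb⟩ := hu.bdd
  obtain ⟨c, hc0, hc⟩ := hv.bdd
  refine BM.of_bdd (hu.meas.mul hv.meas) (b := b * c) fun q hq => ?_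
  rw [abs_mul]
  exact mul_le_mul (hb q hq) (hc q hq) (abs_nonneg _) hb0

lemma BM.const (c : ℝ) : BM fun _ => c := BM.of_bdd measurable_const fun _ _ => le_rfl

lemma BM.ite {u v : ℝ × ℝ → ℝ} (hu : BM u) (hv : BM v) {s : ℝ × ℝ → Prop} [DecidablePred s]
    (hs : MeasurableSet {q | s q}) : BM fun q => if s q then u q else v q := by
  obtain ⟨b, hb0, hb⟩ := hu.bdd
  obtain ⟨c, hc0, hc⟩ := hv.bdd
  refine BM.of_bdd (hu.meas.ite hs hv.meas) (b := b + c) fun q hq => ?_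
  split_ifs
  · linarith [hb q hq]
  · linarith [hc q hq]

lemma volume_X : volume X = 1 := by
  rw [X, Measure.volume_eq_prod, Measure.prod_prod]
  simp

lemma volume_Y : volume Y = ENNReal.ofReal (1 / 2) := by
  rw [Y, Measure.volume_eq_prod, Measure.prod_prod, Real.volume_Ioc, Real.volume_Ico, sub_zero,
    ENNReal.ofReal_one, mul_one]
  norm_num

lemma BM.integrableOn {u : ℝ × ℝ → ℝ} (hu : BM u) {Z : Set (ℝ × ℝ)} (hZ : MeasurableSet Z)
    (hZX : Z ⊆ X) : IntegrableOn u Z := by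
  obtain ⟨b, -, hb⟩ := hu.bdd
  refine IntegrableOn.of_bound ?_ hu.meas.aestronglyMeasurable b
    (ae_restrict_of_forall_mem hZ fun q hq => hb q (hZX hq))
  exact (measure_mono hZX).trans_lt (by rw [volume_X]; exact ENNReal.one_lt_top)

variable (P : LSVParams)

lemma BM.comp_S {u : ℝ × ℝ → ℝ} (hu : BM u) : BM fun q => u (P.S q) := by
  obtain ⟨b, -, hb⟩ := hu.bdd
  exact BM.of_bdd (hu.meas.comp P.measurable_S) fun q hq => hb _ (P.mapsTo_S hq)

/-- The inverse branch of the skew product over the inverse branch `g i` in the fibre. -/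
def σ (g : Bool → ℝ → ℝ) (i : Bool) (q : ℝ × ℝ) : ℝ × ℝ := (g i q.1, P.ψ i q.2)

/-- The averaged transfer operator of a family of inverse branches `g` with Jacobians `j`. -/
def trans (g j : Bool → ℝ → ℝ) (u : ℝ × ℝ → ℝ) (q : ℝ × ℝ) : ℝ :=
  ∑ i, P.w i * j i q.1 * u (P.σ g i q)

/-- `g` consists of the inverse branches over the interval `J`, with derivatives `j`. -/
structure IsBranch (J : Set ℝ) (g j : Bool → ℝ → ℝ) : Prop where
  measJ : MeasurableSet J
  subset : J ⊆ Ioc 0 1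
  meas : ∀ i, Measurable (g i)
  meas' : ∀ i, Measurable (j i)
  deriv : ∀ i, ∀ x ∈ Ioc (0 : ℝ) 1, HasDerivAt (g i) (j i x) x
  pos : ∀ i, ∀ x ∈ Ioc (0 : ℝ) 1, 0 < j i x
  le_one : ∀ i, ∀ x ∈ Ioc (0 : ℝ) 1, j i x ≤ 1
  inj : ∀ i, InjOn (g i) (Ioc 0 1)
  image : ∀ i, g i '' Ioc 0 1 = J
  inv : ∀ i, ∀ x ∈ Ioc (0 : ℝ) 1, lsv (P.e i) (g i x) = x

/-- The left inverse branches. -/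
def gl (i : Bool) : ℝ → ℝ := linv (P.e i)

/-- The Jacobians of the left inverse branches. -/
def jl (i : Bool) : ℝ → ℝ := jac (P.e i)

/-- The right inverse branches. -/
def gr (_ : Bool) (x : ℝ) : ℝ := (x + 1) / 2

/-- The Jacobians of the right inverse branches. -/
def jr (_ : Bool) (_ : ℝ) : ℝ := 1 / 2

lemma isBranch_left : P.IsBranch (Ioc 0 (1 / 2)) P.gl P.jl where
  measJ := measurableSet_Ioc
  subset := Ioc_subset_Ioc_right (by norm_num)
  meas i := (continuous_linv (P.e_pos i)).measurable
  meas' i := measurable_jac (P.e_pos i)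
  deriv i x hx := hasDerivAt_linv (P.e_pos i) hx.1
  pos i x hx := jac_pos (P.e_pos i) hx.1.le
  le_one i x hx := jac_le_one (P.e_pos i) hx.1.le
  inj i := (strictMono_linv (P.e_pos i)).injective.injOn
  image i := linv_image (P.e_pos i)
  inv i x hx := lsv_linv (P.e_pos i) hx

lemma isBranch_right : P.IsBranch (Ioc (1 / 2) 1) gr jr where
  measJ := measurableSet_Ioc
  subset := Ioc_subset_Ioc_left (by norm_num)
  meas i := by unfold gr; fun_prop
  meas' i := measurable_const
  deriv i x hx := ((hasDerivAt_id x).add_const 1).div_const 2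
  pos i x hx := by norm_num [jr]
  le_one i x hx := by norm_num [jr]
  inj i x _ y _ h := by simp only [gr] at h; linarith
  image i := by
    ext y
    simp only [gr, mem_image, mem_Ioc]
    constructor
    · rintro ⟨x, hx, rfl⟩
      constructor <;> linarith [hx.1, hx.2]
    · intro hy
      exact ⟨2 * y - 1, ⟨by linarith [hy.1], by linarith [hy.2]⟩, by ring⟩
  inv i x hx := by
    rw [lsv, gr, if_neg (show ¬ (x + 1) / 2 ≤ 1 / 2 by linarith [hx.1])]
    ring

lemma ψ_mem (i : Bool) {ω : ℝ} (h : ω ∈ Ico (0 : ℝ) 1) : P.ψ i ω ∈ Ico (0 : ℝ) 1 := by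
  have h1 := P.p_pos
  have h2 := P.p_lt
  cases i <;> simp only [ψ, w, s, cond_true, cond_false, mem_Ico] <;> constructor <;>
    nlinarith [h.1, h.2]

lemma decide_ψ (i : Bool) {ω : ℝ} (h : ω ∈ Ico (0 : ℝ) 1) : decide (P.ψ i ω < P.p) = i := by
  have h1 := P.p_pos
  have h2 := P.p_lt
  cases i
  · have : P.p ≤ P.ψ false ω := by
      simp only [ψ, w, s, cond_false]
      nlinarith [h.1]
    simpa using this
  · have : P.ψ true ω < P.p := by
      simp only [ψ, w, s, cond_true]
      nlinarith [h.2]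
    simpa using this

lemma ψ_image (i : Bool) : P.ψ i '' Ico 0 1 = Ico 0 1 ∩ {ω | decide (ω < P.p) = i} := by
  ext ω
  constructor
  · rintro ⟨ω, h, rfl⟩
    exact ⟨P.ψ_mem i h, P.decide_ψ i h⟩
  · rintro ⟨h, rfl⟩
    refine ⟨_, P.noise_mem h, ?_⟩
    have := (P.w_pos (decide (ω < P.p))).ne'
    simp only [ψ]
    field_simp
    ring

namespace IsBranch

variable {P} {J : Set ℝ} {g j : Bool → ℝ → ℝ}

lemma mapsTo (h : P.IsBranch J g j) (i : Bool) {q : ℝ × ℝ} (hq : q ∈ X) :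
    P.σ g i q ∈ J ×ˢ Ico (0 : ℝ) 1 :=
  ⟨h.image i ▸ mem_image_of_mem _ hq.1, P.ψ_mem i hq.2⟩

lemma mapsTo_X (h : P.IsBranch J g j) (i : Bool) {q : ℝ × ℝ} (hq : q ∈ X) : P.σ g i q ∈ X :=
  prod_mono h.subset subset_rfl (h.mapsTo i hq)

lemma S_σ (h : P.IsBranch J g j) (i : Bool) {q : ℝ × ℝ} (hq : q ∈ X) : P.S (P.σ g i q) = q := by
  have hd : decide ((P.σ g i q).2 < P.p) = i := P.decide_ψ i hq.2
  rw [S_apply, hd]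
  have := (P.w_pos i).ne'
  ext
  · exact h.inv i _ hq.1
  · simp only [σ, ψ]
    field_simp
    ring

lemma image_σ (h : P.IsBranch J g j) (i : Bool) :
    P.σ g i '' X = J ×ˢ Ico (0 : ℝ) 1 ∩ {q | decide (q.2 < P.p) = i} := by
  have : P.σ g i = Prod.map (g i) (P.ψ i) := rfl
  rw [this, X, prodMap_image_prod, h.image, ψ_image]
  ext q
  simp only [mem_prod, mem_inter_iff, mem_ofPred_eq]
  tauto

lemma measurable_σ (h : P.IsBranch J g j) (i : Bool) : Measurable (P.σ g i) := by
  have : Measurable (P.ψ i) := by unfold ψ; fun_prop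
  exact ((h.meas i).comp measurable_fst).prodMk (this.comp measurable_snd)

lemma integral_branch (h : P.IsBranch J g j) (i : Bool) (u : ℝ × ℝ → ℝ) :
    ∫ q in P.σ g i '' X, u q = ∫ q in X, P.w i * j i q.1 * u (P.σ g i q) := by
  have hd : ∀ q ∈ X, HasFDerivWithinAt (P.σ g i)
      ((ContinuousLinearMap.toSpanSingleton ℝ (j i q.1)).prodMap
        (ContinuousLinearMap.toSpanSingleton ℝ (P.w i))) X q := fun q hq => by
    have h1 : HasDerivAt (P.ψ i) (P.w i) q.2 := by
      have := ((hasDerivAt_id q.2).const_mul (P.w i)).add_const (P.s i)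
      rwa [mul_one] at this
    exact ((h.deriv i _ hq.1).hasFDerivAt.prodMap q h1.hasFDerivAt).hasFDerivWithinAt
  have hinj : InjOn (P.σ g i) X := fun q hq q' hq' e => by
    rw [← h.S_σ i hq, e, h.S_σ i hq']
  rw [integral_image_eq_integral_abs_det_fderiv_smul volume measurableSet_X hd hinj]
  refine setIntegral_congr_fun measurableSet_X fun q hq => ?_
  have hdet : ((ContinuousLinearMap.toSpanSingleton ℝ (j i q.1)).prodMap
      (ContinuousLinearMap.toSpanSingleton ℝ (P.w i))).det = j i q.1 * P.w i := by
    rw [ContinuousLinearMap.det, ContinuousLinearMap.coe_prodMap, LinearMap.det_prodMap]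
    exact congrArg₂ (· * ·) (ContinuousLinearMap.det_toSpanSingleton _)
      (ContinuousLinearMap.det_toSpanSingleton _)
  simp only [hdet, smul_eq_mul]
  rw [abs_of_pos (mul_pos (h.pos i _ hq.1) (P.w_pos i)), mul_comm (j i q.1)]

lemma bm_branch (h : P.IsBranch J g j) (i : Bool) {u : ℝ × ℝ → ℝ} (hu : BM u) :
    BM fun q => P.w i * j i q.1 * u (P.σ g i q) := by
  obtain ⟨b, -, hb⟩ := hu.bdd
  have h1 : BM fun q => u (P.σ g i q) :=
    BM.of_bdd (hu.meas.comp (h.measurable_σ i)) fun q hq => hb _ (h.mapsTo_X i hq)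
  have h2 : BM fun q => j i q.1 := by
    refine BM.of_bdd ((h.meas' i).comp measurable_fst) (b := 1) fun q hq => ?_
    rw [abs_of_pos (h.pos i _ hq.1)]
    exact h.le_one i _ hq.1
  exact ((BM.const (P.w i)).mul h2).mul h1

lemma bm_trans (h : P.IsBranch J g j) {u : ℝ × ℝ → ℝ} (hu : BM u) : BM (P.trans g j u) := by
  have : P.trans g j u = fun q => P.w true * j true q.1 * u (P.σ g true q) +
      P.w false * j false q.1 * u (P.σ g false q) := by
    ext q; simp [trans]
  rw [this]
  exact (h.bm_branch _ hu).add (h.bm_branch _ hu)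

lemma integral_trans_mul (h : P.IsBranch J g j) {u G : ℝ × ℝ → ℝ} (hu : BM u) (hG : BM G) :
    ∫ q in X, P.trans g j u q * G q = ∫ q in J ×ˢ Ico (0 : ℝ) 1, u q * G (P.S q) := by
  have hm : ∀ i, MeasurableSet {q : ℝ × ℝ | decide (q.2 < P.p) = i} := fun i => by
    have : MeasurableSet {q : ℝ × ℝ | q.2 < P.p} := measurableSet_lt measurable_snd measurable_const
    cases i
    · simpa [compl_ofPred] using this.compl
    · simpa using this
  have hJ : MeasurableSet (J ×ˢ Ico (0 : ℝ) 1) := h.measJ.prod measurableSet_Ico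
  have hJX : J ×ˢ Ico (0 : ℝ) 1 ⊆ X := prod_mono h.subset subset_rfl
  have huG : BM fun q => u q * G (P.S q) := hu.mul (BM.comp_S P hG)
  have hsplit : J ×ˢ Ico (0 : ℝ) 1 = P.σ g true '' X ∪ P.σ g false '' X := by
    rw [h.image_σ, h.image_σ, ← inter_union_distrib_left]
    symm
    apply inter_eq_left.2
    intro q _
    by_cases hq : q.2 < P.p <;> simp [hq, not_lt.1]
  have hdisj : Disjoint (P.σ g true '' X) (P.σ g false '' X) := by
    rw [h.image_σ, h.image_σ, Set.disjoint_left]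
    rintro q ⟨-, h1⟩ ⟨-, h2⟩
    exact absurd (h1.symm.trans h2) (by simp)
  have hmi : ∀ i, MeasurableSet (P.σ g i '' X) := fun i => by
    rw [h.image_σ]; exact hJ.inter (hm i)
  have hsub : ∀ i, P.σ g i '' X ⊆ X := fun i => by
    rw [h.image_σ]; exact inter_subset_left.trans hJX
  rw [hsplit, setIntegral_union hdisj (hmi _) (huG.integrableOn (hmi _) (hsub _))
    (huG.integrableOn (hmi _) (hsub _)), h.integral_branch, h.integral_branch,
    ← integral_add ((h.bm_branch _ huG).integrableOn measurableSet_X subset_rfl)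
      ((h.bm_branch _ huG).integrableOn measurableSet_X subset_rfl)]
  refine setIntegral_congr_fun measurableSet_X fun q hq => ?_
  simp only [trans, Fintype.sum_bool, h.S_σ _ hq]
  ring

end IsBranch

end LSVParams

namespace HittingSystem

variable {Ω : Type*} [MeasurableSpace Ω] {S : Ω → Ω} {X Y : Set Ω} {τ : Ω → ℕ}

lemma mem_iff (h : HittingSystem S X Y τ) {q : Ω} (hq : q ∈ X) : q ∈ Y ↔ τ q = 0 := by
  refine ⟨h.zero q, fun h0 => ?_⟩
  by_contra hY
  have := h.succ q hq hY
  omega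

lemma time_eq (h : HittingSystem S X Y τ) {n : ℕ} :
    ∀ {q : Ω}, q ∈ X → n ≤ τ q → S^[n] q ∈ X ∧ τ q = τ (S^[n] q) + n := by
  induction n with
  | zero => intro q hq _; exact ⟨hq, rfl⟩
  | succ n ih =>
    intro q hq hn
    obtain ⟨h1, h2⟩ := ih hq (Nat.le_of_succ_le hn)
    have h3 : S^[n] q ∉ Y := fun hY => by rw [h.zero _ hY] at h2; omega
    rw [Function.iterate_succ_apply']
    exact ⟨h.mapsTo _ h1, by rw [h2, h.succ _ h1 h3]; omega⟩

lemma iterate_mem_iff (h : HittingSystem S X Y τ) {n : ℕ} {q : Ω} (hq : q ∈ X) (hn : n ≤ τ q) :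
    S^[n] q ∈ Y ↔ τ q = n := by
  obtain ⟨h1, h2⟩ := h.time_eq hq hn
  rw [h.mem_iff h1]
  omega

end HittingSystem

namespace LSVParams

variable (P : LSVParams)

/-- Transfer along the left branches. -/
def A (u : ℝ × ℝ → ℝ) : ℝ × ℝ → ℝ := P.trans P.gl P.jl u

/-- Transfer along the right branches. -/
def B (u : ℝ × ℝ → ℝ) : ℝ × ℝ → ℝ := P.trans gr jr u

/-- Transfer of a density on the base, restricted to the points which return at time `n + 1`. -/
def Tn : ℕ → (ℝ × ℝ → ℝ) → ℝ × ℝ → ℝ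
  | 0, u => P.B u
  | n + 1, u => P.A (Tn n u)

/-- Transfer of the density `h` on the base, multiplied by the Birkhoff sums of `f` over the first
`n + 1` steps and restricted to the points which return at time `n + 1`. -/
def acc (f h : ℝ × ℝ → ℝ) : ℕ → ℝ × ℝ → ℝ
  | 0 => P.B fun q => f q * h q
  | n + 1 => P.A fun q => acc f h n q + f q * P.Tn n h q

lemma bm_Tn {u : ℝ × ℝ → ℝ} (hu : BM u) (n : ℕ) : BM (P.Tn n u) := by
  induction n with
  | zero => exact P.isBranch_right.bm_trans hu
  | succ n ih => exact P.isBranch_left.bm_trans ih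

lemma bm_acc {f h : ℝ × ℝ → ℝ} (hf : BM f) (hh : BM h) (n : ℕ) : BM (P.acc f h n) := by
  induction n with
  | zero => exact P.isBranch_right.bm_trans (hf.mul hh)
  | succ n ih => exact P.isBranch_left.bm_trans (ih.add (hf.mul (P.bm_Tn hh n)))

lemma diff_eq : X \ Y = Ioc (0 : ℝ) (1 / 2) ×ˢ Ico (0 : ℝ) 1 := by
  ext q
  simp only [X, Y, Set.mem_sdiff, mem_prod, mem_Ioc, mem_Ico]
  constructor
  · rintro ⟨⟨⟨h1, h2⟩, h3⟩, h4⟩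
    refine ⟨⟨h1, ?_⟩, h3⟩
    by_contra hx
    exact h4 ⟨⟨not_le.1 hx, h2⟩, h3⟩
  · rintro ⟨⟨h1, h2⟩, h3⟩
    exact ⟨⟨⟨h1, by linarith⟩, h3⟩, fun h => absurd h.1.1 (not_lt.2 h2)⟩

lemma integral_B_mul {u G : ℝ × ℝ → ℝ} (hu : BM u) (hG : BM G) :
    ∫ q in X, P.B u q * G q = ∫ q in Y, u q * G (P.S q) :=
  P.isBranch_right.integral_trans_mul hu hG

lemma BM.indicator {u : ℝ × ℝ → ℝ} (hu : BM u) {Z : Set (ℝ × ℝ)} (hZ : MeasurableSet Z) :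
    BM (Z.indicator u) := by
  obtain ⟨b, -, hb⟩ := hu.bdd
  exact BM.of_bdd (hu.meas.indicator hZ) fun q hq => by
    by_cases h : q ∈ Z
    · simpa [h] using hb q hq
    · simpa [h] using (abs_nonneg _).trans (hb q hq)

lemma integral_A_mul {u G : ℝ × ℝ → ℝ} (hu : BM u) (hG : BM G) :
    ∫ q in X, P.A u q * G q = ∫ q in X, u q * Yᶜ.indicator (fun q => G (P.S q)) q := by
  rw [A, P.isBranch_left.integral_trans_mul hu hG, ← diff_eq]
  have : ∀ q, u q * Yᶜ.indicator (fun q => G (P.S q)) q =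
      Yᶜ.indicator (fun q => u q * G (P.S q)) q := fun q => by
    by_cases h : q ∈ Yᶜ <;> simp [h]
  simp_rw [this]
  rw [setIntegral_indicator measurableSet_Y.compl, sdiff_eq_compl_inter, inter_comm]

lemma bm_return {G : ℝ × ℝ → ℝ} (hG : BM G) (n : ℕ) :
    BM fun p => if n ≤ P.τ (P.S p) then G (P.S^[n + 1] p) else 0 := by
  have h : ∀ n, BM fun p => G (P.S^[n] p) := fun n => by
    induction n with
    | zero => exact hG
    | succ n ih => exact ih.comp_S P
  exact (h (n + 1)).ite (BM.const 0) ((measurableSet_Ici (a := n)).preimage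
    (P.measurable_τ.comp P.measurable_S))

lemma return_succ (G : ℝ × ℝ → ℝ) (n : ℕ) {p : ℝ × ℝ} (hp : p ∈ X) :
    (if n ≤ P.τ (P.S p) then Yᶜ.indicator (fun q => G (P.S q)) (P.S^[n + 1] p) else 0) =
      if n + 1 ≤ P.τ (P.S p) then G (P.S^[n + 2] p) else 0 := by
  have hp' := P.mapsTo_S hp
  by_cases h : n ≤ P.τ (P.S p)
  · have := P.hitting.iterate_mem_iff hp' h
    rw [if_pos h, Function.iterate_succ_apply]
    by_cases h' : P.τ (P.S p) = n
    · rw [indicator_of_notMem (by simpa using this.2 h'), if_neg (by omega)]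
    · rw [indicator_of_mem (mt this.1 h'), if_pos (by omega), Function.iterate_succ_apply',
        Function.iterate_succ_apply]
  · rw [if_neg h, if_neg (by omega)]

lemma integral_Tn_mul {u : ℝ × ℝ → ℝ} (hu : BM u) (n : ℕ) : ∀ {G : ℝ × ℝ → ℝ}, BM G →
    ∫ q in X, P.Tn n u q * G q =
      ∫ p in Y, u p * if n ≤ P.τ (P.S p) then G (P.S^[n + 1] p) else 0 := by
  induction n with
  | zero =>
    intro G hG
    simpa [Tn] using P.integral_B_mul hu hG
  | succ n ih =>
    intro G hG
    rw [Tn, P.integral_A_mul (P.bm_Tn hu n) hG, ih ((hG.comp_S P).indicator measurableSet_Y.compl)]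
    exact setIntegral_congr_fun measurableSet_Y fun p hp => by
      simp only [P.return_succ G n (Y_subset_X hp)]

lemma bm_bsum {f : ℝ × ℝ → ℝ} (hf : BM f) (n : ℕ) : BM (bsum P.S f n) := by
  induction n with
  | zero => exact (BM.const 0)
  | succ n ih =>
    have : bsum P.S f (n + 1) = fun q => f q + bsum P.S f n (P.S q) := funext fun q => bsum_succ _ _ _
    rw [this]
    exact hf.add (ih.comp_S P)

lemma integral_acc_mul {f h : ℝ × ℝ → ℝ} (hf : BM f) (hh : BM h) (n : ℕ) :
    ∀ {G : ℝ × ℝ → ℝ}, BM G → ∫ q in X, P.acc f h n q * G q =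
      ∫ p in Y, h p * bsum P.S f (n + 1) p *
        if n ≤ P.τ (P.S p) then G (P.S^[n + 1] p) else 0 := by
  induction n with
  | zero =>
    intro G hG
    simpa [acc, bsum, mul_comm] using P.integral_B_mul (hf.mul hh) hG
  | succ n ih =>
    intro G hG
    have hT := P.bm_Tn hh n
    have ha := P.bm_acc hf hh n
    have hG' := (hG.comp_S P).indicator measurableSet_Y.compl
    rw [acc, P.integral_A_mul (ha.add (hf.mul hT)) hG]
    have e1 : ∀ q, (P.acc f h n q + f q * P.Tn n h q) * Yᶜ.indicator (fun q => G (P.S q)) q =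
        P.acc f h n q * Yᶜ.indicator (fun q => G (P.S q)) q +
          P.Tn n h q * (f q * Yᶜ.indicator (fun q => G (P.S q)) q) := fun q => by ring
    simp_rw [e1]
    rw [integral_add ((ha.mul hG').integrableOn measurableSet_X subset_rfl)
      ((hT.mul (hf.mul hG')).integrableOn measurableSet_X subset_rfl), ih hG',
      P.integral_Tn_mul hh n (hf.mul hG'), ← integral_add]
    · refine setIntegral_congr_fun measurableSet_Y fun p hp => ?_
      have h1 := P.return_succ G n (Y_subset_X hp)
      simp only [bsum, Finset.sum_range_succ _ (n + 1)]
      rw [← h1]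
      split_ifs <;> ring
    · exact ((hh.mul (P.bm_bsum hf _)).mul (P.bm_return hG' n)).integrableOn measurableSet_Y
        Y_subset_X
    · exact (hh.mul (P.bm_return (hf.mul hG') n)).integrableOn measurableSet_Y Y_subset_X

lemma return_eq (G : ℝ × ℝ → ℝ) (n : ℕ) {p : ℝ × ℝ} (hp : p ∈ X) :
    (if n ≤ P.τ (P.S p) then Y.indicator G (P.S^[n + 1] p) else 0) =
      if P.τ (P.S p) = n then G (hitMap P.S P.τ (P.S p)) else 0 := by
  have hp' := P.mapsTo_S hp
  by_cases h : n ≤ P.τ (P.S p)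
  · have := P.hitting.iterate_mem_iff hp' h
    rw [if_pos h, Function.iterate_succ_apply]
    by_cases h' : P.τ (P.S p) = n
    · rw [indicator_of_mem (this.2 h'), if_pos h', hitMap, h']
    · rw [indicator_of_notMem (mt this.1 h'), if_neg h']
  · rw [if_neg h, if_neg (by omega)]

lemma setIntegral_Y_eq (u G : ℝ × ℝ → ℝ) :
    ∫ q in Y, u q * G q = ∫ q in X, u q * Y.indicator G q := by
  have : ∀ q, u q * Y.indicator G q = Y.indicator (fun q => u q * G q) q := fun q => by
    by_cases h : q ∈ Y <;> simp [h]
  simp_rw [this]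
  rw [setIntegral_indicator measurableSet_Y, inter_eq_right.2 Y_subset_X]

lemma setIntegral_Tn_mul {u G : ℝ × ℝ → ℝ} (hu : BM u) (hG : BM G) (n : ℕ) :
    ∫ q in Y, P.Tn n u q * G q =
      ∫ p in Y, u p * if P.τ (P.S p) = n then G (hitMap P.S P.τ (P.S p)) else 0 := by
  rw [setIntegral_Y_eq, P.integral_Tn_mul hu n (hG.indicator measurableSet_Y)]
  exact setIntegral_congr_fun measurableSet_Y fun p hp => by
    simp only [P.return_eq G n (Y_subset_X hp)]

lemma setIntegral_acc_mul {f h G : ℝ × ℝ → ℝ} (hf : BM f) (hh : BM h) (hG : BM G) (n : ℕ) :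
    ∫ q in Y, P.acc f h n q * G q =
      ∫ p in Y, h p * bsum P.S f (n + 1) p *
        if P.τ (P.S p) = n then G (hitMap P.S P.τ (P.S p)) else 0 := by
  rw [setIntegral_Y_eq, P.integral_acc_mul hf hh n (hG.indicator measurableSet_Y)]
  exact setIntegral_congr_fun measurableSet_Y fun p hp => by
    simp only [P.return_eq G n (Y_subset_X hp)]

end LSVParams

/-- The cone of nonnegative functions on `Z` whose logarithm has modulus of continuity `κ`. -/
structure InCone {Ω : Type*} (κ : Ω → Ω → ℝ) (Z : Set Ω) (u : Ω → ℝ) : Prop where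
  nonneg : ∀ p ∈ Z, 0 ≤ u p
  le : ∀ p ∈ Z, ∀ q ∈ Z, u p ≤ u q * Real.exp (κ p q)

namespace InCone

variable {Ω : Type*} {κ κ' : Ω → Ω → ℝ} {Z Z' : Set Ω} {u v : Ω → ℝ}

lemma mono (hu : InCone κ Z u) (hZ : Z' ⊆ Z) (h : ∀ p ∈ Z', ∀ q ∈ Z', κ p q ≤ κ' p q) :
    InCone κ' Z' u where
  nonneg p hp := hu.nonneg p (hZ hp)
  le p hp q hq := (hu.le p (hZ hp) q (hZ hq)).trans
    (mul_le_mul_of_nonneg_left (Real.exp_le_exp.2 (h p hp q hq)) (hu.nonneg q (hZ hq)))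

lemma add (hu : InCone κ Z u) (hv : InCone κ Z v) : InCone κ Z fun q => u q + v q where
  nonneg p hp := add_nonneg (hu.nonneg p hp) (hv.nonneg p hp)
  le p hp q hq := by
    rw [add_mul]
    exact add_le_add (hu.le p hp q hq) (hv.le p hp q hq)

lemma mul (hu : InCone κ Z u) (hv : InCone κ' Z v) :
    InCone (fun p q => κ p q + κ' p q) Z fun q => u q * v q where
  nonneg p hp := mul_nonneg (hu.nonneg p hp) (hv.nonneg p hp)
  le p hp q hq := by
    rw [Real.exp_add, mul_mul_mul_comm]
    exact mul_le_mul (hu.le p hp q hq) (hv.le p hp q hq) (hv.nonneg p hp)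
      (mul_nonneg (hu.nonneg q hq) (Real.exp_pos _).le)

lemma const {c : ℝ} (hc : 0 ≤ c) (hκ : ∀ p ∈ Z, ∀ q ∈ Z, 0 ≤ κ p q) :
    InCone κ Z fun _ => c where
  nonneg _ _ := hc
  le p hp q hq := le_mul_of_one_le_right hc (Real.one_le_exp (hκ p hp q hq))

lemma of_tendsto {U : ℕ → Ω → ℝ} (hU : ∀ n, InCone κ Z (U n))
    (h : ∀ p ∈ Z, Tendsto (fun n => U n p) atTop (𝓝 (u p))) : InCone κ Z u where
  nonneg p hp := ge_of_tendsto' (h p hp) fun n => (hU n).nonneg p hp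
  le p hp q hq := le_of_tendsto_of_tendsto' (h p hp) ((h q hq).mul_const _)
    fun n => (hU n).le p hp q hq

lemma sum {U : ℕ → Ω → ℝ} (hU : ∀ n, InCone κ Z (U n)) (hκ : ∀ p ∈ Z, ∀ q ∈ Z, 0 ≤ κ p q)
    (N : ℕ) : InCone κ Z fun q => ∑ n ∈ Finset.range N, U n q := by
  induction N with
  | zero => simpa using const le_rfl hκ
  | succ N ih =>
    simp_rw [Finset.sum_range_succ]
    exact ih.add (hU N)

end InCone

namespace LSVParams

variable (P : LSVParams)

/-- The modulus of log-Hölder continuity on the base. -/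
def κY (b : ℝ) (p q : ℝ × ℝ) : ℝ := b * dist p q ^ P.t

/-- The modulus of log-continuity on the phase space. -/
def κX (b : ℝ) (p q : ℝ × ℝ) : ℝ := 2 * |Real.log p.1 - Real.log q.1| + b * dist p q ^ P.t

lemma κY_nonneg {b : ℝ} (hb : 0 ≤ b) (p q : ℝ × ℝ) : 0 ≤ P.κY b p q :=
  mul_nonneg hb (Real.rpow_nonneg dist_nonneg _)

/-- The contraction rate of the right branches and of the noise. -/
def θ₀ : ℝ := max (1 / 2) (max P.p (1 - P.p))

/-- The contraction rate of the Hölder modulus. -/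
def θ : ℝ := P.θ₀ ^ P.t

lemma θ₀_pos : 0 < P.θ₀ := lt_max_of_lt_left (by norm_num)

lemma θ_pos : 0 < P.θ := Real.rpow_pos_of_pos P.θ₀_pos _

lemma θ_lt_one : P.θ < 1 := by
  have h1 := P.p_pos
  have h2 := P.p_lt
  exact Real.rpow_lt_one P.θ₀_pos.le
    (max_lt (by norm_num) (max_lt P.p_lt (by linarith))) P.t_pos

lemma w_le_θ₀ (i : Bool) : P.w i ≤ P.θ₀ := by
  cases i
  · exact (le_max_right _ _).trans (le_max_right _ _)
  · exact (le_max_left _ _).trans (le_max_right _ _)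

lemma abs_ψ_sub (i : Bool) (ω ω' : ℝ) : |P.ψ i ω - P.ψ i ω'| = P.w i * |ω - ω'| := by
  rw [ψ, ψ, add_sub_add_right_eq_sub, ← mul_sub, abs_mul, abs_of_pos (P.w_pos i)]

lemma dist_left (i : Bool) (p q : ℝ × ℝ) : dist (P.σ P.gl i p) (P.σ P.gl i q) ≤ dist p q := by
  rw [Prod.dist_eq, Prod.dist_eq]
  refine max_le_max (abs_linv_sub_le (P.e_pos i) _ _) ?_
  change |P.ψ i p.2 - P.ψ i q.2| ≤ |p.2 - q.2|
  rw [abs_ψ_sub]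
  exact mul_le_of_le_one_left (abs_nonneg _) (P.w_lt_one i).le

lemma dist_right (i : Bool) (p q : ℝ × ℝ) :
    dist (P.σ gr i p) (P.σ gr i q) ≤ P.θ₀ * dist p q := by
  rw [Prod.dist_eq, Prod.dist_eq, mul_comm, max_mul_of_nonneg _ _ P.θ₀_pos.le]
  refine max_le_max ?_ ?_
  · change |(p.1 + 1) / 2 - (q.1 + 1) / 2| ≤ |p.1 - q.1| * P.θ₀
    rw [← sub_div, add_sub_add_right_eq_sub, abs_div, abs_two, div_eq_mul_one_div]
    gcongr
    exact le_max_left _ _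
  · change |P.ψ i p.2 - P.ψ i q.2| ≤ |p.2 - q.2| * P.θ₀
    rw [abs_ψ_sub, mul_comm]
    gcongr
    exact P.w_le_θ₀ i

lemma IsBranch.inCone {P : LSVParams} {J : Set ℝ} {g j : Bool → ℝ → ℝ} (h : P.IsBranch J g j)
    {κ κ' : ℝ × ℝ → ℝ × ℝ → ℝ} {u : ℝ × ℝ → ℝ} {Z : Set (ℝ × ℝ)} (hu : InCone κ Z u)
    (hZ : ∀ i, ∀ q ∈ X, P.σ g i q ∈ Z)
    (hκ : ∀ i, ∀ p ∈ X, ∀ q ∈ X,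
      j i p.1 ≤ j i q.1 * Real.exp (κ' p q - κ (P.σ g i p) (P.σ g i q))) :
    InCone κ' X (P.trans g j u) where
  nonneg p hp := Finset.sum_nonneg fun i _ => mul_nonneg
    (mul_nonneg (P.w_pos i).le (h.pos i _ hp.1).le) (hu.nonneg _ (hZ i p hp))
  le p hp q hq := by
    rw [trans, trans, Finset.sum_mul]
    refine Finset.sum_le_sum fun i _ => ?_
    have h1 := hκ i p hp q hq
    have h2 := hu.le _ (hZ i p hp) _ (hZ i q hq)
    have h3 := hu.nonneg _ (hZ i p hp)
    have hw := (P.w_pos i).le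
    have hj := (h.pos i _ hq.1).le
    calc P.w i * j i p.1 * u (P.σ g i p) ≤ P.w i *
          (j i q.1 * Real.exp (κ' p q - κ (P.σ g i p) (P.σ g i q))) *
          (u (P.σ g i q) * Real.exp (κ (P.σ g i p) (P.σ g i q))) := by gcongr
      _ = _ := by
          rw [Real.exp_sub]
          field_simp

lemma inCone_A {b : ℝ} (hb : 0 ≤ b) {u : ℝ × ℝ → ℝ} (hu : InCone (P.κX b) X u) :
    InCone (P.κX b) X (P.A u) := by
  refine P.isBranch_left.inCone hu (fun i q hq => P.isBranch_left.mapsTo_X i hq)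
    fun i p hp q hq => ?_
  have h1 := jac_le_mul_exp (P.e_pos i) (P.e_le_one i) hp.1.1 hq.1.1
  refine h1.trans (mul_le_mul_of_nonneg_left (Real.exp_le_exp.2 ?_)
    (P.isBranch_left.pos i _ hq.1).le)
  have h2 : b * dist (P.σ P.gl i p) (P.σ P.gl i q) ^ P.t ≤ b * dist p q ^ P.t := by
    have h := P.t_pos.le
    gcongr
    exact P.dist_left i p q
  simp only [κX]
  change _ ≤ 2 * |Real.log p.1 - Real.log q.1| + b * dist p q ^ P.t -
    (2 * |Real.log (linv (P.e i) p.1) - Real.log (linv (P.e i) q.1)| +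
      b * dist (P.σ P.gl i p) (P.σ P.gl i q) ^ P.t)
  linarith

lemma inCone_B {b : ℝ} (hb : 0 ≤ b) {u : ℝ × ℝ → ℝ} (hu : InCone (P.κY b) Y u) :
    InCone (P.κX (P.θ * b)) X (P.B u) := by
  refine P.isBranch_right.inCone hu (fun i q hq => P.isBranch_right.mapsTo i hq)
    fun i p hp q hq => ?_
  refine le_mul_of_one_le_right (by norm_num [jr]) (Real.one_le_exp ?_)
  have h2 : b * dist (P.σ gr i p) (P.σ gr i q) ^ P.t ≤ P.θ * b * dist p q ^ P.t := by
    have h := P.t_pos.le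
    calc b * dist (P.σ gr i p) (P.σ gr i q) ^ P.t ≤ b * (P.θ₀ * dist p q) ^ P.t := by
          gcongr
          exact P.dist_right i p q
      _ = _ := by
          rw [Real.mul_rpow P.θ₀_pos.le dist_nonneg, θ]
          ring
  simp only [κX, κY]
  have : 0 ≤ 2 * |Real.log p.1 - Real.log q.1| := by positivity
  linarith

lemma inCone_Tn {b : ℝ} (hb : 0 ≤ b) {u : ℝ × ℝ → ℝ} (hu : InCone (P.κY b) Y u) (n : ℕ) :
    InCone (P.κX (P.θ * b)) X (P.Tn n u) := by
  induction n with
  | zero => exact P.inCone_B hb hu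
  | succ n ih => exact P.inCone_A (mul_nonneg P.θ_pos.le hb) ih

lemma dist_le_one {p q : ℝ × ℝ} (hp : p ∈ X) (hq : q ∈ X) : dist p q ≤ 1 := by
  rw [Prod.dist_eq]
  refine max_le ?_ ?_ <;> rw [Real.dist_eq, abs_le] <;>
    constructor <;> linarith [hp.1.1, hp.1.2, hq.1.1, hq.1.2, hp.2.1, hp.2.2, hq.2.1, hq.2.2]

lemma dist_rpow_le_one {p q : ℝ × ℝ} (hp : p ∈ X) (hq : q ∈ X) : dist p q ^ P.t ≤ 1 :=
  Real.rpow_le_one dist_nonneg (dist_le_one hp hq) P.t_pos.le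

lemma abs_log_sub_le {x z : ℝ} (hx : 1 / 2 < x) (hz : 1 / 2 < z) :
    |Real.log x - Real.log z| ≤ 2 * |x - z| := by
  have key : ∀ {x z : ℝ}, 1 / 2 < x → 1 / 2 < z → Real.log x - Real.log z ≤ 2 * |x - z| :=
    fun {x z} hx hz => by
      rw [← Real.log_div (by linarith) (by linarith)]
      have h1 := Real.log_le_sub_one_of_pos (show 0 < x / z by apply div_pos <;> linarith)
      have h2 : x / z - 1 = (x - z) / z := by field_simp
      have h3 : (x - z) / z ≤ |x - z| / (1 / 2) := by
        gcongr
        exact le_abs_self _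
      rw [h2] at h1
      linarith
  rw [abs_sub_le_iff]
  exact ⟨key hx hz, by rw [abs_sub_comm]; exact key hz hx⟩

lemma inCone_restrict {b : ℝ} {u : ℝ × ℝ → ℝ} (hu : InCone (P.κX b) X u) :
    InCone (P.κY (b + 4)) Y u := by
  refine hu.mono Y_subset_X fun p hp q hq => ?_
  have h1 := abs_log_sub_le hp.1.1 hq.1.1
  have h2 : |p.1 - q.1| ≤ dist p q := by rw [Prod.dist_eq]; exact le_max_left _ _
  have h3 : dist p q ≤ dist p q ^ P.t := by
    rcases eq_or_lt_of_le (dist_nonneg (x := p) (y := q)) with h0 | h0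
    · rw [← h0, Real.zero_rpow P.t_pos.ne']
    · have := Real.rpow_le_rpow_of_exponent_ge h0
        (dist_le_one (Y_subset_X hp) (Y_subset_X hq)) P.t_le
      rwa [Real.rpow_one] at this
  simp only [κX, κY]
  linarith

end LSVParams

namespace LSVParams

variable (P : LSVParams)

lemma trans_add (g j : Bool → ℝ → ℝ) (u v : ℝ × ℝ → ℝ) (q : ℝ × ℝ) :
    P.trans g j (fun q => u q + v q) q = P.trans g j u q + P.trans g j v q := by
  simp only [trans, mul_add, Finset.sum_add_distrib]

lemma trans_const_mul (g j : Bool → ℝ → ℝ) (c : ℝ) (u : ℝ × ℝ → ℝ) (q : ℝ × ℝ) :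
    P.trans g j (fun q => c * u q) q = c * P.trans g j u q := by
  simp only [trans, Finset.mul_sum]
  exact Finset.sum_congr rfl fun i _ => by ring

lemma Tn_add (n : ℕ) (u v : ℝ × ℝ → ℝ) :
    P.Tn n (fun q => u q + v q) = fun q => P.Tn n u q + P.Tn n v q := by
  induction n with
  | zero => exact funext fun q => P.trans_add _ _ u v q
  | succ n ih => rw [Tn, ih]; exact funext fun q => P.trans_add _ _ _ _ q

lemma Tn_const_mul (n : ℕ) (c : ℝ) (u : ℝ × ℝ → ℝ) :
    P.Tn n (fun q => c * u q) = fun q => c * P.Tn n u q := by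
  induction n with
  | zero => exact funext fun q => P.trans_const_mul _ _ c u q
  | succ n ih => rw [Tn, ih]; exact funext fun q => P.trans_const_mul _ _ _ _ q

lemma acc_add (n : ℕ) (f f' h : ℝ × ℝ → ℝ) :
    P.acc (fun q => f q + f' q) h n = fun q => P.acc f h n q + P.acc f' h n q := by
  induction n with
  | zero =>
    simp only [acc, add_mul]
    exact funext fun q => P.trans_add _ _ _ _ q
  | succ n ih =>
    have : (fun q => P.acc (fun q => f q + f' q) h n q + (f q + f' q) * P.Tn n h q) =
        fun q => (P.acc f h n q + f q * P.Tn n h q) + (P.acc f' h n q + f' q * P.Tn n h q) := by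
      rw [ih]
      exact funext fun q => by ring
    rw [acc, this]
    exact funext fun q => P.trans_add _ _ _ _ q

lemma abs_A_le {c : ℝ} {u : ℝ × ℝ → ℝ} {n : ℕ} (hu : ∀ q ∈ X, |u q| ≤ c * P.tail n q.1)
    {q : ℝ × ℝ} (hq : q ∈ X) : |P.A u q| ≤ c * P.tail (n + 1) q.1 := by
  rw [A, trans, tail, Finset.mul_sum]
  refine (Finset.abs_sum_le_sum_abs _ _).trans (Finset.sum_le_sum fun i _ => ?_)
  have h1 := hu _ (P.isBranch_left.mapsTo_X i hq)
  have h2 : 0 ≤ P.w i * jac (P.e i) q.1 :=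
    mul_nonneg (P.w_pos i).le (jac_pos (P.e_pos i) hq.1.1.le).le
  calc |P.w i * P.jl i q.1 * u (P.σ P.gl i q)|
      = P.w i * jac (P.e i) q.1 * |u (P.σ P.gl i q)| := by
        rw [abs_mul, jl, abs_of_nonneg h2]
    _ ≤ P.w i * jac (P.e i) q.1 * (c * P.tail n (linv (P.e i) q.1)) :=
        mul_le_mul_of_nonneg_left h1 h2
    _ = _ := by ring

lemma abs_B_le {c : ℝ} {u : ℝ × ℝ → ℝ} (hu : ∀ q ∈ Y, |u q| ≤ c)
    {q : ℝ × ℝ} (hq : q ∈ X) : |P.B u q| ≤ c * P.tail 0 q.1 := by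
  calc |P.B u q| ≤ ∑ i, P.w i * (1 / 2 * c) := by
        rw [B, trans]
        refine (Finset.abs_sum_le_sum_abs _ _).trans (Finset.sum_le_sum fun i _ => ?_)
        have h1 : |u (P.σ gr i q)| ≤ c := hu _ (P.isBranch_right.mapsTo i hq)
        rw [abs_mul, jr, abs_of_nonneg (mul_nonneg (P.w_pos i).le (by norm_num)), mul_assoc]
        have := (P.w_pos i).le
        gcongr
    _ = c * P.tail 0 q.1 := by rw [← Finset.sum_mul, P.sum_w, tail]; ring

lemma abs_Tn_le {c : ℝ} {u : ℝ × ℝ → ℝ} (hu : ∀ q ∈ Y, |u q| ≤ c) (n : ℕ) :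
    ∀ q ∈ X, |P.Tn n u q| ≤ c * P.tail n q.1 := by
  induction n with
  | zero => exact fun q hq => P.abs_B_le hu hq
  | succ n ih => exact fun q hq => P.abs_A_le ih hq

lemma abs_acc_le {c d : ℝ} {f h : ℝ × ℝ → ℝ} (hc : 0 ≤ c) (hf : ∀ q ∈ X, |f q| ≤ c)
    (hh : ∀ q ∈ Y, |h q| ≤ d) (n : ℕ) :
    ∀ q ∈ X, |P.acc f h n q| ≤ ((n : ℝ) + 1) * (c * d) * P.tail n q.1 := by
  induction n with
  | zero =>
    intro q hq
    simp only [Nat.cast_zero, zero_add, one_mul]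
    refine P.abs_B_le (fun q hq => ?_) hq
    rw [abs_mul]
    exact mul_le_mul (hf q (Y_subset_X hq)) (hh q hq) (abs_nonneg _) hc
  | succ n ih =>
    intro q hq
    refine P.abs_A_le (fun q hq => ?_) hq
    push_cast
    calc |P.acc f h n q + f q * P.Tn n h q|
        ≤ |P.acc f h n q| + |f q| * |P.Tn n h q| := by rw [← abs_mul]; exact abs_add_le _ _
      _ ≤ ((n : ℝ) + 1) * (c * d) * P.tail n q.1 + c * (d * P.tail n q.1) :=
          add_le_add (ih q hq) (mul_le_mul (hf q hq) (P.abs_Tn_le hh n q hq) (abs_nonneg _) hc)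
      _ = _ := by ring

lemma abs_Tn_le_tb {c : ℝ} (hc : 0 ≤ c) {u : ℝ × ℝ → ℝ} (hu : ∀ q ∈ Y, |u q| ≤ c) (n : ℕ)
    {q : ℝ × ℝ} (hq : q ∈ Y) : |P.Tn n u q| ≤ c * P.tb n :=
  (P.abs_Tn_le hu n q (Y_subset_X hq)).trans
    (mul_le_mul_of_nonneg_left (P.tail_le_tb n hq.1) hc)

lemma abs_acc_le_tb {c d : ℝ} {f h : ℝ × ℝ → ℝ} (hc : 0 ≤ c) (hd : 0 ≤ d)
    (hf : ∀ q ∈ X, |f q| ≤ c) (hh : ∀ q ∈ Y, |h q| ≤ d) (n : ℕ) {q : ℝ × ℝ} (hq : q ∈ Y) :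
    |P.acc f h n q| ≤ c * d * (((n : ℝ) + 1) * P.tb n) := by
  refine (P.abs_acc_le hc hf hh n q (Y_subset_X hq)).trans ?_
  rw [mul_comm ((n : ℝ) + 1), mul_assoc]
  gcongr
  exact P.tail_le_tb n hq.1

lemma summable_mul_tb : Summable fun n : ℕ => ((n : ℝ) + 1) * P.tb n := by
  refine P.summable_sq_mul_tb.of_nonneg_of_le
    (fun n => mul_nonneg (by positivity) (P.tb_nonneg n)) fun n => ?_
  have : (1 : ℝ) ≤ n + 1 := by linarith [n.cast_nonneg (α := ℝ)]
  have h := P.tb_nonneg n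
  gcongr
  nlinarith

lemma summable_tb : Summable P.tb := by
  refine P.summable_mul_tb.of_nonneg_of_le P.tb_nonneg fun n => ?_
  have : (1 : ℝ) ≤ n + 1 := by linarith [n.cast_nonneg (α := ℝ)]
  exact le_mul_of_one_le_left (P.tb_nonneg n) this

/-- The pointwise sum of a sequence of functions on the base. -/
def ySum (U : ℕ → ℝ × ℝ → ℝ) : ℝ × ℝ → ℝ := Y.indicator fun q => ∑' n, U n q

variable {P} in
lemma measurable_ySum {U : ℕ → ℝ × ℝ → ℝ} (hU : ∀ n, Measurable (U n)) {y : ℕ → ℝ}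
    (hy : Summable y) (h : ∀ n, ∀ q ∈ Y, |U n q| ≤ y n) : Measurable (ySum U) := by
  refine measurable_of_tendsto_metrizable
    (f := fun N : ℕ => Y.indicator fun q => ∑ n ∈ Finset.range N, U n q)
    (fun N => (Finset.measurable_fun_sum _ fun n _ => hU n).indicator measurableSet_Y) ?_
  rw [tendsto_pi_nhds]
  intro q
  by_cases hq : q ∈ Y
  · simp only [ySum, indicator_of_mem hq]
    exact (Summable.of_norm_bounded hy fun n => h n q hq).hasSum.tendsto_sum_nat
  · simp only [ySum, indicator_of_notMem hq]
    exact tendsto_const_nhds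

lemma hasSum_ySum {U : ℕ → ℝ × ℝ → ℝ} {y : ℕ → ℝ} (hy : Summable y)
    (h : ∀ n, ∀ q ∈ Y, |U n q| ≤ y n) {q : ℝ × ℝ} (hq : q ∈ Y) :
    HasSum (fun n => U n q) (ySum U q) := by
  rw [ySum, indicator_of_mem hq]
  exact (Summable.of_norm_bounded hy fun n => h n q hq).hasSum

lemma abs_ySum_le {U : ℕ → ℝ × ℝ → ℝ} {y : ℕ → ℝ} (hy : Summable y)
    (h : ∀ n, ∀ q ∈ Y, |U n q| ≤ y n) {q : ℝ × ℝ} (hq : q ∈ Y) : |ySum U q| ≤ ∑' n, y n := by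
  rw [ySum, indicator_of_mem hq]
  exact tsum_of_norm_bounded (f := fun n => U n q) hy.hasSum fun n => h n q hq

lemma bm_ySum {U : ℕ → ℝ × ℝ → ℝ} (hU : ∀ n, Measurable (U n)) {y : ℕ → ℝ} (hy : Summable y)
    (h : ∀ n, ∀ q ∈ Y, |U n q| ≤ y n) : BM (ySum U) := by
  refine BM.of_bdd (measurable_ySum hU hy h) (b := |∑' n, y n|) fun q _ => ?_
  by_cases hq : q ∈ Y
  · exact (abs_ySum_le hy h hq).trans (le_abs_self _)
  · simp [ySum, indicator_of_notMem hq]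

lemma inCone_ySum {U : ℕ → ℝ × ℝ → ℝ} {y : ℕ → ℝ} (hy : Summable y)
    (h : ∀ n, ∀ q ∈ Y, |U n q| ≤ y n) {b : ℝ} (hb : 0 ≤ b)
    (hc : ∀ n, InCone (P.κX b) X (U n)) : InCone (P.κY (b + 4)) Y (ySum U) :=
  InCone.of_tendsto (InCone.sum (fun n => P.inCone_restrict (hc n)) fun p _ q _ =>
    P.κY_nonneg (by linarith) p q) fun _ hp => (hasSum_ySum hy h hp).tendsto_sum_nat

/-- The transfer operator of the first return map to the base. -/
def L (u : ℝ × ℝ → ℝ) : ℝ × ℝ → ℝ := ySum fun n => P.Tn n u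

variable {P}

lemma BM.exists_bound {u : ℝ × ℝ → ℝ} (hu : BM u) : ∃ b, 0 ≤ b ∧ ∀ q ∈ Y, |u q| ≤ b := by
  obtain ⟨b, h0, hb⟩ := hu.bdd
  exact ⟨b, h0, fun q hq => hb q (Y_subset_X hq)⟩

lemma BM.hasSum_L {u : ℝ × ℝ → ℝ} (hu : BM u) {q : ℝ × ℝ} (hq : q ∈ Y) :
    HasSum (fun n => P.Tn n u q) (P.L u q) := by
  obtain ⟨b, h0, hb⟩ := hu.exists_bound
  exact hasSum_ySum (P.summable_tb.mul_left b) (fun n q hq => P.abs_Tn_le_tb h0 hb n hq) hq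

lemma BM.L {u : ℝ × ℝ → ℝ} (hu : BM u) : BM (P.L u) := by
  obtain ⟨b, h0, hb⟩ := hu.exists_bound
  exact bm_ySum (fun n => (P.bm_Tn hu n).meas) (P.summable_tb.mul_left b)
    fun n q hq => P.abs_Tn_le_tb h0 hb n hq

lemma BM.abs_L_le {u : ℝ × ℝ → ℝ} {b : ℝ} (h0 : 0 ≤ b) (hb : ∀ q ∈ Y, |u q| ≤ b)
    {q : ℝ × ℝ} (hq : q ∈ Y) : |P.L u q| ≤ b * ∑' n, P.tb n := by
  rw [← tsum_mul_left]
  exact abs_ySum_le (P.summable_tb.mul_left b) (fun n q hq => P.abs_Tn_le_tb h0 hb n hq) hq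

lemma BM.L_add {u v : ℝ × ℝ → ℝ} (hu : BM u) (hv : BM v) {q : ℝ × ℝ} (hq : q ∈ Y) :
    P.L (fun q => u q + v q) q = P.L u q + P.L v q := by
  refine (hu.add hv).hasSum_L hq |>.unique ?_
  simp_rw [P.Tn_add]
  exact (hu.hasSum_L hq).add (hv.hasSum_L hq)

lemma BM.L_const_mul {u : ℝ × ℝ → ℝ} (hu : BM u) (c : ℝ) {q : ℝ × ℝ} (hq : q ∈ Y) :
    P.L (fun q => c * u q) q = c * P.L u q := by
  refine ((BM.const c).mul hu).hasSum_L hq |>.unique ?_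
  simp_rw [P.Tn_const_mul]
  exact (hu.hasSum_L hq).mul_left c

lemma inCone_L {u : ℝ × ℝ → ℝ} (hu : BM u) {b : ℝ} (hb : 0 ≤ b) (hc : InCone (P.κY b) Y u) :
    InCone (P.κY (P.θ * b + 4)) Y (P.L u) := by
  obtain ⟨c, h0, hcc⟩ := hu.exists_bound
  exact P.inCone_ySum (P.summable_tb.mul_left c) (fun n q hq => P.abs_Tn_le_tb h0 hcc n hq)
    (mul_nonneg P.θ_pos.le hb) fun n => P.inCone_Tn hb hc n

/-- The first return map to the base. -/
def F (P : LSVParams) (p : ℝ × ℝ) : ℝ × ℝ := hitMap P.S P.τ (P.S p)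

lemma measurable_F : Measurable P.F := P.hitting.measurable_hitMap.comp P.measurable_S

lemma F_mem {p : ℝ × ℝ} (hp : p ∈ X) : P.F p ∈ Y := P.hitting.hitMap_mem _ (P.mapsTo_S hp)

lemma BM.comp_F {G : ℝ × ℝ → ℝ} (hG : BM G) : BM fun p => G (P.F p) := by
  obtain ⟨b, -, hb⟩ := hG.bdd
  exact BM.of_bdd (hG.meas.comp measurable_F) fun q hq => hb _ (Y_subset_X (F_mem hq))

lemma measurableSet_τ_eq (n : ℕ) : MeasurableSet {p | P.τ (P.S p) = n} :=
  (measurableSet_singleton n).preimage (P.measurable_τ.comp P.measurable_S)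

lemma measurableSet_τ_lt (n : ℕ) : MeasurableSet {p | P.τ (P.S p) < n} :=
  (measurableSet_Iio (a := n)).preimage (P.measurable_τ.comp P.measurable_S)

lemma sum_setIntegral_Tn_mul {u G : ℝ × ℝ → ℝ} (hu : BM u) (hG : BM G) (a : ℕ → ℝ) (N : ℕ) :
    ∑ n ∈ Finset.range N, a n * ∫ q in Y, P.Tn n u q * G q =
      ∫ p in Y, if P.τ (P.S p) < N then a (P.τ (P.S p)) * (u p * G (P.F p)) else 0 := by
  simp_rw [P.setIntegral_Tn_mul hu hG, ← integral_const_mul]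
  rw [← integral_finsetSum]
  · refine setIntegral_congr_fun measurableSet_Y fun p _ => ?_
    simp only [mul_ite, mul_zero, Finset.sum_ite_eq, Finset.mem_range]
    rfl
  · exact fun n _ => ((BM.const _).mul (hu.mul ((hG.comp_F.ite (BM.const 0)
      (measurableSet_τ_eq n))))).integrableOn measurableSet_Y Y_subset_X

lemma setIntegral_L_mul {u G : ℝ × ℝ → ℝ} (hu : BM u) (hG : BM G) :
    ∫ q in Y, P.L u q * G q = ∫ p in Y, u p * G (P.F p) := by
  obtain ⟨b, h0, hb⟩ := hu.exists_bound
  obtain ⟨c, hc0, hc⟩ := hG.exists_bound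
  have h1 : HasSum (fun n => ∫ q in Y, P.Tn n u q * G q) (∫ q in Y, P.L u q * G q) := by
    refine hasSum_integral_of_dominated_convergence (fun n _ => b * P.tb n * c) (fun n =>
      ((P.bm_Tn hu n).mul hG).meas.aestronglyMeasurable) (fun n => ?_) ?_ ?_ ?_
    · refine ae_restrict_of_forall_mem measurableSet_Y fun q hq => ?_
      rw [Real.norm_eq_abs, abs_mul]
      exact mul_le_mul (P.abs_Tn_le_tb h0 hb n hq) (hc q hq) (abs_nonneg _)
        (mul_nonneg h0 (P.tb_nonneg n))
    · exact Eventually.of_forall fun _ => (P.summable_tb.mul_left b).mul_right c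
    · exact (BM.const _).integrableOn measurableSet_Y Y_subset_X
    · exact ae_restrict_of_forall_mem measurableSet_Y fun q hq => (hu.hasSum_L hq).mul_right _
  have h2 : Tendsto (fun N : ℕ => ∫ p in Y, if P.τ (P.S p) < N then 1 * (u p * G (P.F p)) else 0)
      atTop (𝓝 (∫ p in Y, u p * G (P.F p))) := by
    refine tendsto_integral_of_dominated_convergence (fun p => |u p * G (P.F p)|) (fun N => ?_)
      ((hu.mul hG.comp_F).integrableOn measurableSet_Y Y_subset_X).abs (fun N => ?_) ?_
    · exact (((BM.const 1).mul (hu.mul hG.comp_F)).ite (BM.const 0)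
        (measurableSet_τ_lt N)).meas.aestronglyMeasurable
    · refine Eventually.of_forall fun p => ?_
      split_ifs <;> simp [mul_nonneg]
    · refine Eventually.of_forall fun p => tendsto_const_nhds.congr' ?_
      filter_upwards [eventually_gt_atTop (P.τ (P.S p))] with N hN
      rw [if_pos hN, one_mul]
  refine tendsto_nhds_unique h1.tendsto_sum_nat (h2.congr fun N => ?_)
  rw [← sum_setIntegral_Tn_mul hu hG (fun _ => 1) N]
  simp

end LSVParams

namespace LSVParams

variable {P : LSVParams}

lemma L_of_notMem {u : ℝ × ℝ → ℝ} {q : ℝ × ℝ} (hq : q ∉ Y) : P.L u q = 0 := by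
  rw [L, ySum, indicator_of_notMem hq]

lemma BM.L_add_eq {u v : ℝ × ℝ → ℝ} (hu : BM u) (hv : BM v) :
    P.L (fun q => u q + v q) = fun q => P.L u q + P.L v q := by
  funext q
  by_cases hq : q ∈ Y
  · exact hu.L_add hv hq
  · simp [L_of_notMem hq]

lemma BM.L_const_mul_eq {u : ℝ × ℝ → ℝ} (hu : BM u) (c : ℝ) :
    P.L (fun q => c * u q) = fun q => c * P.L u q := by
  funext q
  by_cases hq : q ∈ Y
  · exact hu.L_const_mul c hq
  · simp [L_of_notMem hq]

lemma BM.iterate_L {u : ℝ × ℝ → ℝ} (hu : BM u) (n : ℕ) : BM (P.L^[n] u) := by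
  induction n generalizing u with
  | zero => exact hu
  | succ n ih => exact ih hu.L

lemma BM.iterate_L_add {u v : ℝ × ℝ → ℝ} (hu : BM u) (hv : BM v) (n : ℕ) :
    P.L^[n] (fun q => u q + v q) = fun q => P.L^[n] u q + P.L^[n] v q := by
  induction n generalizing u v with
  | zero => rfl
  | succ n ih =>
    simp only [Function.iterate_succ_apply]
    rw [hu.L_add_eq hv, ih hu.L hv.L]

lemma BM.iterate_L_const_mul {u : ℝ × ℝ → ℝ} (hu : BM u) (c : ℝ) (n : ℕ) :
    P.L^[n] (fun q => c * u q) = fun q => c * P.L^[n] u q := by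
  induction n generalizing u with
  | zero => rfl
  | succ n ih =>
    simp only [Function.iterate_succ_apply]
    rw [hu.L_const_mul_eq c, ih hu.L]

lemma BM.setIntegral_L {u : ℝ × ℝ → ℝ} (hu : BM u) : ∫ q in Y, P.L u q = ∫ q in Y, u q := by
  simpa using setIntegral_L_mul (P := P) hu (BM.const 1)

lemma BM.setIntegral_iterate_L {u : ℝ × ℝ → ℝ} (hu : BM u) (n : ℕ) :
    ∫ q in Y, P.L^[n] u q = ∫ q in Y, u q := by
  induction n generalizing u with
  | zero => rfl
  | succ n ih => rw [Function.iterate_succ_apply, ih hu.L, hu.setIntegral_L]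

lemma BM.setIntegral_iterate_L_mul {u G : ℝ × ℝ → ℝ} (hu : BM u) (hG : BM G) (n : ℕ) :
    ∫ q in Y, P.L^[n] u q * G q = ∫ q in Y, u q * G (P.F^[n] q) := by
  induction n generalizing G with
  | zero => rfl
  | succ n ih =>
    simp only [Function.iterate_succ_apply']
    rw [setIntegral_L_mul (hu.iterate_L n) hG, ih hG.comp_F]

lemma tendsto_L {U : ℕ → ℝ × ℝ → ℝ} {u : ℝ × ℝ → ℝ} (hU : ∀ n, BM (U n)) (hu : BM u) {y : ℕ → ℝ}
    (hy : Tendsto y atTop (𝓝 0)) (h : ∀ n, ∀ q ∈ Y, |U n q - u q| ≤ y n) {q : ℝ × ℝ}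
    (hq : q ∈ Y) : Tendsto (fun n => P.L (U n) q) atTop (𝓝 (P.L u q)) := by
  rw [tendsto_iff_norm_sub_tendsto_zero]
  refine squeeze_zero (fun _ => norm_nonneg _) (fun n => ?_)
    (by simpa using hy.mul_const (∑' n, P.tb n))
  have h1 : P.L (U n) q - P.L u q = P.L (fun q => U n q + -1 * u q) q := by
    rw [(hU n).L_add ((BM.const _).mul hu) hq, hu.L_const_mul _ hq]
    ring
  rw [h1]
  refine BM.abs_L_le ((abs_nonneg _).trans (h n q hq)) (fun q hq => ?_) hq
  simpa [sub_eq_add_neg] using h n q hq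

section Cone

variable (P) in
/-- The regularity exponent of the invariant cone. -/
def rg : ℝ := 5 / (1 - P.θ)

lemma θ_mul_rg : P.θ * P.rg + 5 = P.rg := by
  have := P.θ_lt_one
  have : 1 - P.θ ≠ 0 := by linarith
  rw [rg]
  field_simp
  ring

lemma one_le_rg : 1 ≤ P.rg := by
  have h1 := P.θ_lt_one
  have h2 := P.θ_pos
  rw [rg, le_div_iff₀ (by linarith)]
  linarith

lemma rg_nonneg : 0 ≤ P.rg := zero_le_one.trans one_le_rg

variable (P) in
/-- Bounded measurable functions in the invariant cone. -/
structure Dn (u : ℝ × ℝ → ℝ) : Prop where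
  bm : BM u
  cone : InCone (P.κY P.rg) Y u

lemma κY_mono {b b' : ℝ} (h : b ≤ b') (p q : ℝ × ℝ) : P.κY b p q ≤ P.κY b' p q :=
  mul_le_mul_of_nonneg_right h (Real.rpow_nonneg dist_nonneg _)

lemma κY_le {b : ℝ} (hb : 0 ≤ b) {p q : ℝ × ℝ} (hp : p ∈ Y) (hq : q ∈ Y) : P.κY b p q ≤ b :=
  mul_le_of_le_one_right hb (P.dist_rpow_le_one (Y_subset_X hp) (Y_subset_X hq))

lemma inCone_κY_mono {b b' : ℝ} (h : b ≤ b') {u : ℝ × ℝ → ℝ} (hu : InCone (P.κY b) Y u) :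
    InCone (P.κY b') Y u := hu.mono subset_rfl fun p _ q _ => κY_mono h p q

lemma setIntegral_Y_const (c : ℝ) : ∫ _ in Y, c = c / 2 := by
  rw [setIntegral_const, measureReal_def, volume_Y, ENNReal.toReal_ofReal (by norm_num),
    smul_eq_mul]
  ring

lemma BM.integrableOn_Y {u : ℝ × ℝ → ℝ} (hu : BM u) : IntegrableOn u Y :=
  hu.integrableOn measurableSet_Y Y_subset_X

namespace Dn

variable {u v : ℝ × ℝ → ℝ}

lemma L_cone (hu : P.Dn u) : InCone (P.κY (P.rg - 1)) Y (P.L u) := by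
  have h := inCone_L hu.bm rg_nonneg hu.cone
  rwa [show P.θ * P.rg + 4 = P.rg - 1 by linarith [θ_mul_rg (P := P)]] at h

lemma L (hu : P.Dn u) : P.Dn (P.L u) :=
  ⟨hu.bm.L, inCone_κY_mono (by linarith) hu.L_cone⟩

lemma iterate_L (hu : P.Dn u) (n : ℕ) : P.Dn (P.L^[n] u) := by
  induction n generalizing u with
  | zero => exact hu
  | succ n ih => exact ih hu.L

lemma le_mul_exp (hu : P.Dn u) {p q : ℝ × ℝ} (hp : p ∈ Y) (hq : q ∈ Y) :
    u p ≤ u q * Real.exp P.rg :=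
  (hu.cone.le p hp q hq).trans (mul_le_mul_of_nonneg_left
    (Real.exp_le_exp.2 (κY_le rg_nonneg hp hq)) (hu.cone.nonneg q hq))

lemma le_integral (hu : P.Dn u) {p : ℝ × ℝ} (hp : p ∈ Y) :
    u p ≤ 2 * Real.exp P.rg * ∫ q in Y, u q := by
  have h : ∫ _ in Y, u p ≤ ∫ q in Y, u q * Real.exp P.rg :=
    setIntegral_mono_on (BM.const _).integrableOn_Y (hu.bm.mul (BM.const _)).integrableOn_Y
      measurableSet_Y fun q hq => hu.le_mul_exp hp hq
  rw [setIntegral_Y_const, integral_mul_const] at h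
  linarith

lemma integral_le (hu : P.Dn u) {q : ℝ × ℝ} (hq : q ∈ Y) :
    2 * ∫ p in Y, u p ≤ u q * Real.exp P.rg := by
  have h : ∫ p in Y, u p ≤ ∫ _ in Y, u q * Real.exp P.rg :=
    setIntegral_mono_on hu.bm.integrableOn_Y (BM.const _).integrableOn_Y
      measurableSet_Y fun p hp => hu.le_mul_exp hp hq
  rw [setIntegral_Y_const] at h
  linarith

lemma integral_nonneg (hu : P.Dn u) : 0 ≤ ∫ p in Y, u p :=
  setIntegral_nonneg measurableSet_Y hu.cone.nonneg

lemma const {c : ℝ} (hc : 0 ≤ c) : P.Dn fun _ => c :=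
  ⟨BM.const c, InCone.const hc fun p _ q _ => P.κY_nonneg rg_nonneg p q⟩

lemma const_mul (hu : P.Dn u) {c : ℝ} (hc : 0 ≤ c) : P.Dn fun q => c * u q where
  bm := (BM.const c).mul hu.bm
  cone :=
    { nonneg := fun p hp => mul_nonneg hc (hu.cone.nonneg p hp)
      le := fun p hp q hq => by
        rw [mul_assoc]
        exact mul_le_mul_of_nonneg_left (hu.cone.le p hp q hq) hc }

lemma of_sub_const (hu : BM u) (hc : InCone (P.κY (P.rg - 1)) Y u) {k : ℝ} (hk : 0 ≤ k)
    (h : ∀ q ∈ Y, k * (P.rg * Real.exp P.rg) ≤ u q) : P.Dn fun q => u q + -k where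
  bm := hu.add (BM.const _)
  cone :=
    { nonneg := fun q hq => by
        have h1 := one_le_rg (P := P)
        have h2 : 1 ≤ P.rg * Real.exp P.rg := one_le_mul_of_one_le_of_one_le h1
          (Real.one_le_exp (by linarith))
        nlinarith [h q hq]
      le := fun p hp q hq => by
        have hb := one_le_rg (P := P)
        have h1 := hc.le p hp q hq
        have h3 := h q hq
        have hd1 := P.dist_rpow_le_one (Y_subset_X hp) (Y_subset_X hq)
        have hd0 : 0 ≤ dist p q ^ P.t := Real.rpow_nonneg dist_nonneg _
        simp only [κY] at h1 ⊢
        set d := dist p q ^ P.t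
        set b := P.rg
        have e1 : Real.exp (b * d) = Real.exp ((b - 1) * d) * Real.exp d := by
          rw [← Real.exp_add]; ring_nf
        have e2 : 1 ≤ Real.exp ((b - 1) * d) :=
          Real.one_le_exp (mul_nonneg (by linarith) hd0)
        have e3 : d ≤ Real.exp d - 1 := by linarith [Real.add_one_le_exp d]
        have e4 : Real.exp (b * d) - 1 ≤ b * d * Real.exp b := by
          have h5 := Real.add_one_le_exp (-(b * d))
          have h6 : Real.exp (b * d) * Real.exp (-(b * d)) = 1 := by
            rw [← Real.exp_add]; simp
          have h7 : Real.exp (b * d) ≤ Real.exp b := Real.exp_le_exp.2 (by nlinarith)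
          have h8 := Real.exp_pos (b * d)
          have h9 : 0 ≤ b * d := by positivity
          nlinarith
        have e5 : d ≤ Real.exp (b * d) - Real.exp ((b - 1) * d) := by
          rw [e1]; nlinarith
        have hu0 := hc.nonneg q hq
        have e6 : u q * d ≤ u q * (Real.exp (b * d) - Real.exp ((b - 1) * d)) :=
          mul_le_mul_of_nonneg_left e5 hu0
        have e7 : k * (Real.exp (b * d) - 1) ≤ k * (b * d * Real.exp b) :=
          mul_le_mul_of_nonneg_left e4 hk
        have e8 : k * (b * Real.exp b) * d ≤ u q * d := mul_le_mul_of_nonneg_right h3 hd0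
        linarith }

end Dn

variable (P) in
/-- The Doeblin constant of the return map. -/
def dc : ℝ := Real.exp (-2 * P.rg) / P.rg

variable (P) in
/-- The contraction rate of the transfer operator. -/
def rt : ℝ := 1 - P.dc / 2

lemma dc_pos : 0 < P.dc := div_pos (Real.exp_pos _) (by linarith [one_le_rg (P := P)])

lemma dc_le_one : P.dc ≤ 1 := by
  have := one_le_rg (P := P)
  refine div_le_one_of_le₀ ((Real.exp_le_one_iff.2 (by linarith)).trans this) (by linarith)

lemma rt_pos : 0 < P.rt := by linarith [dc_le_one (P := P), show P.rt = 1 - P.dc / 2 from rfl]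

lemma rt_lt_one : P.rt < 1 := by linarith [dc_pos (P := P), show P.rt = 1 - P.dc / 2 from rfl]

lemma Dn.sub_dc {u : ℝ × ℝ → ℝ} (hu : P.Dn u) {I : ℝ} (hI : ∫ q in Y, u q = I) :
    P.Dn fun q => P.L u q + -(P.dc * I) := by
  have hI0 : 0 ≤ I := hI ▸ hu.integral_nonneg
  refine Dn.of_sub_const hu.bm.L hu.L_cone (mul_nonneg dc_pos.le hI0) fun q hq => ?_
  have h1 := hu.L.integral_le hq
  rw [hu.bm.setIntegral_L, hI] at h1
  have h2 : P.dc * I * (P.rg * Real.exp P.rg) = I * Real.exp (-P.rg) := by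
    have h0 : P.rg ≠ 0 := by linarith [one_le_rg (P := P)]
    rw [dc, show -2 * P.rg = -P.rg + -P.rg by ring, Real.exp_add]
    have h3 : Real.exp (-P.rg) * Real.exp P.rg = 1 := by rw [← Real.exp_add]; simp
    generalize Real.exp (-P.rg) = x, Real.exp P.rg = y at *
    have h4 : x * x / P.rg * I * (P.rg * y) = (x * y) * (I * x) := by field_simp
    rw [h4, h3, one_mul]
  have h3 : Real.exp P.rg * Real.exp (-P.rg) = 1 := by rw [← Real.exp_add]; simp
  have h4 := mul_le_mul_of_nonneg_right h1 (Real.exp_pos (-P.rg)).le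
  rw [mul_assoc (P.L u q), h3] at h4
  have h5 := mul_nonneg hI0 (Real.exp_pos (-P.rg)).le
  rw [h2]
  linarith

/-- The transfer operator contracts differences of functions in the invariant cone. -/
lemma abs_iterate_L_sub_le {u v : ℝ × ℝ → ℝ} (hu : P.Dn u) (hv : P.Dn v) {I : ℝ}
    (hI : ∫ q in Y, u q = I) (hI' : ∫ q in Y, v q = I) (n : ℕ) {q : ℝ × ℝ} (hq : q ∈ Y) :
    |P.L^[n] u q - P.L^[n] v q| ≤ 2 * Real.exp P.rg * I * P.rt ^ n := by
  induction n generalizing u v I with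
  | zero =>
    have h1 := hu.le_integral hq
    have h2 := hv.le_integral hq
    have h3 := hu.cone.nonneg q hq
    have h4 := hv.cone.nonneg q hq
    rw [hI] at h1
    rw [hI'] at h2
    simp only [Function.iterate_zero, id, pow_zero, mul_one]
    rw [abs_le]
    constructor <;> linarith
  | succ n ih =>
    have key : ∀ {u}, P.Dn u → ∫ q in Y, u q = I →
        P.L^[n + 1] u = (fun q => P.L^[n] (fun q => P.L u q + -(P.dc * I)) q +
          P.L^[n] (fun _ => P.dc * I) q) ∧
        ∫ q in Y, P.L u q + -(P.dc * I) = P.rt * I := fun {u} hu hI => by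
      refine ⟨?_, ?_⟩
      · rw [← (hu.bm.L.add (BM.const _)).iterate_L_add (BM.const _)]
        simp
      · rw [integral_add hu.bm.L.integrableOn_Y (BM.const _).integrableOn_Y, hu.bm.setIntegral_L,
          hI, setIntegral_Y_const, rt]
        ring
    have h := ih (hu.sub_dc hI) (hv.sub_dc hI') (key hu hI).2 (key hv hI').2
    rw [(key hu hI).1, (key hv hI').1, add_sub_add_right_eq_sub, pow_succ]
    convert h using 1
    ring

end Cone

/-- The return map has an invariant density in the invariant cone. -/
lemma exists_density (P : LSVParams) : ∃ h : ℝ × ℝ → ℝ, P.Dn h ∧ ∫ q in Y, h q = 1 ∧ P.L h = h := by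
  set U : ℕ → ℝ × ℝ → ℝ := fun n => P.L^[n + 1] fun _ => 2
  have h2 : P.Dn fun _ => 2 := Dn.const zero_le_two
  have hI2 : ∫ _ in Y, (2 : ℝ) = 1 := by rw [setIntegral_Y_const]; norm_num
  have hU : ∀ n, P.Dn (U n) := fun n => h2.iterate_L _
  have hUI : ∀ n, ∫ q in Y, U n q = 1 := fun n => by rw [h2.bm.setIntegral_iterate_L, hI2]
  have hU0 : ∀ n, ∀ q ∉ Y, U n q = 0 := fun n q hq => by
    simp only [U, Function.iterate_succ_apply']
    exact L_of_notMem hq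
  set K := 2 * Real.exp P.rg
  have hK : 0 ≤ K := by positivity
  have hd : ∀ q n, dist (U n q) (U (n + 1) q) ≤ K * P.rt ^ n := fun q n => by
    have hr : 0 ≤ K * P.rt ^ n := mul_nonneg hK (pow_nonneg rt_pos.le _)
    by_cases hq : q ∈ Y
    · have h := abs_iterate_L_sub_le (P := P) h2.L h2.L.L (by rw [h2.bm.setIntegral_L, hI2])
        (by rw [h2.L.bm.setIntegral_L, h2.bm.setIntegral_L, hI2]) n hq
      rw [mul_one] at h
      rwa [Real.dist_eq]
    · simpa [hU0 _ q hq] using hr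
  choose h hh using fun q =>
    cauchySeq_tendsto_of_complete (cauchySeq_of_le_geometric _ _ rt_lt_one (hd q))
  have hdist : ∀ n q, |U n q - h q| ≤ K * P.rt ^ n / (1 - P.rt) := fun n q =>
    dist_le_of_le_geometric_of_tendsto _ _ rt_lt_one (hd q) (hh q) n
  have hUK : ∀ n, ∀ q ∈ Y, |U n q| ≤ K := fun n q hq => by
    rw [abs_of_nonneg ((hU n).cone.nonneg q hq)]
    simpa [hUI n] using (hU n).le_integral hq
  have hDn : P.Dn h := by
    refine ⟨⟨measurable_of_tendsto_metrizable (fun n => (hU n).bm.meas) (tendsto_pi_nhds.2 hh), K,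
      hK, fun q _ => ?_⟩, InCone.of_tendsto (fun n => (hU n).cone) fun q _ => hh q⟩
    refine le_of_tendsto' (hh q).abs fun n => ?_
    by_cases hq : q ∈ Y
    · exact hUK n q hq
    · simpa [hU0 n q hq] using hK
  refine ⟨h, hDn, ?_, ?_⟩
  · refine tendsto_nhds_unique (tendsto_integral_of_dominated_convergence (fun _ => K)
      (fun n => (hU n).bm.meas.aestronglyMeasurable) (BM.const K).integrableOn_Y (fun n =>
      ae_restrict_of_forall_mem measurableSet_Y (hUK n)) (Eventually.of_forall hh)) ?_
    simp [hUI]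
  · funext q
    by_cases hq : q ∈ Y
    · have hy : Tendsto (fun n => K * P.rt ^ n / (1 - P.rt)) atTop (𝓝 0) := by
        simpa using ((tendsto_pow_atTop_nhds_zero_of_lt_one rt_pos.le rt_lt_one).const_mul
          K).div_const (1 - P.rt)
      refine tendsto_nhds_unique (tendsto_L (fun n => (hU n).bm) hDn.bm hy
        (fun n q _ => hdist n q) hq) ?_
      refine ((tendsto_add_atTop_iff_nat 1).2 (hh q)).congr fun n => ?_
      simp only [U]
      rw [← Function.iterate_succ_apply' P.L]
    · rw [L_of_notMem hq]
      exact tendsto_nhds_unique (by simp [hU0 _ q hq]) (hh q)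

variable (P) in
/-- The invariant density of the return map. -/
def hd : ℝ × ℝ → ℝ := P.exists_density.choose

lemma hd_mem : P.Dn P.hd := P.exists_density.choose_spec.1

lemma integral_hd : ∫ q in Y, P.hd q = 1 := P.exists_density.choose_spec.2.1

lemma L_hd : P.L P.hd = P.hd := P.exists_density.choose_spec.2.2

lemma hd_lower {q : ℝ × ℝ} (hq : q ∈ Y) : 2 * Real.exp (-P.rg) ≤ P.hd q := by
  have h := mul_le_mul_of_nonneg_right (hd_mem.integral_le (P := P) hq) (Real.exp_pos (-P.rg)).le
  rwa [integral_hd, mul_one, mul_assoc, ← Real.exp_add, add_neg_cancel, Real.exp_zero,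
    mul_one] at h

lemma hd_pos {q : ℝ × ℝ} (hq : q ∈ Y) : 0 < P.hd q :=
  (by positivity : 0 < 2 * Real.exp (-P.rg)).trans_le (hd_lower hq)

lemma hd_upper {q : ℝ × ℝ} (hq : q ∈ Y) : P.hd q ≤ 2 * Real.exp P.rg := by
  simpa [integral_hd] using (hd_mem (P := P)).le_integral hq

lemma abs_iterate_L_sub_hd_le {u : ℝ × ℝ → ℝ} (hu : P.Dn u) (n : ℕ) {q : ℝ × ℝ} (hq : q ∈ Y) :
    |P.L^[n] u q - (∫ p in Y, u p) * P.hd q| ≤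
      2 * Real.exp P.rg * (∫ p in Y, u p) * P.rt ^ n := by
  have h := abs_iterate_L_sub_le hu (hd_mem.const_mul hu.integral_nonneg) rfl
    (by rw [integral_const_mul, integral_hd, mul_one]) n hq
  rwa [hd_mem.bm.iterate_L_const_mul, Function.iterate_fixed L_hd] at h

end LSVParams

lemma InCone.add_const {Ω : Type*} {κ : Ω → Ω → ℝ} {Z : Set Ω} {u : Ω → ℝ} {B K c : ℝ}
    (hκ : ∀ p ∈ Z, ∀ q ∈ Z, 0 ≤ κ p q) (hB : ∀ q ∈ Z, |u q| ≤ B) (hK0 : 0 ≤ K)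
    (hK : ∀ p ∈ Z, ∀ q ∈ Z, u p - u q ≤ K * κ p q) (hc : B + K ≤ c) :
    InCone κ Z fun q => u q + c where
  nonneg q hq := by linarith [(abs_le.1 (hB q hq)).1]
  le p hp q hq := by
    have h1 := Real.add_one_le_exp (κ p q)
    have h2 := hκ p hp q hq
    have h3 := hK p hp q hq
    have h4 : K ≤ u q + c := by linarith [(abs_le.1 (hB q hq)).1]
    nlinarith [mul_le_mul_of_nonneg_right h4 h2, mul_le_mul_of_nonneg_left h1 (hK0.trans h4)]

namespace LSVParams

variable {P : LSVParams}

lemma BM.of_abs_le {u : ℝ × ℝ → ℝ} (hu : Measurable u) (h : ∃ b, ∀ q, |u q| ≤ b) : BM u := by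
  obtain ⟨b, hb⟩ := h
  exact BM.of_bdd hu fun q _ => hb q

lemma tendsto_setIntegral_mul_iterate {u G : ℝ × ℝ → ℝ} (hu : BM u) {c : ℝ} (hc : 0 ≤ c)
    (huc : P.Dn fun q => u q + c) (hG : BM G) :
    Tendsto (fun n => ∫ q in Y, u q * G (P.F^[n] q)) atTop
      (𝓝 ((∫ q in Y, u q) * ∫ q in Y, P.hd q * G q)) := by
  obtain ⟨b, hb0, hb⟩ := hG.exists_bound
  set I := ∫ q in Y, u q + c
  have hI : ∫ q in Y, u q = I - ∫ _ in Y, c := by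
    simp only [I]
    rw [integral_add hu.integrableOn_Y (BM.const c).integrableOn_Y]
    ring
  set E := 2 * Real.exp P.rg * (I + ∫ _ in Y, c)
  have hL : ∀ n, ∀ q ∈ Y, |P.L^[n] u q - (∫ q in Y, u q) * P.hd q| ≤ E * P.rt ^ n := by
    intro n q hq
    have h1 := abs_iterate_L_sub_hd_le huc n hq
    have h2 := abs_iterate_L_sub_hd_le (P := P) (Dn.const hc) n hq
    rw [hu.iterate_L_add (BM.const c)] at h1
    rw [hI]
    calc |P.L^[n] u q - (I - ∫ _ in Y, c) * P.hd q|
        = |(P.L^[n] u q + P.L^[n] (fun _ => c) q - I * P.hd q) -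
            (P.L^[n] (fun _ => c) q - (∫ _ in Y, c) * P.hd q)| := by congr 1; ring
      _ ≤ _ := abs_sub _ _
      _ ≤ _ := add_le_add h1 h2
      _ = E * P.rt ^ n := by simp only [E]; ring
  rw [tendsto_iff_norm_sub_tendsto_zero]
  refine squeeze_zero (fun _ => norm_nonneg _) (g := fun n => E * P.rt ^ n * b * (1 / 2))
    (fun n => ?_) ?_
  · rw [← hu.setIntegral_iterate_L_mul hG, ← integral_const_mul, ← integral_sub]
    · refine (norm_setIntegral_le_of_norm_le_const (C := E * P.rt ^ n * b) (by simp [volume_Y])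
        fun q hq => ?_).trans_eq ?_
      · rw [← mul_assoc, ← sub_mul, norm_mul]
        exact mul_le_mul (hL n q hq) (hb q hq) (norm_nonneg _) ((abs_nonneg _).trans (hL n q hq))
      · rw [measureReal_def, volume_Y, ENNReal.toReal_ofReal (by norm_num)]
    · exact ((hu.iterate_L n).mul hG).integrableOn_Y
    · exact ((BM.const _).mul (hd_mem.bm.mul hG)).integrableOn_Y
  · simpa using (((tendsto_pow_atTop_nhds_zero_of_lt_one (rt_pos (P := P)).le rt_lt_one).const_mul
      E).mul_const b).mul_const 2⁻¹

lemma dist_le_rpow {p q : ℝ × ℝ} (hp : p ∈ X) (hq : q ∈ X) : dist p q ≤ P.κY 1 p q := by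
  rw [κY, one_mul]
  simpa using Real.rpow_le_rpow_of_exponent_ge' dist_nonneg (dist_le_one hp hq) P.t_pos.le P.t_le

lemma exists_dn_of_lipschitz {u : ℝ × ℝ → ℝ} (hu : BM u) {K : NNReal} (hK : LipschitzWith K u) :
    ∃ c, 0 ≤ c ∧ P.Dn fun q => u q + c := by
  obtain ⟨b, hb0, hb⟩ := hu.exists_bound
  refine ⟨b + K, by positivity, hu.add (BM.const _), inCone_κY_mono one_le_rg
    (InCone.add_const (fun p _ q _ => P.κY_nonneg zero_le_one p q) hb K.2 (fun p hp q hq => ?_)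
      le_rfl)⟩
  refine (le_abs_self _).trans ((hK.dist_le_mul p q).trans ?_)
  exact mul_le_mul_of_nonneg_left (dist_le_rpow (Y_subset_X hp) (Y_subset_X hq)) K.2

section Invariant

variable {ν : Measure (ℝ × ℝ)} [IsFiniteMeasure ν]

lemma setIntegral_comp_iterate_F (hS : MeasurePreserving P.S ν ν) (hX : ν Xᶜ = 0) {G : ℝ × ℝ → ℝ}
    (hG : Measurable G) (hGb : ∃ b, ∀ q, |G q| ≤ b) (n : ℕ) :
    ∫ p in Y, G (P.F^[n] p) ∂ν = ∫ p in Y, G p ∂ν := by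
  obtain ⟨b, hb⟩ := hGb
  induction n with
  | zero => rfl
  | succ n ih =>
    rw [← ih]
    exact P.hitting.integral_return hS hX (hG.comp (measurable_F.iterate n))
      ⟨b, fun q => hb _⟩

/-- An absolutely continuous invariant measure has density proportional to `hd` on the base. -/
lemma setIntegral_eq (hS : MeasurePreserving P.S ν ν) (hX : ν Xᶜ = 0) (hac : ν ≪ volume)
    {G : ℝ × ℝ → ℝ} (hG : Measurable G) (hGb : ∃ b, ∀ q, |G q| ≤ b) :
    ∫ p in Y, G p ∂ν = ν.real Y * ∫ p in Y, P.hd p * G p := by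
  obtain ⟨b, hb⟩ := hGb
  have hb0 : 0 ≤ b := (abs_nonneg _).trans (hb 0)
  have hGm : BM G := BM.of_abs_le hG ⟨b, hb⟩
  have hac' : ν.restrict Y ≪ volume.restrict Y := hac.restrict Y
  have : IsFiniteMeasure (volume.restrict Y : Measure (ℝ × ℝ)) := ⟨by simp [volume_Y]⟩
  set ρ := fun p => ((ν.restrict Y).rnDeriv (volume.restrict Y) p).toReal
  have hρ : IntegrableOn ρ Y := Measure.integrable_toReal_rnDeriv
  have hρ1 : ∫ p in Y, ρ p = ν.real Y := by
    have := integral_toReal_rnDeriv_mul hac' (f := fun _ => (1 : ℝ))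
    simpa using this
  have hρG : ∀ n, ∫ p in Y, ρ p * G (P.F^[n] p) = ∫ p in Y, G p ∂ν := fun n => by
    rw [← setIntegral_comp_iterate_F hS hX hG ⟨b, hb⟩ n]
    exact integral_toReal_rnDeriv_mul hac' (f := fun p => G (P.F^[n] p))
  have hmul : ∀ {v : ℝ × ℝ → ℝ}, IntegrableOn v Y → ∀ {g : ℝ × ℝ → ℝ}, Measurable g →
      (∀ q, |g q| ≤ b) → IntegrableOn (fun p => v p * g p) Y := fun hv g hg hgb =>
    hv.mul_bdd (c := b) hg.aestronglyMeasurable (Eventually.of_forall hgb)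
  set J := ∫ p in Y, P.hd p * G p
  have hJ : |J| ≤ b := by
    calc |J| ≤ ∫ p in Y, P.hd p * b := by
          rw [← Real.norm_eq_abs]
          refine norm_integral_le_of_norm_le (hd_mem.bm.mul (BM.const b)).integrableOn_Y
            (ae_restrict_of_forall_mem measurableSet_Y fun q hq => ?_)
          rw [norm_mul, Real.norm_eq_abs, Real.norm_eq_abs, abs_of_pos (hd_pos hq)]
          exact mul_le_mul_of_nonneg_left (hb q) (hd_pos hq).le
      _ = b := by rw [integral_mul_const, integral_hd, one_mul]
  have key : ∀ ε > 0, |∫ p in Y, G p ∂ν - ν.real Y * J| ≤ 2 * b * ε := by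
    intro ε hε
    obtain ⟨u, hu1, hu2, hu3⟩ := (memLp_one_iff_integrable.2 hρ).exist_eLpNorm_sub_le
      (by simp) le_rfl hε
    obtain ⟨K, hK⟩ := hu2.lipschitzWith_of_hasCompactSupport hu1 (by simp)
    obtain ⟨B, hB⟩ := hu1.exists_bound_of_continuous hu2.continuous
    have huBM : BM u := BM.of_bdd hu2.continuous.measurable fun q _ => hB q
    obtain ⟨c, hc, huc⟩ := exists_dn_of_lipschitz (P := P) huBM hK
    have hsub : IntegrableOn (fun p => ρ p - u p) Y := hρ.sub huBM.integrableOn_Y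
    have hd1 : ∫ p in Y, |ρ p - u p| ≤ ε := by
      have h := hu3
      rw [eLpNorm_one_eq_lintegral_enorm] at h
      have h2 := integral_norm_eq_lintegral_enorm hsub.aestronglyMeasurable
      simp only [Real.norm_eq_abs] at h2
      rw [h2]
      exact ENNReal.toReal_le_of_le_ofReal hε.le h
    have hd2 : ∀ g : ℝ × ℝ → ℝ, Measurable g → (∀ q, |g q| ≤ b) →
        |(∫ p in Y, ρ p * g p) - ∫ p in Y, u p * g p| ≤ b * ε := fun g hg hgb => by
      rw [← integral_sub (hmul hρ hg hgb) (hmul huBM.integrableOn_Y hg hgb)]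
      calc |∫ p in Y, ρ p * g p - u p * g p| ≤ ∫ p in Y, b * |ρ p - u p| := by
            rw [← Real.norm_eq_abs]
            refine norm_integral_le_of_norm_le (hsub.abs.const_mul b)
              (Eventually.of_forall fun q => ?_)
            rw [← sub_mul, norm_mul, mul_comm]
            exact mul_le_mul_of_nonneg_right (hgb q) (norm_nonneg _)
        _ ≤ b * ε := by
            rw [integral_const_mul]
            exact mul_le_mul_of_nonneg_left hd1 hb0
    have hd3 : |ν.real Y - ∫ p in Y, u p| ≤ ε := by
      rw [← hρ1, ← integral_sub hρ huBM.integrableOn_Y]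
      exact abs_integral_le_integral_abs.trans hd1
    have hlim : Tendsto (fun n => |∫ p in Y, G p ∂ν - ∫ p in Y, u p * G (P.F^[n] p)|) atTop
        (𝓝 |∫ p in Y, G p ∂ν - (∫ q in Y, u q) * J|) :=
      ((tendsto_setIntegral_mul_iterate huBM hc huc hGm).const_sub _).abs
    have h1 := le_of_tendsto' hlim (b := b * ε) fun n => by
      rw [← hρG n]
      exact hd2 (fun p => G (P.F^[n] p)) (hG.comp (measurable_F.iterate n)) fun q => hb _
    have h2 : |(∫ q in Y, u q) * J - ν.real Y * J| ≤ b * ε := by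
      rw [← sub_mul, abs_mul, abs_sub_comm, mul_comm]
      exact mul_le_mul hJ hd3 (abs_nonneg _) hb0
    calc _ ≤ _ := abs_sub_le _ ((∫ q in Y, u q) * J) _
      _ ≤ b * ε + b * ε := add_le_add h1 h2
      _ = _ := by ring
  have h0 : Tendsto (fun ε : ℝ => 2 * b * ε) (𝓝[>] 0) (𝓝 0) := by
    have : Continuous fun ε : ℝ => 2 * b * ε := by fun_prop
    simpa using (this.tendsto 0).mono_left nhdsWithin_le_nhds
  exact sub_eq_zero.1 (abs_nonpos_iff.1 (ge_of_tendsto h0 (eventually_nhdsWithin_of_forall key)))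

omit [IsFiniteMeasure ν] in
lemma measure_eq_zero (hS : MeasurePreserving P.S ν ν) (hX : ν Xᶜ = 0) {A : Set (ℝ × ℝ)}
    (hA : P.S ⁻¹' A = A) (hAm : MeasurableSet A) (h : ν (A ∩ Y) = 0) : ν A = 0 := by
  have h1 : A ⊆ Xᶜ ∪ ⋃ n, P.S^[n] ⁻¹' (A ∩ Y) := fun q hq => by
    by_cases hqX : q ∈ X
    · refine Or.inr (mem_iUnion.2 ⟨P.τ q, ?_, P.hitting.hitMap_mem q hqX⟩)
      have : ∀ n, P.S^[n] ⁻¹' A = A := fun n => by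
        induction n with
        | zero => rfl
        | succ n ih => rw [Function.iterate_succ, preimage_comp, ih, hA]
      have h2 := this (P.τ q)
      rw [← h2] at hq
      exact hq
    · exact Or.inl hqX
  refine measure_mono_null h1 (measure_union_null hX (measure_iUnion_null fun n => ?_))
  rw [(hS.iterate n).measure_preimage (hAm.inter measurableSet_Y).nullMeasurableSet, h]

/-- An absolutely continuous invariant measure is ergodic. -/
lemma ergodic (hS : MeasurePreserving P.S ν ν) (hX : ν Xᶜ = 0) (hac : ν ≪ volume) :
    Ergodic P.S ν where
  toMeasurePreserving := hS
  aeconst_set A hAm hA := by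
    have hAc : P.S ⁻¹' Aᶜ = Aᶜ := by rw [preimage_compl, hA]
    have hS' : MeasurePreserving P.S (ν.restrict A) (ν.restrict A) := by
      simpa [hA] using hS.restrict_preimage hAm
    have hG : Measurable (Aᶜ.indicator fun _ => (1 : ℝ)) := measurable_const.indicator hAm.compl
    have hGb : ∃ b, ∀ q, |Aᶜ.indicator (fun _ => (1 : ℝ)) q| ≤ b :=
      ⟨1, fun q => by by_cases hq : q ∈ A <;> simp [hq]⟩
    have hX' : ν.restrict A Xᶜ = 0 := by
      rw [Measure.restrict_apply measurableSet_X.compl]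
      exact measure_mono_null inter_subset_left hX
    have h1 := setIntegral_eq hS' hX' (Measure.absolutelyContinuous_of_le
        Measure.restrict_le_self |>.trans hac) hG hGb
    have h2 := setIntegral_eq hS hX hac hG hGb
    rw [integral_indicator_const _ hAm.compl, measureReal_restrict_apply hAm.compl,
      measureReal_restrict_apply (hAm.compl.inter measurableSet_Y)] at h1
    rw [integral_indicator_const _ hAm.compl, measureReal_restrict_apply hAm.compl] at h2
    have h3 : Aᶜ ∩ Y ∩ A = ∅ := by ext; simp; tauto
    rw [h3, measureReal_empty, zero_smul, measureReal_restrict_apply measurableSet_Y] at h1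
    rw [eventuallyConst_set']
    rcases mul_eq_zero.1 h1.symm with h4 | h4
    · left
      rw [measureReal_eq_zero_iff] at h4
      exact ae_eq_empty.2 (measure_eq_zero hS hX hA hAm (by rwa [inter_comm]))
    · right
      rw [h4, mul_zero, smul_eq_mul, mul_one, measureReal_eq_zero_iff] at h2
      exact ae_eq_univ.2 (measure_eq_zero hS hX hAc hAm.compl h2)

end Invariant

end LSVParams

namespace LSVParams

variable {P : LSVParams}

lemma integrableOn_sq_return_time :
    IntegrableOn (fun p => ((P.τ (P.S p) : ℝ) + 1) ^ 2) Y := by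
  set s : ℕ → Set (ℝ × ℝ) := fun n => Y ∩ {p | P.τ (P.S p) = n}
  have hs : ∀ n, MeasurableSet (s n) := fun n => measurableSet_Y.inter (measurableSet_τ_eq n)
  have hY : Y = ⋃ n, s n := by
    ext p
    simp [s]
  have hval : ∀ n, ∀ p ∈ s n, ((P.τ (P.S p) : ℝ) + 1) ^ 2 = ((n : ℝ) + 1) ^ 2 := fun n p hp => by
    rw [hp.2]
  have hvol : ∀ n, volume (s n) ≠ ⊤ := fun n =>
    measure_ne_top_of_subset inter_subset_left (by simp [volume_Y])
  rw [hY]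
  refine integrableOn_iUnion_of_summable_integral_norm (fun n => ?_) ?_
  · exact (integrableOn_const (C := ((n : ℝ) + 1) ^ 2) (hvol n)).congr_fun
      (fun p hp => (hval n p hp).symm) (hs n)
  · refine P.summable_sq_mul_tb.of_nonneg_of_le
      (fun n => setIntegral_nonneg (hs n) fun _ _ => norm_nonneg _) fun n => ?_
    have h1 : ∫ p in s n, ‖((P.τ (P.S p) : ℝ) + 1) ^ 2‖ = ((n : ℝ) + 1) ^ 2 * volume.real (s n) := by
      rw [setIntegral_congr_fun (hs n) (g := fun _ => ((n : ℝ) + 1) ^ 2) fun p hp => by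
        simp only [hval n p hp]
        exact Real.norm_of_nonneg (by positivity)]
      rw [setIntegral_const, smul_eq_mul, mul_comm]
    have h2 : volume.real (s n) = ∫ q in Y, P.Tn n (fun _ => 1) q := by
      have h := P.setIntegral_Tn_mul (BM.const 1) (BM.const 1) n
      simp only [mul_one, one_mul] at h
      rw [h, show s n = {p | P.τ (P.S p) = n} ∩ Y from inter_comm _ _,
        ← measureReal_restrict_apply (measurableSet_τ_eq n),
        ← integral_indicator_one (measurableSet_τ_eq n)]
      exact integral_congr_ae (Eventually.of_forall fun p => by simp [indicator_apply])
    have h3 : ∫ q in Y, P.Tn n (fun _ => 1) q ≤ ∫ _ in Y, P.tb n :=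
      setIntegral_mono_on (P.bm_Tn (BM.const 1) n).integrableOn_Y (BM.const _).integrableOn_Y
        measurableSet_Y fun q hq => (le_abs_self _).trans (by
          simpa using P.abs_Tn_le_tb zero_le_one (u := fun _ => 1) (by simp) n hq)
    rw [h1, h2]
    rw [setIntegral_Y_const] at h3
    exact mul_le_mul_of_nonneg_left (h3.trans (by linarith [P.tb_nonneg n])) (by positivity)

/-- The cohomological equation for the transfer operator. -/
lemma exists_eq_add_L {u : ℝ × ℝ → ℝ} (hu : BM u) {K : ℝ}
    (hK : ∀ n, ∀ q ∈ Y, |P.L^[n] u q| ≤ K * P.rt ^ n) :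
    ∃ z, BM z ∧ ∀ q ∈ Y, z q = u q + P.L z q := by
  have hsum : Summable fun n => K * P.rt ^ n :=
    (summable_geometric_of_lt_one rt_pos.le rt_lt_one).mul_left K
  set z := ySum fun n => P.L^[n] u
  have hz : BM z := bm_ySum (fun n => (hu.iterate_L n).meas) hsum hK
  refine ⟨z, hz, fun q hq => ?_⟩
  set Z : ℕ → ℝ × ℝ → ℝ := fun N q => ∑ n ∈ Finset.range N, P.L^[n] u q
  have hZ : ∀ N, BM (Z N) ∧ P.L (Z N) = fun q => ∑ n ∈ Finset.range N, P.L^[n + 1] u q := by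
    intro N
    induction N with
    | zero =>
      refine ⟨by simpa [Z] using BM.const 0, ?_⟩
      have := (BM.const 0).L_const_mul_eq (P := P) 0
      simpa [Z] using this
    | succ N ih =>
      have h : Z (N + 1) = fun q => Z N q + P.L^[N] u q := funext fun q => by
        simp only [Z, Finset.sum_range_succ]
      rw [h]
      refine ⟨ih.1.add (hu.iterate_L N), ?_⟩
      rw [ih.1.L_add_eq (hu.iterate_L N), ih.2]
      funext q
      rw [Finset.sum_range_succ, Function.iterate_succ_apply']
  have hlim : ∀ q ∈ Y, Tendsto (fun N => Z N q) atTop (𝓝 (z q)) := fun q hq =>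
    (hasSum_ySum hsum hK hq).tendsto_sum_nat
  have hdist : ∀ N, ∀ q ∈ Y, |Z N q - z q| ≤ K * P.rt ^ N / (1 - P.rt) := fun N q hq =>
    dist_le_of_le_geometric_of_tendsto _ _ rt_lt_one (fun n => by
      rw [dist_comm, Real.dist_eq]
      simp only [Z, Finset.sum_range_succ, add_sub_cancel_left]
      exact hK n q hq) (hlim q hq) N
  have hy : Tendsto (fun n => K * P.rt ^ n / (1 - P.rt)) atTop (𝓝 0) := by
    simpa using ((tendsto_pow_atTop_nhds_zero_of_lt_one (rt_pos (P := P)).le rt_lt_one).const_mul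
      K).div_const (1 - P.rt)
  have h1 := tendsto_L (P := P) (fun N => (hZ N).1) hz hy hdist hq
  have h2 : Tendsto (fun N => Z (N + 1) q) atTop (𝓝 (u q + P.L z q)) := by
    refine (h1.const_add (u q)).congr fun N => ?_
    simp only [Z]
    rw [(hZ N).2, Finset.sum_range_succ', add_comm]
    rfl
  exact tendsto_nhds_unique ((tendsto_add_atTop_iff_nat 1).2 (hlim q hq)) h2

/-- The total mass transported by the returns, weighted by the accumulated values of `f`. -/
lemma dn_ySum_acc {f : ℝ × ℝ → ℝ} (hf : BM f) (hc : InCone (P.κY 1) X f) :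
    P.Dn (ySum (P.acc f P.hd)) := by
  obtain ⟨b, hb0, hb⟩ := hf.bdd
  obtain ⟨d, hd0, hd⟩ := (hd_mem (P := P)).bm.exists_bound
  have hθ := P.θ_pos.le
  have hθ1 := P.θ_lt_one
  have hr := rg_nonneg (P := P)
  have hcone : ∀ n, InCone (P.κX (P.θ * P.rg + 1)) X (P.acc f P.hd n) := by
    intro n
    induction n with
    | zero =>
      have h1 : InCone (P.κY (P.rg + 1)) Y fun q => f q * P.hd q :=
        ((hc.mono Y_subset_X fun _ _ _ _ => le_rfl).mul hd_mem.cone).mono subset_rfl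
          fun p _ q _ => by simp only [κY]; linarith
      refine (P.inCone_B (by linarith) h1).mono subset_rfl fun p _ q _ => ?_
      have := mul_le_mul_of_nonneg_right hθ1.le (P.κY_nonneg zero_le_one p q)
      simp only [κX, κY] at this ⊢
      linarith
    | succ n ih =>
      have h1 := hc.mul (P.inCone_Tn hr hd_mem.cone n)
      refine P.inCone_A (by positivity) (ih.add (h1.mono subset_rfl fun p _ q _ => ?_))
      simp only [κX, κY]
      linarith
  have hs := P.summable_mul_tb.mul_left (b * d)
  have hle : ∀ n, ∀ q ∈ Y, |P.acc f P.hd n q| ≤ b * d * (((n : ℝ) + 1) * P.tb n) :=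
    fun n q hq => P.abs_acc_le_tb hb0 hd0 hb hd n hq
  refine ⟨bm_ySum (fun n => (P.bm_acc hf hd_mem.bm n).meas) hs hle, ?_⟩
  have h := P.inCone_ySum hs hle (b := P.θ * P.rg + 1) (by positivity) hcone
  rwa [show P.θ * P.rg + 1 + 4 = P.rg by linarith [θ_mul_rg (P := P)]] at h

section Invariant

variable {ν : Measure (ℝ × ℝ)} [IsFiniteMeasure ν]

lemma restrict_eq_withDensity (hS : MeasurePreserving P.S ν ν) (hX : ν Xᶜ = 0)
    (hac : ν ≪ volume) :
    ν.restrict Y = (volume.restrict Y).withDensity fun p => ENNReal.ofReal (ν.real Y * P.hd p) := by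
  have hm : BM fun p => ν.real Y * P.hd p := (BM.const _).mul hd_mem.bm
  ext A hA
  have h := setIntegral_eq hS hX hac (G := A.indicator 1) (measurable_one.indicator hA)
    ⟨1, fun q => by by_cases hq : q ∈ A <;> simp [hq]⟩
  rw [integral_indicator_one hA, ← integral_const_mul] at h
  have h2 : ∀ p, ν.real Y * (P.hd p * A.indicator 1 p) =
      A.indicator (fun p => ν.real Y * P.hd p) p := fun p => by
    by_cases hp : p ∈ A <;> simp [hp]
  simp only [h2] at h
  rw [integral_indicator hA] at h
  rw [withDensity_apply _ hA, ← ofReal_integral_eq_lintegral_ofReal, ← h, ofReal_measureReal]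
  · exact Integrable.mono_measure hm.integrableOn_Y Measure.restrict_le_self
  · refine ae_restrict_of_ae (ae_restrict_of_forall_mem measurableSet_Y fun q hq => ?_)
    exact mul_nonneg measureReal_nonneg (hd_pos hq).le

lemma setIntegral_eq' (hS : MeasurePreserving P.S ν ν) (hX : ν Xᶜ = 0) (hac : ν ≪ volume)
    (G : ℝ × ℝ → ℝ) : ∫ p in Y, G p ∂ν = ν.real Y * ∫ p in Y, P.hd p * G p := by
  have hm : Measurable fun p => ν.real Y * P.hd p := measurable_const.mul hd_mem.bm.meas
  rw [restrict_eq_withDensity hS hX hac, integral_withDensity_eq_integral_toReal_smul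
    hm.ennreal_ofReal (Eventually.of_forall fun _ => ENNReal.ofReal_lt_top), ← integral_const_mul]
  refine setIntegral_congr_fun measurableSet_Y fun p hp => ?_
  simp only [smul_eq_mul]
  rw [ENNReal.toReal_ofReal (mul_nonneg measureReal_nonneg (hd_pos hp).le), mul_assoc]

lemma integrableOn_of_volume (hS : MeasurePreserving P.S ν ν) (hX : ν Xᶜ = 0)
    (hac : ν ≪ volume) {G : ℝ × ℝ → ℝ} (hG : IntegrableOn G Y) : IntegrableOn G Y ν := by
  have hm : Measurable fun p => ν.real Y * P.hd p := measurable_const.mul hd_mem.bm.meas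
  rw [IntegrableOn, restrict_eq_withDensity hS hX hac,
    integrable_withDensity_iff_integrable_smul' hm.ennreal_ofReal
      (Eventually.of_forall fun _ => ENNReal.ofReal_lt_top)]
  refine Integrable.bdd_mul (c := ν.real Y * (2 * Real.exp P.rg)) hG
    hm.ennreal_ofReal.ennreal_toReal.aestronglyMeasurable
    (ae_restrict_of_forall_mem measurableSet_Y fun p hp => ?_)
  have h0 : 0 ≤ ν.real Y * P.hd p := mul_nonneg measureReal_nonneg (hd_pos hp).le
  rw [ENNReal.toReal_ofReal h0, Real.norm_of_nonneg h0]
  exact mul_le_mul_of_nonneg_left (hd_upper hp) measureReal_nonneg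

end Invariant

end LSVParams

namespace LSVParams

/-- The Birkhoff sum of `f` up to the first return to the base. -/
def V (P : LSVParams) (f : ℝ × ℝ → ℝ) (p : ℝ × ℝ) : ℝ := bsum P.S f (P.τ (P.S p) + 1) p

/-- The Birkhoff sum of `f` up to the first hitting of the base. -/
def H (P : LSVParams) (f : ℝ × ℝ → ℝ) (q : ℝ × ℝ) : ℝ := bsum P.S f (P.τ q) q

/-- The Birkhoff sum of `f` up to the first hitting of the base or time `N`. -/
def HN (P : LSVParams) (f : ℝ × ℝ → ℝ) (N : ℕ) (q : ℝ × ℝ) : ℝ := bsum P.S f (min (P.τ q) N) q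

variable {P : LSVParams} {f : ℝ × ℝ → ℝ} {B : ℝ}

lemma measurable_bsum_comp (hf : Measurable f) {k : ℝ × ℝ → ℕ} (hk : Measurable k) :
    Measurable fun q => bsum P.S f (k q) q := by
  have h1 : Measurable (fun p : ℕ × (ℝ × ℝ) => bsum P.S f p.1 p.2) :=
    measurable_from_prod_countable_right fun n => measurable_bsum P.measurable_S hf n
  exact h1.comp (hk.prodMk measurable_id)

lemma measurable_V (hf : Measurable f) : Measurable (P.V f) :=
  measurable_bsum_comp hf ((P.measurable_τ.comp P.measurable_S).add_const 1)

lemma measurable_H (hf : Measurable f) : Measurable (P.H f) :=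
  measurable_bsum_comp hf P.measurable_τ

lemma measurable_HN (hf : Measurable f) (N : ℕ) : Measurable (P.HN f N) :=
  measurable_bsum_comp hf (P.measurable_τ.min measurable_const)

lemma V_eq (p : ℝ × ℝ) : P.V f p = f p + P.H f (P.S p) := bsum_succ _ _ _

lemma abs_V_le (hB : ∀ q, |f q| ≤ B) (p : ℝ × ℝ) : |P.V f p| ≤ ((P.τ (P.S p) : ℝ) + 1) * B := by
  simpa [V] using abs_bsum_le (S := P.S) hB (P.τ (P.S p) + 1) p

lemma H_of_mem {q : ℝ × ℝ} (hq : q ∈ Y) : P.H f q = 0 := by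
  simp [H, P.hitting.zero q hq, bsum]

lemma H_of_notMem {q : ℝ × ℝ} (hq : q ∈ X) (hq' : q ∉ Y) : P.H f q = f q + P.H f (P.S q) := by
  rw [H, P.hitting.succ q hq hq', bsum_succ, H]

lemma HN_succ {q : ℝ × ℝ} (hq : q ∈ X) (N : ℕ) :
    Y.indicator (fun p => f p + P.HN f N (P.S p)) q = f q + P.HN f N (P.S q) - P.HN f (N + 1) q := by
  by_cases h : q ∈ Y
  · simp [h, HN, P.hitting.zero q h, bsum]
  · simp only [h, not_false_eq_true, indicator_of_notMem]
    rw [HN, HN, P.hitting.succ q hq h, min_add_add_right, bsum_succ]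
    ring

lemma abs_HN_sub_le (hB : ∀ q, |f q| ≤ B) (N : ℕ) (q : ℝ × ℝ) :
    |P.HN f N q - P.HN f (N + 1) q| ≤ B := by
  rcases le_or_gt (P.τ q) N with h | h
  · rw [HN, HN, min_eq_left h, min_eq_left (by omega), sub_self, abs_zero]
    exact (abs_nonneg _).trans (hB q)
  · rw [HN, HN, min_eq_right h.le, min_eq_right h, bsum, bsum, Finset.sum_range_succ, abs_sub_comm,
      add_sub_cancel_left]
    exact hB _

lemma sum_setIntegral_acc_mul {h G : ℝ × ℝ → ℝ} (hf : BM f) (hh : BM h) (hG : BM G) (N : ℕ) :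
    ∑ n ∈ Finset.range N, ∫ q in Y, P.acc f h n q * G q =
      ∫ p in Y, if P.τ (P.S p) < N then h p * P.V f p * G (P.F p) else 0 := by
  simp_rw [P.setIntegral_acc_mul hf hh hG]
  rw [← integral_finsetSum]
  · refine setIntegral_congr_fun measurableSet_Y fun p _ => ?_
    simp only [mul_ite, mul_zero, Finset.sum_ite_eq, Finset.mem_range]
    rfl
  · exact fun n _ => ((hh.mul (P.bm_bsum hf (n + 1))).mul (hG.comp_F.ite (BM.const 0)
      (measurableSet_τ_eq n))).integrableOn_Y

lemma tendsto_setIntegral_ySum {U : ℕ → ℝ × ℝ → ℝ} (hU : ∀ n, Measurable (U n)) {y : ℕ → ℝ}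
    (hy : Summable y) (h : ∀ n, ∀ q ∈ Y, |U n q| ≤ y n) :
    Tendsto (fun N => ∑ n ∈ Finset.range N, ∫ q in Y, U n q) atTop (𝓝 (∫ q in Y, ySum U q)) := by
  refine HasSum.tendsto_sum_nat (hasSum_integral_of_dominated_convergence (fun n _ => y n)
    (fun n => (hU n).aestronglyMeasurable)
    (fun n => ae_restrict_of_forall_mem measurableSet_Y (h n)) ?_ (BM.const _).integrableOn_Y ?_)
  · exact Eventually.of_forall fun _ => hy
  · exact ae_restrict_of_forall_mem measurableSet_Y fun q hq => hasSum_ySum hy h hq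

lemma integrableOn_return_time {c : ℝ} :
    IntegrableOn (fun p => ((P.τ (P.S p) : ℝ) + 1) * c) Y := by
  refine Integrable.mul_const ?_ c
  refine (integrableOn_sq_return_time (P := P)).mono' ?_ (Eventually.of_forall fun p => ?_)
  · exact ((measurable_from_nat.comp (P.measurable_τ.comp P.measurable_S)).add_const
      (1 : ℝ)).aestronglyMeasurable
  · rw [Real.norm_of_nonneg (by positivity)]
    nlinarith [(P.τ (P.S p)).cast_nonneg (α := ℝ)]

/-- Integrals over the base of quantities truncated at return time `N`. -/
lemma tendsto_setIntegral_truncated {u : ℝ × ℝ → ℝ} (hu : IntegrableOn u Y) :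
    Tendsto (fun N : ℕ => ∫ p in Y, if P.τ (P.S p) < N then u p else 0) atTop
      (𝓝 (∫ p in Y, u p)) := by
  refine tendsto_integral_of_dominated_convergence (fun p => |u p|) (fun N => ?_) hu.abs
    (fun N => ?_) ?_
  · exact (hu.aestronglyMeasurable.indicator (measurableSet_τ_lt (P := P) N)).congr
      (Eventually.of_forall fun p => by simp [indicator_apply])
  · refine Eventually.of_forall fun p => ?_
    split_ifs <;> simp
  · refine Eventually.of_forall fun p => tendsto_const_nhds.congr' ?_
    filter_upwards [eventually_gt_atTop (P.τ (P.S p))] with N hN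
    rw [if_pos hN]

lemma integrableOn_hd_mul_V (hf : Measurable f) (hB : ∀ q, |f q| ≤ B) :
    IntegrableOn (fun p => P.hd p * P.V f p) Y := by
  refine Integrable.bdd_mul (c := 2 * Real.exp P.rg) ?_ hd_mem.bm.meas.aestronglyMeasurable
    (ae_restrict_of_forall_mem measurableSet_Y fun q hq => ?_)
  · exact integrableOn_return_time.mono' (measurable_V hf).aestronglyMeasurable
      (Eventually.of_forall fun p => abs_V_le hB p)
  · rw [Real.norm_of_nonneg (hd_pos hq).le]
    exact hd_upper hq

section Invariant

variable {ν : Measure (ℝ × ℝ)} [IsProbabilityMeasure ν]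

lemma measureReal_Y_pos (hS : MeasurePreserving P.S ν ν) (hX : ν Xᶜ = 0) : 0 < ν.real Y := by
  refine measureReal_nonneg.lt_of_ne fun h => ?_
  have h1 : ν Y = 0 := (measureReal_eq_zero_iff).1 h.symm
  have h2 := measure_eq_zero hS hX preimage_univ MeasurableSet.univ (by rwa [univ_inter])
  simp at h2

/-- Kac's formula for the induced observable. -/
lemma setIntegral_hd_mul_V (hS : MeasurePreserving P.S ν ν) (hX : ν Xᶜ = 0) (hac : ν ≪ volume)
    (hf : Measurable f) (hB : ∀ q, |f q| ≤ B) (hf0 : ∫ q, f q ∂ν = 0) :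
    ∫ p in Y, P.hd p * P.V f p = 0 := by
  have hB0 : 0 ≤ B := (abs_nonneg _).trans (hB 0)
  have hInt : ∀ {u : ℝ × ℝ → ℝ} {b : ℝ}, Measurable u → (∀ q, |u q| ≤ b) → Integrable u ν :=
    fun hu hb => Integrable.of_bound hu.aestronglyMeasurable _ (Eventually.of_forall hb)
  have hHN : ∀ N, Integrable (P.HN f N) ν := fun N =>
    hInt (measurable_HN hf N) (b := N * B) fun q => (abs_bsum_le hB _ q).trans (by
      gcongr
      exact min_le_right _ _)
  have h1 : ∀ N, ∫ p in Y, (f p + P.HN f N (P.S p)) ∂ν = ∫ q, (P.HN f N q - P.HN f (N + 1) q) ∂ν := by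
    intro N
    rw [← integral_indicator measurableSet_Y, integral_congr_ae (g := fun q =>
      f q + P.HN f N (P.S q) - P.HN f (N + 1) q), integral_sub, integral_add, hf0, zero_add,
      hS.integral_comp_aesm (hHN N).aestronglyMeasurable, integral_sub (hHN N) (hHN (N + 1))]
    · exact hInt hf hB
    · exact hS.integrable_comp_self (hHN N)
    · exact (hInt hf hB).add (hS.integrable_comp_self (hHN N))
    · exact hHN _
    · have : ∀ᵐ q ∂ν, q ∈ X := hX
      filter_upwards [this] with q hq
      exact HN_succ hq N
  have h2 : Tendsto (fun N => ∫ q, (P.HN f N q - P.HN f (N + 1) q) ∂ν) atTop (𝓝 0) := by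
    have := tendsto_integral_of_dominated_convergence (μ := ν) (f := fun _ => (0 : ℝ))
      (F := fun N q => P.HN f N q - P.HN f (N + 1) q) (fun _ => B)
      (fun N => ((measurable_HN hf N).sub (measurable_HN hf (N + 1))).aestronglyMeasurable)
      (integrable_const B) (fun N => Eventually.of_forall fun q => abs_HN_sub_le hB N q)
      (Eventually.of_forall fun q => tendsto_const_nhds.congr' ?_)
    · simpa using this
    · filter_upwards [eventually_ge_atTop (P.τ q)] with N hN
      rw [HN, HN, min_eq_left hN, min_eq_left (by omega), sub_self]
  have h3 : Tendsto (fun N => ∫ p in Y, P.hd p * (f p + P.HN f N (P.S p))) atTop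
      (𝓝 (∫ p in Y, P.hd p * P.V f p)) := by
    refine tendsto_integral_of_dominated_convergence
      (fun p => 2 * Real.exp P.rg * (((P.τ (P.S p) : ℝ) + 1) * B)) (fun N => ?_)
      (integrableOn_return_time.const_mul _) (fun N => ?_) (Eventually.of_forall fun p => ?_)
    · exact (hd_mem.bm.meas.mul (hf.add
        ((measurable_HN hf N).comp P.measurable_S))).aestronglyMeasurable
    · refine ae_restrict_of_forall_mem measurableSet_Y fun p hp => ?_
      rw [norm_mul, Real.norm_of_nonneg (hd_pos hp).le]
      refine mul_le_mul (hd_upper hp) ?_ (norm_nonneg _) (by positivity)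
      have h4 : |P.HN f N (P.S p)| ≤ P.τ (P.S p) * B := (abs_bsum_le hB _ _).trans (by
        gcongr
        exact min_le_left _ _)
      rw [Real.norm_eq_abs]
      linarith [abs_add_le (f p) (P.HN f N (P.S p)), hB p]
    · refine tendsto_const_nhds.congr' ?_
      filter_upwards [eventually_ge_atTop (P.τ (P.S p))] with N hN
      rw [HN, min_eq_left hN, V_eq, H]
  have h4 := h3.const_mul (ν.real Y)
  simp only [← setIntegral_eq' hS hX hac, h1] at h4
  have h5 := tendsto_nhds_unique h4 h2
  rw [setIntegral_eq' hS hX hac] at h5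
  exact (mul_eq_zero.1 h5).resolve_left (measureReal_Y_pos hS hX).ne'

end Invariant

end LSVParams

namespace LSVParams

variable {P : LSVParams} {f : ℝ × ℝ → ℝ} {B : ℝ}

lemma abs_acc_hd_le (hB : ∀ q, |f q| ≤ B) {d : ℝ} (hd0 : 0 ≤ d) (hd : ∀ q ∈ Y, |P.hd q| ≤ d) (n : ℕ)
    {q : ℝ × ℝ} (hq : q ∈ Y) : |P.acc f P.hd n q| ≤ B * d * (((n : ℝ) + 1) * P.tb n) :=
  P.abs_acc_le_tb ((abs_nonneg _).trans (hB 0)) hd0 (fun q _ => hB q) hd n hq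

lemma setIntegral_ySum_acc (hf : Measurable f) (hB : ∀ q, |f q| ≤ B) :
    ∫ q in Y, ySum (P.acc f P.hd) q = ∫ p in Y, P.hd p * P.V f p := by
  obtain ⟨d, hd0, hd⟩ := (hd_mem (P := P)).bm.exists_bound
  have hfm := BM.of_abs_le hf ⟨B, hB⟩
  have h1 := tendsto_setIntegral_ySum (fun n => (P.bm_acc hfm hd_mem.bm n).meas)
    (P.summable_mul_tb.mul_left (B * d)) fun n q hq => P.abs_acc_hd_le hB hd0 hd n hq
  have h2 := tendsto_setIntegral_truncated (P := P) (integrableOn_hd_mul_V (P := P) hf hB)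
  refine tendsto_nhds_unique h1 (h2.congr fun N => ?_)
  simpa using (sum_setIntegral_acc_mul (P := P) hfm hd_mem.bm (BM.const 1) N).symm

/-- The correction which turns the induced observable into a martingale difference. -/
lemma exists_corrector (hf : Measurable f) (hB : ∀ q, |f q| ≤ B) {K : ℝ} (hK0 : 0 ≤ K)
    (hK : ∀ p ∈ X, ∀ q ∈ X, f p - f q ≤ K * P.κY 1 p q)
    (hV : ∫ p in Y, P.hd p * P.V f p = 0) :
    ∃ z, BM z ∧ ∀ q ∈ Y, z q = ySum (P.acc f P.hd) q + P.L z q := by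
  obtain ⟨d, hd0, hd⟩ := (hd_mem (P := P)).bm.exists_bound
  have hB0 : 0 ≤ B := (abs_nonneg _).trans (hB 0)
  have hfm := BM.of_abs_le hf ⟨B, hB⟩
  set c := B + K
  have hc0 : 0 ≤ c := by positivity
  have hκ : ∀ p ∈ X, ∀ q ∈ X, 0 ≤ P.κY 1 p q := fun p _ q _ => P.κY_nonneg zero_le_one p q
  have h1 := dn_ySum_acc (P := P) (hfm.add (BM.const c))
    (InCone.add_const hκ (fun q _ => hB q) hK0 hK le_rfl)
  have h2 := dn_ySum_acc (P := P) (BM.const c) (InCone.const hc0 hκ)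
  have hsum : ∀ b, Summable fun n : ℕ => b * d * (((n : ℝ) + 1) * P.tb n) :=
    fun b => P.summable_mul_tb.mul_left (b * d)
  have hψ : ySum (P.acc f P.hd) = fun q => ySum (P.acc (fun q => f q + c) P.hd) q +
      -1 * ySum (P.acc (fun _ => c) P.hd) q := by
    funext q
    by_cases hq : q ∈ Y
    · have e1 := hasSum_ySum (hsum B) (fun n q hq => P.abs_acc_hd_le hB hd0 hd n hq) hq
      have e2 := hasSum_ySum (hsum |c|)
        (fun n q hq => P.abs_acc_hd_le (f := fun _ => c) (fun _ => le_rfl) hd0 hd n hq) hq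
      have e3 := hasSum_ySum (hsum (B + |c|)) (fun n q hq =>
        P.abs_acc_hd_le (f := fun q => f q + c) (fun q => (abs_add_le _ _).trans
          (add_le_add_left (hB q) _)) hd0 hd n hq) hq
      rw [show (fun n => P.acc (fun q => f q + c) P.hd n q) = fun n => P.acc f P.hd n q +
        P.acc (fun _ => c) P.hd n q from funext fun n => by rw [acc_add]] at e3
      linarith [e3.unique (e1.add e2)]
    · simp [ySum, hq]
  refine exists_eq_add_L (K := 2 * Real.exp P.rg * ∫ q in Y, ySum (P.acc (fun _ => c) P.hd) q) ?_
    fun n q hq => ?_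
  · rw [hψ]
    exact h1.bm.add ((BM.const _).mul h2.bm)
  · have h3 : ∫ q in Y, ySum (P.acc (fun q => f q + c) P.hd) q =
        ∫ q in Y, ySum (P.acc (fun _ => c) P.hd) q := by
      have h4 := setIntegral_ySum_acc (P := P) hf hB
      rw [hV, hψ, integral_add h1.bm.integrableOn_Y (h2.bm.integrableOn_Y.const_mul _),
        integral_const_mul] at h4
      linarith
    have h5 := abs_iterate_L_sub_le h1 h2 h3 rfl n hq
    rw [hψ, h1.bm.iterate_L_add ((BM.const _).mul h2.bm), h2.bm.iterate_L_const_mul]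
    convert h5 using 2
    ring

/-- The quotient of `u` by the invariant density, on the base. -/
def quo (P : LSVParams) (u : ℝ × ℝ → ℝ) : ℝ × ℝ → ℝ := Y.indicator fun q => u q / P.hd q

lemma hd_mul_quo (u : ℝ × ℝ → ℝ) {q : ℝ × ℝ} (hq : q ∈ Y) : P.hd q * P.quo u q = u q := by
  rw [quo, indicator_of_mem hq, mul_div_cancel₀ _ (hd_pos hq).ne']

lemma measurable_quo {u : ℝ × ℝ → ℝ} (hu : Measurable u) : Measurable (P.quo u) :=
  (hu.div hd_mem.bm.meas).indicator measurableSet_Y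

lemma abs_quo_le {u : ℝ × ℝ → ℝ} {b : ℝ} (h0 : 0 ≤ b) (hu : ∀ q ∈ Y, |u q| ≤ b) (q : ℝ × ℝ) :
    |P.quo u q| ≤ b / (2 * Real.exp (-P.rg)) := by
  by_cases hq : q ∈ Y
  · rw [quo, indicator_of_mem hq, abs_div, abs_of_pos (hd_pos hq)]
    exact div_le_div₀ h0 (hu q hq) (by positivity) (hd_lower hq)
  · rw [quo, indicator_of_notMem hq, abs_zero]
    positivity

lemma abs_partial_sum_le {U y : ℕ → ℝ} (hU : HasSum U 0) (hy : Summable y)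
    (h : ∀ n, |U n| ≤ y n) (N : ℕ) : |∑ n ∈ Finset.range N, U n| ≤ ∑' m, y (N + m) := by
  have := dist_le_tsum_of_dist_le_of_tendsto (f := fun N => ∑ n ∈ Finset.range N, U n) y
    (fun n => by
      rw [dist_comm, Real.dist_eq, Finset.sum_range_succ, add_sub_cancel_left]
      exact h n) hy hU.tendsto_sum_nat N
  simpa using this

end LSVParams

namespace LSVParams

variable {P : LSVParams} {f z : ℝ × ℝ → ℝ} {B : ℝ}

/-- The martingale difference built from the corrector `z`. -/
def mart (P : LSVParams) (f z : ℝ × ℝ → ℝ) : ℝ × ℝ → ℝ :=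
  Y.indicator fun p => P.V f p + P.quo z p - P.quo z (P.F p)

/-- The contribution to the transferred martingale difference of the points which return at time
`n + 1`. -/
def defectTerm (P : LSVParams) (f z : ℝ × ℝ → ℝ) (n : ℕ) (q : ℝ × ℝ) : ℝ :=
  P.acc f P.hd n q + P.Tn n z q - P.quo z q * P.Tn n P.hd q

/-- The conditional expectation of the martingale difference truncated at return time `K`. -/
def defect (P : LSVParams) (f z : ℝ × ℝ → ℝ) (K : ℕ) : ℝ × ℝ → ℝ :=
  P.quo fun q => ∑ n ∈ Finset.range K, P.defectTerm f z n q

lemma bm_quo (hz : BM z) : BM (P.quo z) := by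
  obtain ⟨b, h0, hb⟩ := hz.exists_bound
  exact BM.of_abs_le (measurable_quo hz.meas) ⟨_, abs_quo_le h0 hb⟩

lemma bm_defectTerm (hf : BM f) (hz : BM z) (n : ℕ) : BM (P.defectTerm f z n) := by
  have hh := (hd_mem (P := P)).bm
  have h := ((P.bm_acc hf hh n).add (P.bm_Tn hz n)).add
    ((BM.const (-1)).mul ((bm_quo (P := P) hz).mul (P.bm_Tn hh n)))
  convert h using 2
  rw [defectTerm]
  ring

lemma exists_defect_bound (hB : ∀ q, |f q| ≤ B) (hz : BM z)
    (hzL : ∀ q ∈ Y, z q = ySum (P.acc f P.hd) q + P.L z q) :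
    ∃ ε : ℕ → ℝ, Tendsto ε atTop (𝓝 0) ∧ ∀ K q, |P.defect f z K q| ≤ ε K := by
  obtain ⟨d, hd0, hd⟩ := (hd_mem (P := P)).bm.exists_bound
  obtain ⟨b, hb0, hb⟩ := hz.exists_bound
  have hB0 : 0 ≤ B := (abs_nonneg _).trans (hB 0)
  have hg := abs_quo_le (P := P) hb0 hb
  set a := b / (2 * Real.exp (-P.rg))
  have ha0 : 0 ≤ a := by positivity
  have hsum := P.summable_mul_tb.mul_left (B * d)
  set y : ℕ → ℝ := fun n => B * d * (((n : ℝ) + 1) * P.tb n) + b * P.tb n + a * (d * P.tb n)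
  have hy : Summable y :=
    (hsum.add (P.summable_tb.mul_left b)).add ((P.summable_tb.mul_left d).mul_left a)
  have hbound : ∀ n, ∀ q ∈ Y, |P.defectTerm f z n q| ≤ y n := fun n q hq => by
    refine (abs_sub _ _).trans (add_le_add ((abs_add_le _ _).trans (add_le_add
      (P.abs_acc_hd_le hB hd0 hd n hq) (P.abs_Tn_le_tb hb0 hb n hq))) ?_)
    rw [abs_mul]
    exact mul_le_mul (hg q) (P.abs_Tn_le_tb hd0 hd n hq) (abs_nonneg _) ha0
  have hzero : ∀ q ∈ Y, HasSum (fun n => P.defectTerm f z n q) 0 := fun q hq => by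
    have h1 := ((hasSum_ySum hsum (fun n q hq => P.abs_acc_hd_le hB hd0 hd n hq) hq).add
      (hz.hasSum_L (P := P) hq)).sub (((hd_mem (P := P)).bm.hasSum_L (P := P) hq).mul_left (P.quo z q))
    rw [L_hd, mul_comm (P.quo z q) (P.hd q), hd_mul_quo z hq] at h1
    have h2 : ySum (P.acc f P.hd) q + P.L z q - z q = 0 := sub_eq_zero.2 (hzL q hq).symm
    exact h2 ▸ h1
  refine ⟨fun K => (∑' m, y (K + m)) / (2 * Real.exp (-P.rg)), ?_, fun K q => ?_⟩
  · have := (tendsto_sum_nat_add y).div_const (2 * Real.exp (-P.rg))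
    simp only [zero_div] at this
    exact this.congr fun K => by simp only [add_comm]
  · refine abs_quo_le (tsum_nonneg fun m => ?_)
      (fun q hq => abs_partial_sum_le (hzero q hq) hy (fun n => hbound n q hq) K) q
    have h1 := P.tb_nonneg (K + m)
    positivity

section Invariant

variable {ν : Measure (ℝ × ℝ)} [IsProbabilityMeasure ν]

lemma setIntegral_mart_mul (hS : MeasurePreserving P.S ν ν) (hX : ν Xᶜ = 0) (hac : ν ≪ volume)
    (hf : Measurable f) (hB : ∀ q, |f q| ≤ B) (hz : BM z) {G : ℝ × ℝ → ℝ} (hG : BM G) (K : ℕ) :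
    ∫ p in Y, (if P.τ (P.S p) < K then P.mart f z p else 0) * G (P.F p) ∂ν =
      ∫ p in Y, P.defect f z K p * G p ∂ν := by
  have hfm := BM.of_abs_le hf ⟨B, hB⟩
  have hB0 : 0 ≤ B := (abs_nonneg _).trans (hB 0)
  have hg := bm_quo (P := P) hz
  have hh := (hd_mem (P := P)).bm
  rw [setIntegral_eq' hS hX hac, setIntegral_eq' hS hX hac]
  congr 1
  have hlt := measurableSet_τ_lt (P := P) K
  have hV : BM fun p => if P.τ (P.S p) < K then P.V f p else 0 := by
    refine BM.of_abs_le ((measurable_V hf).ite hlt measurable_const) ⟨K * B, fun p => ?_⟩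
    split_ifs with h
    · refine (abs_V_le hB p).trans (mul_le_mul_of_nonneg_right ?_ hB0)
      exact_mod_cast h
    · rw [abs_zero]
      positivity
  have e1 := sum_setIntegral_acc_mul (P := P) hfm hh hG K
  have e2 := sum_setIntegral_Tn_mul (P := P) hz hG (fun _ => 1) K
  have e3 := sum_setIntegral_Tn_mul (P := P) hh (hg.mul hG) (fun _ => 1) K
  have i1 : BM fun p => if P.τ (P.S p) < K then P.hd p * P.V f p * G (P.F p) else 0 := by
    convert (hh.mul hV).mul (hG.comp_F (P := P)) using 2
    split_ifs <;> simp
  have i2 : BM fun p => if P.τ (P.S p) < K then 1 * (z p * G (P.F p)) else 0 :=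
    ((BM.const 1).mul (hz.mul (hG.comp_F (P := P)))).ite (BM.const 0) hlt
  have i3 : BM fun p => if P.τ (P.S p) < K then
      1 * (P.hd p * (P.quo z (P.F p) * G (P.F p))) else 0 :=
    ((BM.const 1).mul (hh.mul ((hg.mul hG).comp_F (P := P)))).ite (BM.const 0) hlt
  have h1 : ∫ p in Y, P.hd p * ((if P.τ (P.S p) < K then P.mart f z p else 0) * G (P.F p)) =
      (∫ p in Y, if P.τ (P.S p) < K then P.hd p * P.V f p * G (P.F p) else 0) +
      (∫ p in Y, if P.τ (P.S p) < K then 1 * (z p * G (P.F p)) else 0) -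
      ∫ p in Y, if P.τ (P.S p) < K then 1 * (P.hd p * (P.quo z (P.F p) * G (P.F p))) else 0 := by
    rw [← integral_add i1.integrableOn_Y i2.integrableOn_Y,
      ← integral_sub (i1.add i2).integrableOn_Y i3.integrableOn_Y]
    refine setIntegral_congr_fun measurableSet_Y fun p hp => ?_
    simp only [mart, indicator_of_mem hp]
    split_ifs
    · rw [← hd_mul_quo (P := P) z hp]
      ring
    · simp
  rw [h1, ← e1, ← e2, ← e3, ← Finset.sum_add_distrib, ← Finset.sum_sub_distrib]
  rw [setIntegral_congr_fun measurableSet_Y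
    (g := fun q => ∑ n ∈ Finset.range K, P.defectTerm f z n q * G q) fun q hq => by
      simp only [defect]
      rw [← mul_assoc, hd_mul_quo _ hq, Finset.sum_mul],
    integral_finsetSum _ fun n _ => ((bm_defectTerm hfm hz n).mul hG).integrableOn_Y]
  refine Finset.sum_congr rfl fun n _ => ?_
  have j1 := (P.bm_acc hfm hh n).mul hG
  have j2 := (P.bm_Tn hz n).mul hG
  have j3 := (P.bm_Tn hh n).mul (hg.mul hG)
  rw [one_mul, one_mul, ← integral_add j1.integrableOn_Y j2.integrableOn_Y,
    ← integral_sub (j1.add j2).integrableOn_Y j3.integrableOn_Y]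
  refine setIntegral_congr_fun measurableSet_Y fun q _ => ?_
  simp only [defectTerm]
  ring

lemma setIntegral_sq_mul_le {d : ℝ} (hd0 : 0 ≤ d) (hd : ∀ q ∈ Y, |P.hd q| ≤ d)
    {G : ℝ × ℝ → ℝ} (hG : Measurable G) (hGb : ∃ b, ∀ q, |G q| ≤ b) (hG0 : ∀ q, 0 ≤ G q) :
    ∫ p in Y, ((P.τ (P.S p) : ℝ) + 1) ^ 2 * (P.hd p * G (P.F p)) ≤
      d * (∑' n : ℕ, ((n : ℝ) + 1) ^ 2 * P.tb n) * ∫ q in Y, G q := by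
  have hGm := BM.of_abs_le hG hGb
  obtain ⟨b, hb⟩ := hGb
  have hInt : IntegrableOn (fun p => ((P.τ (P.S p) : ℝ) + 1) ^ 2 * (P.hd p * G (P.F p))) Y := by
    refine Integrable.mul_bdd (c := d * b) integrableOn_sq_return_time
      (hd_mem.bm.mul hGm.comp_F).meas.aestronglyMeasurable
      (ae_restrict_of_forall_mem measurableSet_Y fun q hq => ?_)
    rw [norm_mul]
    exact mul_le_mul (hd q hq) (hb _) (norm_nonneg _) hd0
  have hG0' : 0 ≤ ∫ q in Y, G q := integral_nonneg hG0
  refine le_of_tendsto (tendsto_setIntegral_truncated (P := P) hInt) (Eventually.of_forall fun N => ?_)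
  rw [← sum_setIntegral_Tn_mul hd_mem.bm hGm (fun n => ((n : ℝ) + 1) ^ 2) N]
  have h1 : ∀ n ∈ Finset.range N, ((n : ℝ) + 1) ^ 2 * ∫ q in Y, P.Tn n P.hd q * G q ≤
      d * (∫ q in Y, G q) * (((n : ℝ) + 1) ^ 2 * P.tb n) := fun n _ => by
    have h2 : ∫ q in Y, P.Tn n P.hd q * G q ≤ ∫ q in Y, d * P.tb n * G q :=
      setIntegral_mono_on ((P.bm_Tn hd_mem.bm n).mul hGm).integrableOn_Y
        ((BM.const _).mul hGm).integrableOn_Y measurableSet_Y fun q hq =>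
          mul_le_mul_of_nonneg_right ((le_abs_self _).trans (P.abs_Tn_le_tb hd0 hd n hq)) (hG0 q)
    rw [integral_const_mul] at h2
    have h3 := mul_le_mul_of_nonneg_left h2 (by positivity : 0 ≤ ((n : ℝ) + 1) ^ 2)
    linarith
  refine (Finset.sum_le_sum h1).trans ?_
  rw [← Finset.mul_sum, mul_right_comm d (∑' n : ℕ, _)]
  refine mul_le_mul_of_nonneg_left (P.summable_sq_mul_tb.sum_le_tsum _ fun n _ => ?_)
    (mul_nonneg hd0 hG0')
  exact mul_nonneg (by positivity) (P.tb_nonneg n)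

lemma exists_returnMartingale (hS : MeasurePreserving P.S ν ν) (hX : ν Xᶜ = 0) (hac : ν ≪ volume)
    (hf : Measurable f) (hB : ∀ q, |f q| ≤ B) (hz : BM z)
    (hzL : ∀ q ∈ Y, z q = ySum (P.acc f P.hd) q + P.L z q) :
    ∃ (ε : ℕ → ℝ) (c C : ℝ),
      ReturnMartingale ν P.S Y P.τ (P.mart f z) (P.defect f z) ε c C := by
  obtain ⟨d, hd0, hd⟩ := (hd_mem (P := P)).bm.exists_bound
  obtain ⟨b, hb0, hb⟩ := hz.exists_bound
  obtain ⟨ε, hε, hw⟩ := exists_defect_bound hB hz hzL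
  have hfm := BM.of_abs_le hf ⟨B, hB⟩
  have hB0 : 0 ≤ B := (abs_nonneg _).trans (hB 0)
  have hg := abs_quo_le (P := P) hb0 hb
  have hT : 0 ≤ ∑' n : ℕ, ((n : ℝ) + 1) ^ 2 * P.tb n :=
    tsum_nonneg fun n => mul_nonneg (by positivity) (P.tb_nonneg n)
  set T := ∑' n : ℕ, ((n : ℝ) + 1) ^ 2 * P.tb n
  set a := b / (2 * Real.exp (-P.rg))
  have ha0 : 0 ≤ a := by positivity
  have hqm := measurable_quo (P := P) hz.meas
  refine ⟨ε, B + 2 * a, d * T / (2 * Real.exp (-P.rg)), ?_, ?_, by positivity, by positivity, ?_,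
    integrableOn_of_volume hS hX hac integrableOn_sq_return_time, ?_, ?_, hε, hw, ?_⟩
  · exact (((measurable_V hf).add hqm).sub (hqm.comp measurable_F)).indicator measurableSet_Y
  · exact fun q hq => indicator_of_notMem hq _
  · intro p hp
    rw [mart, indicator_of_mem hp]
    have h1 := abs_V_le (P := P) hB p
    have h2 := abs_sub (P.V f p + P.quo z p) (P.quo z (P.F p))
    have h3 := abs_add_le (P.V f p) (P.quo z p)
    have h4 : 0 ≤ a * P.τ (P.S p) := by positivity
    linarith [hg p, hg (P.F p)]
  · intro G hG hGb hG0
    have h1 := setIntegral_sq_mul_le hd0 hd hG hGb hG0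
    have hGm := BM.of_abs_le hG hGb
    rw [setIntegral_eq' hS hX hac, setIntegral_eq' hS hX hac]
    have h2 : 2 * Real.exp (-P.rg) * ∫ q in Y, G q ≤ ∫ q in Y, P.hd q * G q := by
      rw [← integral_const_mul]
      exact setIntegral_mono_on ((BM.const _).mul hGm).integrableOn_Y
        (hd_mem.bm.mul hGm).integrableOn_Y measurableSet_Y fun q hq =>
          mul_le_mul_of_nonneg_right (hd_lower hq) (hG0 q)
    have h3 : ∫ p in Y, P.hd p * (((P.τ (P.S p) : ℝ) + 1) ^ 2 * G (hitMap P.S P.τ (P.S p))) =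
        ∫ p in Y, ((P.τ (P.S p) : ℝ) + 1) ^ 2 * (P.hd p * G (P.F p)) :=
      setIntegral_congr_fun measurableSet_Y fun p _ => mul_left_comm _ _ _
    rw [h3, mul_left_comm]
    refine mul_le_mul_of_nonneg_left (h1.trans ?_) measureReal_nonneg
    rw [div_mul_eq_mul_div, le_div_iff₀ (by positivity), mul_assoc]
    refine mul_le_mul_of_nonneg_left ?_ (by positivity)
    linarith
  · exact fun K => measurable_quo (Finset.measurable_fun_sum _ fun n _ => (bm_defectTerm hfm hz n).meas)
  · exact fun K G hG hGb => setIntegral_mart_mul hS hX hac hf hB hz (BM.of_abs_le hG hGb) K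

lemma eq_mart_add (f z : ℝ × ℝ → ℝ) {q : ℝ × ℝ} (hq : q ∈ X) :
    f q = P.mart f z q + (P.H f q - P.quo z (hitMap P.S P.τ q)) -
      (P.H f (P.S q) - P.quo z (hitMap P.S P.τ (P.S q))) := by
  by_cases h : q ∈ Y
  · rw [mart, indicator_of_mem h, V_eq, H_of_mem h, P.hitting.hitMap_of_mem h, F]
    ring
  · rw [mart, indicator_of_notMem h, H_of_notMem hq h, P.hitting.hitMap_of_notMem hq h]
    ring

theorem exists_tendsto (hS : MeasurePreserving P.S ν ν) (hX : ν Xᶜ = 0) (hac : ν ≪ volume)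
    (hf : Measurable f) (hB : ∀ q, |f q| ≤ B) {K : ℝ} (hK0 : 0 ≤ K)
    (hK : ∀ p ∈ X, ∀ q ∈ X, f p - f q ≤ K * P.κY 1 p q) (hf0 : ∫ q, f q ∂ν = 0) :
    ∃ σ2 : NNReal, ∀ g : BoundedContinuousFunction ℝ ℝ,
      Tendsto (fun n : ℕ => ∫ p, g (bsum P.S f n p / √n) ∂ν) atTop
        (𝓝 (∫ x, g x ∂ProbabilityTheory.gaussianReal 0 σ2)) := by
  obtain ⟨z, hz, hzL⟩ := exists_corrector hf hB hK0 hK (setIntegral_hd_mul_V hS hX hac hf hB hf0)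
  obtain ⟨ε, c, C, hM⟩ := exists_returnMartingale hS hX hac hf hB hz hzL
  refine hM.exists_tendsto P.hitting (ergodic hS hX hac) hX hf ((measurable_H (P := P) hf).sub
    ((measurable_quo (P := P) hz.meas).comp P.hitting.measurable_hitMap)) ?_
  have : ∀ᵐ q ∂ν, q ∈ X := hX
  filter_upwards [this] with q hq
  exact eq_mart_add f z hq

end Invariant

end LSVParams

lemma continuousOn_of_abs_sub_le_dist_rpow {Ω : Type*} [PseudoMetricSpace Ω] {f : Ω → ℝ} {Z : Set Ω}
    {C t : ℝ} (ht : 0 < t) (h : ∀ p ∈ Z, ∀ q ∈ Z, |f p - f q| ≤ C * dist p q ^ t) :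
    ContinuousOn f Z := by
  intro q hq
  rw [ContinuousWithinAt, tendsto_iff_dist_tendsto_zero]
  have h1 : Continuous fun p => C * dist p q ^ t :=
    continuous_const.mul ((continuous_id.dist continuous_const).rpow_const fun _ => Or.inr ht.le)
  have h2 := (h1.tendsto q).mono_left (nhdsWithin_le_nhds (s := Z))
  rw [dist_self, Real.zero_rpow ht.ne', mul_zero] at h2
  exact squeeze_zero' (Eventually.of_forall fun _ => dist_nonneg)
    (eventually_mem_nhdsWithin.mono fun p hp => h p hp q hq) h2

lemma LSVParams.measure_compl_X {ν : Measure (ℝ × ℝ)} (hac : ν ≪ volume)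
    (hsupp : ν ((Icc (0 : ℝ) 1 ×ˢ Icc (0 : ℝ) 1)ᶜ) = 0) : ν Xᶜ = 0 := by
  have h1 : (Xᶜ : Set (ℝ × ℝ)) ⊆ (Icc (0 : ℝ) 1 ×ˢ Icc (0 : ℝ) 1)ᶜ ∪
      (({0} : Set ℝ) ×ˢ univ ∪ univ ×ˢ ({1} : Set ℝ)) := by
    rintro ⟨x, ω⟩ hq
    by_contra h
    simp only [mem_union, mem_compl_iff, mem_prod, mem_Icc, mem_singleton_iff, mem_univ, and_true,
      true_and, not_or, not_not] at h
    obtain ⟨⟨⟨h1, h2⟩, h3, h4⟩, h5, h6⟩ := h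
    exact hq ⟨⟨lt_of_le_of_ne h1 (Ne.symm h5), h2⟩, h3, lt_of_le_of_ne h4 h6⟩
  refine measure_mono_null h1 (measure_union_null hsupp (hac (measure_union_null ?_ ?_))) <;>
    rw [Measure.volume_eq_prod, Measure.prod_prod] <;> simp

/-- Theorem 3.2 (1): CLT for Hölder observables when `α < 1/2`. -/
theorem clt_small_alpha (α β p₁ : ℝ) (hα : 0 < α) (hα2 : α < 1 / 2) (hαβ : α < β) (hβ : β < 1)
    (hp₁ : 0 < p₁) (hp₁' : p₁ < 1)
    (ν : Measure (ℝ × ℝ)) (hprob : IsProbabilityMeasure ν)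
    (hac : ν ≪ (volume : Measure (ℝ × ℝ)))
    (hsupp : ν ((Icc (0 : ℝ) 1 ×ˢ Icc (0 : ℝ) 1)ᶜ) = 0)
    (hinv : ∀ A : Set (ℝ × ℝ), MeasurableSet A → ν (skewLSV α β p₁ ⁻¹' A) = ν A)
    (f : ℝ × ℝ → ℝ)
    (hf : ∃ C t : ℝ, 0 < t ∧ t ≤ 1 ∧
      ∀ p ∈ Icc (0 : ℝ) 1 ×ˢ Icc (0 : ℝ) 1, ∀ q ∈ Icc (0 : ℝ) 1 ×ˢ Icc (0 : ℝ) 1,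
        |f p - f q| ≤ C * dist p q ^ t)
    (hf0 : (∫ p, f p ∂ν) = 0) :
    ∃ σ2 : NNReal, ∀ g : BoundedContinuousFunction ℝ ℝ,
      Tendsto (fun n : ℕ => ∫ p, g (birkhoff α β p₁ f n p / Real.sqrt n) ∂ν) atTop
        (𝓝 (∫ x, g x ∂(ProbabilityTheory.gaussianReal 0 σ2))) := by
  obtain ⟨C, t, ht0, ht1, hC⟩ := hf
  let P : LSVParams := ⟨α, β, p₁, t, hα, hα2, hαβ, hβ, hp₁, hp₁', ht0, ht1⟩
  have hXsub : LSVParams.X ⊆ Icc (0 : ℝ) 1 ×ˢ Icc (0 : ℝ) 1 :=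
    prod_mono Ioc_subset_Icc_self Ico_subset_Icc_self
  have hX := LSVParams.measure_compl_X hac hsupp
  have hS : MeasurePreserving P.S ν ν :=
    ⟨P.measurable_S, Measure.ext fun A hA => by
      rw [Measure.map_apply P.measurable_S hA]
      exact hinv A hA⟩
  have hae : ∀ᵐ q ∂ν, q ∈ LSVParams.X := hX
  have hfC : ∀ p ∈ LSVParams.X, ∀ q ∈ LSVParams.X, |f p - f q| ≤ |C| * dist p q ^ t :=
    fun p hp q hq => (hC p (hXsub hp) q (hXsub hq)).trans
      (mul_le_mul_of_nonneg_right (le_abs_self C) (Real.rpow_nonneg dist_nonneg _))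
  classical
  have hmeas : Measurable (LSVParams.X.indicator f) := by
    rw [← piecewise_eq_indicator]
    exact (continuousOn_of_abs_sub_le_dist_rpow ht0 hfC).measurable_piecewise
      continuousOn_const LSVParams.measurableSet_X
  have h0 : ((1 : ℝ), (0 : ℝ)) ∈ LSVParams.X := by simp [LSVParams.X]
  have hB : ∀ q, |LSVParams.X.indicator f q| ≤ |f (1, 0)| + |C| := by
    intro q
    by_cases hq : q ∈ LSVParams.X
    · rw [indicator_of_mem hq]
      have h1 := hfC q hq _ h0
      have h2 : dist q (1, 0) ^ t ≤ 1 := P.dist_rpow_le_one hq h0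
      have h3 := mul_le_mul_of_nonneg_left h2 (abs_nonneg C)
      linarith [abs_sub_abs_le_abs_sub (f q) (f (1, 0))]
    · rw [indicator_of_notMem hq, abs_zero]
      positivity
  have hK : ∀ p ∈ LSVParams.X, ∀ q ∈ LSVParams.X,
      LSVParams.X.indicator f p - LSVParams.X.indicator f q ≤ |C| * P.κY 1 p q := by
    intro p hp q hq
    rw [indicator_of_mem hp, indicator_of_mem hq, LSVParams.κY, one_mul]
    exact (le_abs_self _).trans (hfC p hp q hq)
  have hf0' : ∫ q, LSVParams.X.indicator f q ∂ν = 0 := by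
    rw [← hf0]
    refine integral_congr_ae ?_
    filter_upwards [hae] with q hq
    rw [indicator_of_mem hq]
  obtain ⟨σ2, h⟩ := LSVParams.exists_tendsto hS hX hac hmeas hB (abs_nonneg C) hK hf0'
  refine ⟨σ2, fun g => (h g).congr fun n => integral_congr_ae ?_⟩
  filter_upwards [hae] with q hq
  have hiter : ∀ k, P.S^[k] q ∈ LSVParams.X := fun k => by
    induction k with
    | zero => exact hq
    | succ k ih =>
      rw [Function.iterate_succ_apply']
      exact P.mapsTo_S ih
  have hsum : bsum P.S (LSVParams.X.indicator f) n q = birkhoff α β p₁ f n q :=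
    Finset.sum_congr rfl fun k _ => indicator_of_mem (hiter k) f
  rw [hsum]
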